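/- Let δ ∈ (0, 1/2) satisfy 12·10^{2δ} < ln(1/(2δ)). Then there exists x₀ such that for every real x ≥ x₀ and every integer N there exists an integer b such that: for every integer n with 1 ≤ n ≤ y there is a prime p ≤ x dividing n − b, and for every integer n with −y ≤ n ≤ −1 there is a prime p ≤ x dividing n + N + b; equivalently, S_x(b) ∩ [1, y] = ∅ and S_x(−N − b) ∩ [−y, −1] = ∅, where y = ⌈x(ln x)^δ⌉. -/

import Mathlib

open scoped Classical

noncomputable def yy (δ x : ℝ) : ℕ := ⌈x * Real.log x ^ δ⌉₊

noncomputable def zz (δ x : ℝ) : ℝ :=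
  (yy δ x : ℝ) * Real.log (Real.log x) ^ 2 / Real.log x ^ (1/2 : ℝ)

noncomputable def primesUpTo (t : ℝ) : Finset ℕ :=
  (Finset.range (⌊t⌋₊ + 1)).filter fun p => p.Prime ∧ (p : ℝ) ≤ t

noncomputable def PP (t : ℝ) : ℕ := ∏ p ∈ primesUpTo t, p

noncomputable def sigUpTo (t : ℝ) : ℝ := ∏ p ∈ primesUpTo t, (1 - 1 / (p : ℝ))

noncomputable def primesBetween (w t : ℝ) : Finset ℕ :=
  (Finset.range (⌊t⌋₊ + 1)).filter fun p => p.Prime ∧ w < (p : ℝ) ∧ (p : ℝ) ≤ t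

noncomputable def sigBetween (w t : ℝ) : ℝ := ∏ p ∈ primesBetween w t, (1 - 1 / (p : ℝ))

def inS (t : ℝ) (b n : ℤ) : Prop :=
  ∀ p : ℕ, p.Prime → (p : ℝ) ≤ t → ¬ ((p : ℤ) ∣ (n - b))

def inSBetween (w t : ℝ) (b n : ℤ) : Prop :=
  ∀ p : ℕ, p.Prime → w < (p : ℝ) → (p : ℝ) ≤ t → ¬ ((p : ℤ) ∣ (n - b))

noncomputable def countS (t : ℝ) (b lo hi : ℤ) : ℕ :=
  ((Finset.Icc lo hi).filter (inS t b)).card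

noncomputable def EE (δ x : ℝ) (g : ℤ → ℝ) : ℝ :=
  (1 / (PP (zz δ x) : ℝ)) * ∑ b ∈ Finset.range (PP (zz δ x)), g (b : ℤ)

def frakH (δ ξ x : ℝ) : Set ℝ :=
  {H | ∃ j : ℕ, H = ξ ^ j ∧ 2 * (yy δ x : ℝ) / x ≤ H ∧ H ≤ (yy δ x : ℝ) / (ξ * zz δ x)}

def frakH1 (δ ξ x : ℝ) : Set ℝ :=
  {H | ∃ j : ℕ, Even j ∧ H = ξ ^ j ∧ 2 * (yy δ x : ℝ) / x ≤ H ∧ H ≤ (yy δ x : ℝ) / (ξ * zz δ x)}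

def frakH2 (δ ξ x : ℝ) : Set ℝ :=
  {H | ∃ j : ℕ, Odd j ∧ H = ξ ^ j ∧ 2 * (yy δ x : ℝ) / x ≤ H ∧ H ≤ (yy δ x : ℝ) / (ξ * zz δ x)}

noncomputable def QH (δ ξ x H : ℝ) : Finset ℕ :=
  (Finset.range (⌊(yy δ x : ℝ) / H⌋₊ + 1)).filter fun q =>
    q.Prime ∧ (yy δ x : ℝ) / (ξ * H) < (q : ℝ) ∧ (q : ℝ) ≤ (yy δ x : ℝ) / H

noncomputable def Hq (δ ξ x : ℝ) (q : ℕ) : ℝ :=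
  if h : ∃ H ∈ frakH δ ξ x, (yy δ x : ℝ) / (ξ * H) < (q : ℝ) ∧ (q : ℝ) ≤ (yy δ x : ℝ) / H
  then h.choose else 1

noncomputable def APset (M : ℝ) (K : ℕ) (b : ℤ) (H : ℝ) (q : ℕ) (n : ℤ) : Finset ℤ :=
  ((Finset.Icc 1 ⌊(K : ℝ) * H⌋₊).image fun h : ℕ => n + (q : ℤ) * (h : ℤ)).filter (inS (H ^ M) b)

noncomputable def lam (M zv : ℝ) (K : ℕ) (b : ℤ) (H : ℝ) (q : ℕ) (n : ℤ) : ℝ :=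
  if ∀ m ∈ APset M K b H q n, inSBetween (H ^ M) zv b m
  then sigBetween (H ^ M) zv ^ (-((APset M K b H q n).card : ℤ))
  else 0

noncomputable def APsetStar (M : ℝ) (K : ℕ) (N b : ℤ) (H : ℝ) (q : ℕ) (n : ℤ) : Finset ℤ :=
  ((Finset.Icc 1 ⌊(K : ℝ) * H⌋₊).image fun h : ℕ => n - (q : ℤ) * (h : ℤ)).filter (inS (H ^ M) (-N - b))

noncomputable def lamStar (M zv : ℝ) (K : ℕ) (N b : ℤ) (H : ℝ) (q : ℕ) (n : ℤ) : ℝ :=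
  if ∀ m ∈ APsetStar M K N b H q n, inSBetween (H ^ M) zv (-N - b) m
  then sigBetween (H ^ M) zv ^ (-((APsetStar M K N b H q n).card : ℤ))
  else 0

namespace SieveGap

/-- The weight `log k / k` on primes. -/
noncomputable def primeLogDiv (k : ℕ) : ℝ := if k.Prime then Real.log k / k else 0

lemma log_factorial_eq_sum (n : ℕ) :
    Real.log (n.factorial : ℝ) =
      ∑ p ∈ (Finset.Icc 0 n).filter Nat.Prime, (n.factorial.factorization p : ℝ) * Real.log p := by
  have h0 : n.factorial ≠ 0 := Nat.factorial_ne_zero n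
  have h1 := Nat.prod_factorization_pow_eq_self h0
  conv_lhs => rw [← h1]
  rw [Finsupp.prod, Nat.cast_prod, Real.log_prod]
  · rw [Nat.support_factorization]
    have : n.factorial.primeFactors ⊆ (Finset.Icc 0 n).filter Nat.Prime := by
      intro p hp
      have := Nat.mem_primeFactors.mp hp
      simp only [Finset.mem_filter, Finset.mem_Icc]
      exact ⟨⟨by omega, (Nat.Prime.dvd_factorial this.1).mp this.2.1⟩, this.1⟩
    rw [← Finset.sum_subset this]
    · refine Finset.sum_congr rfl fun p _ => ?_
      push_cast
      rw [Real.log_pow]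
    · intro p _ hp
      rw [← Nat.support_factorization, Finsupp.notMem_support_iff] at hp
      simp [hp]
  · intro p hp
    rw [Nat.support_factorization] at hp
    have := (Nat.prime_of_mem_primeFactors hp).pos
    positivity

lemma summable_log_div_sq : Summable fun k : ℕ => 4 / (k : ℝ) ^ (3/2 : ℝ) := by
  simpa [div_eq_mul_inv] using (Real.summable_nat_rpow_inv.mpr (by norm_num : (1:ℝ) < 3/2)).mul_left 4

/-- The first theorem of Mertens at natural numbers. -/
lemma exists_abs_sum_primeLogDiv_sub_log_le_nat :
    ∃ C : ℝ, 0 < C ∧ ∀ n : ℕ, 1 ≤ n →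
      |∑ k ∈ Finset.Icc 0 n, primeLogDiv k - Real.log n| ≤ C := by
  set T : ℝ := ∑' k : ℕ, 4 / (k : ℝ) ^ (3/2 : ℝ) with hT
  have hT0 : 0 ≤ T := tsum_nonneg fun k => by positivity
  refine ⟨T + 1 + Real.log 4, by positivity, fun n hn => ?_⟩
  have hn0 : (0 : ℝ) < n := by exact_mod_cast hn
  have hsum : ∑ k ∈ Finset.Icc 0 n, primeLogDiv k
      = ∑ p ∈ (Finset.Icc 0 n).filter Nat.Prime, Real.log p / p := by
    rw [Finset.sum_filter]; rfl
  have hl4 : 0 ≤ Real.log 4 := Real.log_nonneg (by norm_num)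
  rw [abs_le, hsum]
  constructor
  · -- lower bound
    have h1 : Real.log (n.factorial : ℝ) ≤
        ∑ p ∈ (Finset.Icc 0 n).filter Nat.Prime,
          (n * (Real.log p / p) + n * (4 / (p : ℝ) ^ (3/2 : ℝ))) := by
      rw [log_factorial_eq_sum]
      refine Finset.sum_le_sum fun p hp => ?_
      have hp := (Finset.mem_filter.mp hp).2
      have hp2 : (2 : ℝ) ≤ p := by exact_mod_cast hp.two_le
      have hle : (n.factorial.factorization p : ℝ) ≤ n / (p - 1) := by
        rw [le_div_iff₀ (by linarith)]
        have := Nat.sub_one_mul_factorization_factorial (n := n) hp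
        have h2 : (p - 1) * n.factorial.factorization p ≤ n := by rw [this]; omega
        have h3 : ((p - 1 : ℕ) : ℝ) * n.factorial.factorization p ≤ n := by exact_mod_cast h2
        rw [Nat.cast_sub hp.one_le] at h3
        push_cast at h3
        linarith
      have hlog : 0 ≤ Real.log p := Real.log_natCast_nonneg p
      have hlog2 : Real.log p ≤ 2 * (p : ℝ) ^ (1/2 : ℝ) := by
        have := Real.log_le_rpow_div (Nat.cast_nonneg p) (by norm_num : (0:ℝ) < 1/2)
        linarith
      have h32 : (p : ℝ) ^ (3/2 : ℝ) = p * p ^ (1/2 : ℝ) := by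
        rw [show (3/2 : ℝ) = 1 + 1/2 by norm_num, Real.rpow_add (by linarith), Real.rpow_one]
      have hs : (p : ℝ) ^ (1/2 : ℝ) * (p : ℝ) ^ (1/2 : ℝ) = p := by
        rw [← Real.rpow_add (by linarith)]; norm_num
      set s := (p : ℝ) ^ (1/2 : ℝ)
      have hs0 : 0 < s := Real.rpow_pos_of_pos (by linarith) _
      calc (n.factorial.factorization p : ℝ) * Real.log p
          ≤ n / (p - 1) * Real.log p := by gcongr
        _ = n * (Real.log p / p) + n * (Real.log p / (p * (p - 1))) := by
            have : (p : ℝ) - 1 ≠ 0 := by linarith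
            field_simp; ring
        _ ≤ _ := by
            refine add_le_add le_rfl (mul_le_mul_of_nonneg_left ?_ hn0.le)
            rw [h32, div_le_div_iff₀ (by nlinarith) (by positivity)]
            have : (p : ℝ) ≤ 2 * (p - 1) := by linarith
            calc Real.log p * (p * s) ≤ 2 * s * (p * s) := by gcongr
              _ = 2 * p * p := by rw [← hs]; ring
              _ ≤ 4 * (p * (p - 1)) := by nlinarith
    rw [Finset.sum_add_distrib, ← Finset.mul_sum, ← Finset.mul_sum] at h1
    have h2 : ∑ p ∈ (Finset.Icc 0 n).filter Nat.Prime, 4 / (p : ℝ) ^ (3/2 : ℝ) ≤ T :=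
      summable_log_div_sq.sum_le_tsum _ fun k _ => by positivity
    have h3 := Stirling.le_log_factorial_stirling (n := n) (by omega)
    have h4 : 0 ≤ Real.log n := Real.log_natCast_nonneg n
    have h5 : 0 ≤ Real.log (2 * Real.pi) := Real.log_nonneg (by nlinarith [Real.pi_gt_three])
    have h6 : n * Real.log n - n ≤
        n * (∑ p ∈ (Finset.Icc 0 n).filter Nat.Prime, Real.log p / p) + n * T := by
      have : (n : ℝ) * ∑ p ∈ (Finset.Icc 0 n).filter Nat.Prime, 4 / (p : ℝ) ^ (3/2 : ℝ) ≤ n * T := by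
        gcongr
      linarith
    have h7 : (n : ℝ) * (Real.log n - 1) ≤
        n * ((∑ p ∈ (Finset.Icc 0 n).filter Nat.Prime, Real.log p / p) + T) := by linarith
    have := le_of_mul_le_mul_left h7 hn0
    linarith
  · have h1 : n * (∑ p ∈ (Finset.Icc 0 n).filter Nat.Prime, Real.log p / p) -
        ∑ p ∈ (Finset.Icc 0 n).filter Nat.Prime, Real.log p ≤ Real.log (n.factorial : ℝ) := by
      rw [log_factorial_eq_sum, Finset.mul_sum, ← Finset.sum_sub_distrib]
      refine Finset.sum_le_sum fun p hp => ?_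
      have hpn := (Finset.mem_Icc.mp (Finset.mem_filter.mp hp).1).2
      have hp := (Finset.mem_filter.mp hp).2
      have hp0 : (0 : ℝ) < p := by exact_mod_cast hp.pos
      have h2 : n / p ≤ n.factorial.factorization p := by
        have := Nat.factorization_factorial_mul (n := n / p) hp
        calc n / p ≤ (p * (n / p)).factorial.factorization p := by omega
          _ ≤ n.factorial.factorization p := by
            have hd := Nat.factorial_dvd_factorial (Nat.mul_div_le n p)
            exact (Nat.factorization_le_iff_dvd (Nat.factorial_ne_zero _)
              (Nat.factorial_ne_zero _)).mpr hd p
      have h3 : (n : ℝ) / p - 1 ≤ n.factorial.factorization p := by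
        have : (n : ℝ) / p < (n / p : ℕ) + 1 := by
          rw [div_lt_iff₀ hp0]
          have := Nat.lt_div_mul_add (a := n) hp.pos
          have h4 : n < (n / p + 1) * p := by linarith
          exact_mod_cast h4
        have h5 : ((n / p : ℕ) : ℝ) ≤ n.factorial.factorization p := by exact_mod_cast h2
        linarith
      have hlog : 0 ≤ Real.log p := Real.log_natCast_nonneg p
      calc n * (Real.log p / p) - Real.log p = (n / p - 1) * Real.log p := by ring
        _ ≤ _ := by gcongr
    have h2 : ∑ p ∈ (Finset.Icc 0 n).filter Nat.Prime, Real.log p ≤ Real.log 4 * n := by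
      have := Chebyshev.theta_le_log4_mul_x (x := n) (Nat.cast_nonneg n)
      rw [Chebyshev.theta_eq_sum_Icc] at this
      simpa using this
    have h3 : Real.log (n.factorial : ℝ) ≤ n * Real.log n := by
      rw [← Real.log_pow]
      refine Real.log_le_log (by positivity) ?_
      exact_mod_cast Nat.factorial_le_pow n
    have h4 : n * (∑ p ∈ (Finset.Icc 0 n).filter Nat.Prime, Real.log p / p) ≤
        n * (Real.log n + Real.log 4) := by linarith
    have := le_of_mul_le_mul_left h4 hn0
    linarith

/-- The first theorem of Mertens. -/
lemma exists_abs_sum_primeLogDiv_sub_log_le :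
    ∃ C : ℝ, 0 < C ∧ ∀ t : ℝ, 1 ≤ t →
      |∑ k ∈ Finset.Icc 0 ⌊t⌋₊, primeLogDiv k - Real.log t| ≤ C := by
  obtain ⟨C, hC, h⟩ := exists_abs_sum_primeLogDiv_sub_log_le_nat
  refine ⟨C + Real.log 2, by positivity, fun t ht => ?_⟩
  have hf : 1 ≤ ⌊t⌋₊ := (Nat.one_le_floor_iff t).mpr ht
  have hf' : (1 : ℝ) ≤ ⌊t⌋₊ := by exact_mod_cast hf
  have h1 := h _ hf
  have h2 : Real.log ⌊t⌋₊ ≤ Real.log t :=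
    Real.log_le_log (by linarith) (Nat.floor_le (by linarith))
  have h3 : Real.log t ≤ Real.log ⌊t⌋₊ + Real.log 2 := by
    rw [← Real.log_mul (by linarith) (by norm_num)]
    refine Real.log_le_log (by linarith) ?_
    have := Nat.lt_floor_add_one t
    linarith
  rw [abs_le] at h1 ⊢
  constructor <;> linarith [h1.1, h1.2, Real.log_nonneg (by norm_num : (1:ℝ) ≤ 2)]

/-- The second theorem of Mertens for prime reciprocals in `(w, z]`. -/
lemma exists_abs_sum_inv_prime_sub_loglog_le :
    ∃ C : ℝ, 0 < C ∧ ∀ w z : ℝ, 2 ≤ w → w ≤ z →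
      |∑ p ∈ (Finset.Ioc ⌊w⌋₊ ⌊z⌋₊).filter Nat.Prime, (1 : ℝ) / p -
        Real.log (Real.log z / Real.log w)| ≤ C / Real.log w := by
  obtain ⟨C, hC, hM⟩ := exists_abs_sum_primeLogDiv_sub_log_le
  refine ⟨3 * C, by positivity, fun w z hw hwz => ?_⟩
  have hlw : 0 < Real.log w := Real.log_pos (by linarith)
  have hlz : 0 < Real.log z := Real.log_pos (by linarith)
  have hlog : ∀ t ∈ Set.Icc w z, 0 < Real.log t := fun t ht =>
    Real.log_pos (by linarith [ht.1])
  have hne : ∀ t ∈ Set.Icc w z, t ≠ 0 := fun t ht => by linarith [ht.1]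
  have hd : ∀ t ∈ Set.Icc w z,
      HasDerivAt (fun t => (Real.log t)⁻¹) (-t⁻¹ / Real.log t ^ 2) t := fun t ht =>
    (Real.hasDerivAt_log (hne t ht)).inv (hlog t ht).ne'
  have hcont : ContinuousOn (fun t : ℝ => -t⁻¹ / Real.log t ^ 2) (Set.Icc w z) := by
    refine ContinuousOn.div (ContinuousOn.neg (continuousOn_inv₀.mono fun t ht => hne t ht))
      ((Real.continuousOn_log.mono fun t ht => hne t ht).pow 2) fun t ht => ?_
    exact pow_ne_zero _ (hlog t ht).ne'
  have hderiv : ∀ t ∈ Set.Icc w z, deriv (fun t => (Real.log t)⁻¹) t = -t⁻¹ / Real.log t ^ 2 :=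
    fun t ht => (hd t ht).deriv
  have hintegrable : MeasureTheory.IntegrableOn (deriv fun t => (Real.log t)⁻¹) (Set.Icc w z) :=
    (hcont.integrableOn_Icc).congr_fun (fun t ht => (hderiv t ht).symm) measurableSet_Icc
  have key := sum_mul_eq_sub_sub_integral_mul primeLogDiv (f := fun t => (Real.log t)⁻¹)
    (by linarith : (0:ℝ) ≤ w) hwz (fun t ht => (hd t ht).differentiableAt) hintegrable
  have hlhs : ∑ p ∈ (Finset.Ioc ⌊w⌋₊ ⌊z⌋₊).filter Nat.Prime, (1 : ℝ) / p =
      ∑ k ∈ Finset.Ioc ⌊w⌋₊ ⌊z⌋₊, (Real.log k)⁻¹ * primeLogDiv k := by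
    rw [Finset.sum_filter]
    refine Finset.sum_congr rfl fun k _ => ?_
    unfold primeLogDiv
    split_ifs with hk
    · have : Real.log k ≠ 0 := (Real.log_pos (by exact_mod_cast hk.one_lt)).ne'
      field_simp
    · simp
  rw [hlhs, key]
  set A : ℝ → ℝ := fun t => ∑ k ∈ Finset.Icc 0 ⌊t⌋₊, primeLogDiv k with hA
  have hII : MeasureTheory.IntegrableOn
      (fun t => deriv (fun t => (Real.log t)⁻¹) t * A t) (Set.Icc w z) :=
    integrableOn_mul_sum_Icc primeLogDiv (by linarith) hintegrable
  have hd2 : ∀ t ∈ Set.Icc w z,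
      HasDerivAt (fun t => Real.log (Real.log t)) (t⁻¹ / Real.log t) t := fun t ht =>
    (Real.hasDerivAt_log (hne t ht)).log (hlog t ht).ne'
  have hcont2 : ContinuousOn (fun t : ℝ => t⁻¹ / Real.log t) (Set.Icc w z) :=
    ContinuousOn.div (continuousOn_inv₀.mono fun t ht => hne t ht)
      (Real.continuousOn_log.mono fun t ht => hne t ht) fun t ht => (hlog t ht).ne'
  have hI2 : ∫ t in w..z, t⁻¹ / Real.log t = Real.log (Real.log z) - Real.log (Real.log w) := by
    refine intervalIntegral.integral_eq_sub_of_hasDerivAt (fun t ht => hd2 t ?_) ?_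
    · rwa [Set.uIcc_of_le hwz] at ht
    · exact (hcont2.mono (by rw [Set.uIcc_of_le hwz])).intervalIntegrable
  have hI1 : ∫ t in w..z, -t⁻¹ / Real.log t ^ 2 = (Real.log z)⁻¹ - (Real.log w)⁻¹ := by
    refine intervalIntegral.integral_eq_sub_of_hasDerivAt
      (f := fun t => (Real.log t)⁻¹) (fun t ht => hd t ?_) ?_
    · rwa [Set.uIcc_of_le hwz] at ht
    · exact (hcont.mono (by rw [Set.uIcc_of_le hwz])).intervalIntegrable
  have hbound : |(∫ t in w..z, deriv (fun t => (Real.log t)⁻¹) t * A t) +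
      ∫ t in w..z, t⁻¹ / Real.log t| ≤ C * ((Real.log w)⁻¹ - (Real.log z)⁻¹) := by
    have e1 : IntervalIntegrable (fun t => deriv (fun t => (Real.log t)⁻¹) t * A t)
        MeasureTheory.volume w z := by
      rw [intervalIntegrable_iff_integrableOn_Icc_of_le hwz]; exact hII
    have e2 : IntervalIntegrable (fun t : ℝ => t⁻¹ / Real.log t) MeasureTheory.volume w z :=
      (hcont2.mono (by rw [Set.uIcc_of_le hwz])).intervalIntegrable
    rw [← intervalIntegral.integral_add e1 e2]
    have e3 : IntervalIntegrable (fun t : ℝ => -C * (-t⁻¹ / Real.log t ^ 2))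
        MeasureTheory.volume w z :=
      ((hcont.mono (by rw [Set.uIcc_of_le hwz])).intervalIntegrable).const_mul _
    have e4 := intervalIntegral.norm_integral_le_of_norm_le (μ := MeasureTheory.volume)
      (f := fun t => deriv (fun t => (Real.log t)⁻¹) t * A t + t⁻¹ / Real.log t)
      (g := fun t : ℝ => -C * (-t⁻¹ / Real.log t ^ 2)) hwz (Filter.Eventually.of_forall fun t ht => by
        have ht' : t ∈ Set.Icc w z := ⟨ht.1.le, ht.2⟩
        have hl := hlog t ht'
        have ht0 : 0 < t := by linarith [ht'.1]
        have hm := hM t (by linarith [ht'.1])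
        rw [hderiv t ht', Real.norm_eq_abs]
        have : -t⁻¹ / Real.log t ^ 2 * A t + t⁻¹ / Real.log t =
            -(t⁻¹ / Real.log t ^ 2) * (A t - Real.log t) := by field_simp; ring
        rw [this, abs_mul, abs_neg, abs_of_pos (by positivity)]
        calc t⁻¹ / Real.log t ^ 2 * |A t - Real.log t| ≤ t⁻¹ / Real.log t ^ 2 * C := by
              gcongr
          _ = _ := by ring) e3
    rw [intervalIntegral.integral_const_mul, hI1, Real.norm_eq_abs] at e4
    linarith
  rw [← intervalIntegral.integral_of_le hwz, Real.log_div hlz.ne' hlw.ne', ← hI2]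
  have hz := hM z (by linarith)
  have hw' := hM w (by linarith)
  have hinv : (Real.log z)⁻¹ ≤ (Real.log w)⁻¹ :=
    inv_anti₀ hlw (Real.log_le_log (by linarith) hwz)
  have hzi : 0 < (Real.log z)⁻¹ := inv_pos.mpr hlz
  have hz2 : |(Real.log z)⁻¹ * A z - 1| ≤ C * (Real.log z)⁻¹ := by
    have : (Real.log z)⁻¹ * A z - 1 = (Real.log z)⁻¹ * (A z - Real.log z) := by
      field_simp
    rw [this, abs_mul, abs_of_pos hzi, mul_comm]
    gcongr
  have hw2 : |(Real.log w)⁻¹ * A w - 1| ≤ C * (Real.log w)⁻¹ := by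
    have : (Real.log w)⁻¹ * A w - 1 = (Real.log w)⁻¹ * (A w - Real.log w) := by
      field_simp
    rw [this, abs_mul, abs_of_pos (inv_pos.mpr hlw), mul_comm]
    gcongr
  rw [abs_le] at hz2 hw2 hbound ⊢
  rw [div_eq_mul_inv]
  constructor <;> nlinarith [hz2.1, hz2.2, hw2.1, hw2.2, hbound.1, hbound.2]

/-! ### Primes in arithmetic progressions: a factorial upper bound -/

theorem factorial_dvd_pow_mul_prod (d c m : ℕ) :
    m.factorial ∣ d ^ m * ∏ n ∈ Finset.range m, (d * n + c) := by
  rw [Nat.dvd_iff_prime_pow_dvd_dvd]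
  intro l k hl hk
  by_cases hld : l ∣ d
  · refine Dvd.dvd.mul_right ?_ _
    have hkm : k ≤ m := by
      rcases Nat.eq_zero_or_pos m with rfl | hm
      · simp only [Nat.factorial_zero, Nat.dvd_one] at hk
        rcases Nat.pow_eq_one.1 hk with h | h
        · exact absurd h hl.one_lt.ne'
        · omega
      · have := (hl.pow_dvd_iff_le_factorization m.factorial_ne_zero).1 hk
        have h2 := Nat.factorization_factorial_le_div_pred hl m
        exact (this.trans h2).trans (Nat.div_le_self _ _)
    exact (pow_dvd_pow l hkm).trans (pow_dvd_pow_of_dvd hld m)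
  · refine Dvd.dvd.mul_left ?_ _
    have hco : Nat.Coprime d (l ^ k) :=
      ((Nat.Prime.coprime_iff_not_dvd hl).2 hld).symm.pow_right k
    have hpos : 0 < l ^ k := pow_pos hl.pos _
    have : NeZero (l ^ k) := ⟨hpos.ne'⟩
    rw [← ZMod.natCast_eq_zero_iff]
    let u := ZMod.unitOfCoprime d hco
    let a : ZMod (l ^ k) := (u⁻¹ : (ZMod (l ^ k))ˣ) * (c : ZMod (l ^ k))
    have hda : (d : ZMod (l ^ k)) * a = c := by
      have : ((u : (ZMod (l ^ k))ˣ) : ZMod (l ^ k)) = d := ZMod.coe_unitOfCoprime d hco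
      simp only [a, ← this, ← mul_assoc, Units.mul_inv, one_mul]
    obtain ⟨c', hc'⟩ : ∃ c' : ℕ, (c' : ZMod (l ^ k)) = a := ⟨a.val, ZMod.natCast_zmod_val a⟩
    have h1 : ((∏ n ∈ Finset.range m, (d * n + c) : ℕ) : ZMod (l ^ k))
        = (d : ZMod (l ^ k)) ^ m * ((∏ n ∈ Finset.range m, (c' + n) : ℕ) : ZMod (l ^ k)) := by
      push_cast
      rw [← Finset.card_range m, ← Finset.prod_const, Finset.card_range,
        ← Finset.prod_mul_distrib]
      refine Finset.prod_congr rfl fun n _ => ?_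
      rw [hc', mul_add, hda]; ring
    rw [h1]
    have h2 : m.factorial ∣ ∏ n ∈ Finset.range m, (c' + n) := by
      rw [← Nat.ascFactorial_eq_prod_range]
      exact Nat.factorial_dvd_ascFactorial _ _
    rw [(ZMod.natCast_eq_zero_iff _ _).2 (hk.trans h2), mul_zero]

theorem prod_primes_in_progression_le {d c m : ℕ} (hc : 0 < c) (hcd : c ≤ d) (Q : Finset ℕ)
    (hQ : ∀ q ∈ Q, q.Prime ∧ m < q ∧ ∃ n < m, q = d * n + c) :
    ∏ q ∈ Q, q ≤ d ^ (2 * m) := by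
  have hd : 0 < d := hc.trans_le hcd
  set Pr := ∏ n ∈ Finset.range m, (d * n + c) with hPr
  have hPrpos : 0 < Pr := Finset.prod_pos fun n _ => by positivity
  have h1 : ∏ q ∈ Q, q ∣ Pr := by
    refine Finset.prod_primes_dvd _ (fun q hq => (hQ q hq).1.prime) fun q hq => ?_
    obtain ⟨_, _, n, hn, rfl⟩ := hQ q hq
    exact Finset.dvd_prod_of_mem (fun n => d * n + c) (Finset.mem_range.2 hn)
  have h2 : Nat.Coprime m.factorial (∏ q ∈ Q, q) := by
    refine Nat.Coprime.prod_right fun q hq => ?_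
    obtain ⟨hp, hm, _⟩ := hQ q hq
    refine Nat.Coprime.symm ((Nat.Prime.coprime_iff_not_dvd hp).2 fun h => ?_)
    exact absurd ((Nat.Prime.dvd_factorial hp).1 h) (by omega)
  have h3 : m.factorial * ∏ q ∈ Q, q ∣ d ^ m * Pr :=
    h2.mul_dvd_of_dvd_of_dvd (factorial_dvd_pow_mul_prod d c m) (h1.mul_left _)
  have h4 := Nat.le_of_dvd (by positivity) h3
  have h5 : Pr ≤ d ^ m * m.factorial := by
    have : ∀ k, ∏ n ∈ Finset.range k, (d * n + c) ≤ d ^ k * k.factorial := by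
      intro k
      induction k with
      | zero => simp
      | succ k ih =>
        rw [Finset.prod_range_succ, pow_succ, Nat.factorial_succ]
        calc _ ≤ (d ^ k * k.factorial) * (d * k + d) := by gcongr
          _ = _ := by ring
    exact this m
  have h6 : m.factorial * ∏ q ∈ Q, q ≤ m.factorial * d ^ (2 * m) := by
    refine h4.trans ?_
    calc d ^ m * Pr ≤ d ^ m * (d ^ m * m.factorial) := by gcongr
      _ = _ := by rw [two_mul, pow_add]; ring
  exact Nat.le_of_mul_le_mul_left h6 m.factorial_pos

/-- Primes in `(Y₁, Y₂]` in a fixed residue class modulo `d`. -/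
theorem card_primes_in_progression_le {d : ℕ} (hd : 2 ≤ d) {Y₁ Y₂ : ℝ} (hY : 1 < Y₁)
    (hY2 : 0 ≤ Y₂) (hdY : (d : ℝ) ≤ Y₁) (hm : Y₂ / d + 1 ≤ Y₁) (a : ℤ) (Q : Finset ℕ)
    (hQ : ∀ q ∈ Q, q.Prime ∧ Y₁ < q ∧ (q : ℝ) ≤ Y₂ ∧ (d : ℤ) ∣ (q : ℤ) - a) :
    (Q.card : ℝ) * Real.log Y₁ ≤ 2 * (Y₂ / d + 1) * Real.log d := by
  have hd0 : (0 : ℝ) < d := by positivity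
  have hdZ : (0 : ℤ) < d := by exact_mod_cast (by omega : 0 < d)
  have hlogd := Real.log_natCast_nonneg d
  rcases Q.eq_empty_or_nonempty with rfl | ⟨q0, hq0⟩
  · simp only [Finset.card_empty, Nat.cast_zero, zero_mul]
    positivity
  set c := (a % d).toNat with hcdef
  have hc : (c : ℤ) = a % d := Int.toNat_of_nonneg (Int.emod_nonneg _ hdZ.ne')
  have hcd : c < d := by have := Int.emod_lt_of_pos a hdZ; omega
  have hqc : ∀ q ∈ Q, q % d = c := by
    intro q hq
    have h2 : (q : ℤ) % d = a % d :=
      Int.emod_eq_emod_iff_emod_sub_eq_zero.2 (Int.emod_eq_zero_of_dvd (hQ q hq).2.2.2)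
    have h3 : ((q % d : ℕ) : ℤ) = c := by rw [hc]; push_cast; exact h2
    exact_mod_cast h3
  have hc0 : 0 < c := by
    rcases Nat.eq_zero_or_pos c with h0 | h0
    · have h1 : d ∣ q0 := Nat.dvd_of_mod_eq_zero (h0 ▸ hqc q0 hq0)
      have h2 := ((Nat.dvd_prime (hQ q0 hq0).1).1 h1).resolve_left (by omega)
      have h3 := (hQ q0 hq0).2.1
      rw [← h2] at h3
      linarith
    · exact h0
  set m := ⌊Y₂ / d⌋₊ + 1 with hmdef
  have hmle : (m : ℝ) ≤ Y₂ / d + 1 := by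
    have := Nat.floor_le (by positivity : 0 ≤ Y₂ / d)
    push_cast [hmdef]; linarith
  have hprod := prod_primes_in_progression_le (m := m) hc0 hcd.le Q fun q hq => by
    obtain ⟨hp, h1, h2, _⟩ := hQ q hq
    refine ⟨hp, ?_, q / d, ?_, ?_⟩
    · have : (m : ℝ) < q := by linarith
      exact_mod_cast this
    · have : (q / d : ℕ) ≤ ⌊Y₂ / d⌋₊ := by
        refine Nat.le_floor (Nat.cast_div_le.trans ?_)
        gcongr
      omega
    · rw [← hqc q hq, Nat.div_add_mod]
  have h1 : (∏ q ∈ Q, (q : ℝ)) ≤ (d : ℝ) ^ (2 * m) := by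
    rw [← Nat.cast_prod, ← Nat.cast_pow]; exact Nat.cast_le.2 hprod
  have h2 : Y₁ ^ Q.card ≤ ∏ q ∈ Q, (q : ℝ) := by
    rw [← Finset.prod_const]
    exact Finset.prod_le_prod (fun _ _ => by linarith) fun q hq => (hQ q hq).2.1.le
  have h3 := Real.log_le_log (by positivity) (h2.trans h1)
  rw [Real.log_pow, Real.log_pow] at h3
  push_cast at h3
  calc (Q.card : ℝ) * Real.log Y₁ ≤ 2 * m * Real.log d := h3
    _ ≤ _ := by gcongr

/-! ### Bounded differences on finite product spaces -/

/-- Expectation of `f` under the product of the weights `P i`. -/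
noncomputable def prodExp {ι α : Type*} [Fintype ι] [Fintype α] (P : ι → α → ℝ)
    (f : (ι → α) → ℝ) : ℝ :=
  ∑ c : ι → α, (∏ i, P i (c i)) * f c

section prodExp
variable {ι α : Type*} [Fintype ι] [Fintype α] {P : ι → α → ℝ}

theorem prodExp_prod (g : ι → α → ℝ) :
    prodExp P (fun c => ∏ i, g i (c i)) = ∏ i, ∑ a, P i a * g i a := by
  rw [Finset.prod_univ_sum, prodExp, Fintype.piFinset_univ]
  exact Finset.sum_congr rfl fun c _ => Finset.prod_mul_distrib.symm

theorem prodExp_one (h1 : ∀ i, ∑ a, P i a = 1) : prodExp P (fun _ => 1) = 1 := by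
  have := prodExp_prod (P := P) (fun _ _ => 1)
  simpa [h1] using this

theorem prodExp_sum {σ : Type*} (s : Finset σ) (f : σ → (ι → α) → ℝ) :
    prodExp P (fun c => ∑ k ∈ s, f k c) = ∑ k ∈ s, prodExp P (f k) := by
  simp only [prodExp, Finset.mul_sum]
  exact Finset.sum_comm

theorem prodExp_const_mul (r : ℝ) (f : (ι → α) → ℝ) :
    prodExp P (fun c => r * f c) = r * prodExp P f := by
  simp only [prodExp, Finset.mul_sum]
  exact Finset.sum_congr rfl fun c _ => by ring

theorem prodExp_const (h1 : ∀ i, ∑ a, P i a = 1) (r : ℝ) : prodExp P (fun _ => r) = r := by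
  have := prodExp_const_mul (P := P) r (fun _ => 1)
  simpa [prodExp_one h1] using this

theorem prodExp_sub (f g : (ι → α) → ℝ) :
    prodExp P (fun c => f c - g c) = prodExp P f - prodExp P g := by
  simp only [prodExp, mul_sub, Finset.sum_sub_distrib]

theorem prodExp_add (f g : (ι → α) → ℝ) :
    prodExp P (fun c => f c + g c) = prodExp P f + prodExp P g := by
  simp only [prodExp, mul_add, Finset.sum_add_distrib]

theorem prodExp_mono (h0 : ∀ i a, 0 ≤ P i a) {f g : (ι → α) → ℝ} (h : ∀ c, f c ≤ g c) :
    prodExp P f ≤ prodExp P g :=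
  Finset.sum_le_sum fun c _ =>
    mul_le_mul_of_nonneg_left (h c) (Finset.prod_nonneg fun i _ => h0 i _)

theorem exists_lt_of_prodExp_lt (h0 : ∀ i a, 0 ≤ P i a) (h1 : ∀ i, ∑ a, P i a = 1)
    {f : (ι → α) → ℝ} {r : ℝ} (h : prodExp P f < r) : ∃ c, f c < r := by
  by_contra hcon
  push Not at hcon
  have := prodExp_mono (P := P) h0 hcon
  rw [prodExp_const h1] at this
  linarith

theorem prodExp_equiv {κ : Type*} [Fintype κ] (e : κ ≃ ι) (f : (ι → α) → ℝ) :
    prodExp P f = prodExp (fun k => P (e k)) (fun c => f (c ∘ e.symm)) := by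
  unfold prodExp
  refine Fintype.sum_equiv (Equiv.arrowCongr e.symm (Equiv.refl α)) _ _ fun c => ?_
  have h2 : ((Equiv.arrowCongr e.symm (Equiv.refl α)) c) ∘ e.symm = c := by
    ext i; simp
  simp only [h2]
  congr 1
  refine Fintype.prod_equiv e.symm _ _ fun i => ?_
  simp

end prodExp

theorem prodExp_fin_succ {α : Type*} [Fintype α] {n : ℕ} (P : Fin (n + 1) → α → ℝ)
    (f : (Fin (n + 1) → α) → ℝ) :
    prodExp P f =
      ∑ a, P 0 a * prodExp (fun i => P i.succ) (fun c => f (Fin.cons a c)) := by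
  unfold prodExp
  have hinst : ∑ c ∈ (Finset.univ : Finset (Fin (n + 1) → α)), (∏ i, P i (c i)) * f c = prodExp P f :=
    Finset.sum_congr (by ext; simp) fun _ _ => rfl
  refine hinst.symm.trans ?_
  refine (Fintype.sum_equiv (Fin.consEquiv fun _ : Fin (n + 1) => α)
    (fun ac => (∏ i, P i (Fin.consEquiv (fun _ => α) ac i)) * f (Fin.consEquiv (fun _ => α) ac))
    (fun c => (∏ i, P i (c i)) * f c) (fun _ => rfl)).symm.trans ?_
  rw [Fintype.sum_prod_type]
  refine Finset.sum_congr rfl fun a _ => ?_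
  rw [Finset.mul_sum]
  refine Finset.sum_congr (by ext; simp) fun c _ => ?_
  simp [Fin.consEquiv, Fin.prod_univ_succ, mul_assoc]

theorem exp_moment_le {α : Type*} [Fintype α] {p g : α → ℝ} (h0 : ∀ a, 0 ≤ p a)
    (h1 : ∑ a, p a = 1) {c l : ℝ} (hl : |l| * c ≤ 1)
    (hg : ∀ a b, |g a - g b| ≤ c) :
    ∑ a, p a * Real.exp (l * (g a - ∑ b, p b * g b)) ≤ Real.exp ((l * c) ^ 2) := by
  set m := ∑ b, p b * g b with hm
  have hdev : ∀ a, |g a - m| ≤ c := by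
    intro a
    have : g a - m = ∑ b, p b * (g a - g b) := by
      simp only [mul_sub, Finset.sum_sub_distrib, ← Finset.sum_mul, h1, one_mul, hm]
    rw [this]
    calc |∑ b, p b * (g a - g b)| ≤ ∑ b, |p b * (g a - g b)| := Finset.abs_sum_le_sum_abs _ _
      _ ≤ ∑ b, p b * c := Finset.sum_le_sum fun b _ => by
          rw [abs_mul, abs_of_nonneg (h0 b)]
          exact mul_le_mul_of_nonneg_left (hg a b) (h0 b)
      _ = c := by rw [← Finset.sum_mul, h1, one_mul]
  have hpt : ∀ a, Real.exp (l * (g a - m)) ≤ 1 + l * (g a - m) + (l * c) ^ 2 := by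
    intro a
    have hx : |l * (g a - m)| ≤ |l| * c := by
      rw [abs_mul]; exact mul_le_mul_of_nonneg_left (hdev a) (abs_nonneg _)
    have h2 := (abs_le.1 (Real.abs_exp_sub_one_sub_id_le (hx.trans hl))).2
    have h3 : (l * (g a - m)) ^ 2 ≤ (l * c) ^ 2 := by
      rw [← sq_abs (l * (g a - m)), ← sq_abs (l * c)]
      refine pow_le_pow_left₀ (abs_nonneg _) (hx.trans ?_) 2
      rw [abs_mul]
      exact mul_le_mul_of_nonneg_left (le_abs_self c) (abs_nonneg _)
    linarith
  calc ∑ a, p a * Real.exp (l * (g a - m))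
      ≤ ∑ a, p a * (1 + l * (g a - m) + (l * c) ^ 2) :=
        Finset.sum_le_sum fun a _ => mul_le_mul_of_nonneg_left (hpt a) (h0 a)
    _ = (1 + (l * c) ^ 2) * ∑ a, p a + l * (∑ a, p a * g a - (∑ a, p a) * m) := by
        rw [Finset.sum_mul, Finset.mul_sum, ← Finset.sum_sub_distrib, Finset.mul_sum,
          ← Finset.sum_add_distrib]
        exact Finset.sum_congr rfl fun a _ => by ring
    _ = 1 + (l * c) ^ 2 := by rw [h1, ← hm]; ring
    _ ≤ _ := by linarith [Real.add_one_le_exp ((l * c) ^ 2)]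

theorem prodExp_exp_le_fin {α : Type*} [Fintype α] {c l : ℝ} (hl : |l| * c ≤ 1) (n : ℕ) :
    ∀ (P : Fin n → α → ℝ) (_ : ∀ i a, 0 ≤ P i a) (_ : ∀ i, ∑ a, P i a = 1)
      (f : (Fin n → α) → ℝ) (_ : ∀ x i a, |f x - f (Function.update x i a)| ≤ c),
      prodExp P (fun x => Real.exp (l * (f x - prodExp P f))) ≤ Real.exp (n * (l * c) ^ 2) := by
  induction n with
  | zero =>
    intro P _ _ f _
    simp [prodExp]
  | succ n ih =>
    intro P h0 h1 f hf
    set P' : Fin n → α → ℝ := fun i => P i.succ with hP'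
    set g : α → ℝ := fun a => prodExp P' (fun c => f (Fin.cons a c)) with hg
    have hm : prodExp P f = ∑ a, P 0 a * g a := prodExp_fin_succ P f
    have hgd : ∀ a b, |g a - g b| ≤ c := by
      intro a b
      have key : ∀ y, |f (Fin.cons a y) - f (Fin.cons b y)| ≤ c := by
        intro y
        have := hf (Fin.cons a y) 0 b
        rwa [Fin.update_cons_zero] at this
      rw [hg, abs_le]
      simp only
      rw [← prodExp_sub]
      constructor
      · rw [← prodExp_const (P := P') (fun i => h1 _) (-c)]
        exact prodExp_mono (fun i a => h0 _ _) fun y => (abs_le.1 (key y)).1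
      · rw [← prodExp_const (P := P') (fun i => h1 _) c]
        exact prodExp_mono (fun i a => h0 _ _) fun y => (abs_le.1 (key y)).2
    rw [prodExp_fin_succ]
    have hstep : ∀ a, prodExp P' (fun y => Real.exp (l * (f (Fin.cons a y) - prodExp P f)))
        ≤ Real.exp (l * (g a - ∑ b, P 0 b * g b)) * Real.exp (n * (l * c) ^ 2) := by
      intro a
      have h2 := ih P' (fun i a => h0 _ _) (fun i => h1 _) (fun y => f (Fin.cons a y))
        (fun y i b => by
          have := hf (Fin.cons a y) i.succ b
          rwa [← Fin.cons_update] at this)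
      have h3 : prodExp P' (fun y => Real.exp (l * (f (Fin.cons a y) - prodExp P f)))
          = Real.exp (l * (g a - ∑ b, P 0 b * g b)) *
            prodExp P' (fun y => Real.exp (l * (f (Fin.cons a y) - g a))) := by
        rw [← prodExp_const_mul]
        congr 1; ext y
        rw [← Real.exp_add, hm]; congr 1; ring
      rw [h3]
      exact mul_le_mul_of_nonneg_left h2 (Real.exp_pos _).le
    calc _ ≤ ∑ a, P 0 a * (Real.exp (l * (g a - ∑ b, P 0 b * g b)) *
            Real.exp (n * (l * c) ^ 2)) :=
          Finset.sum_le_sum fun a _ => mul_le_mul_of_nonneg_left (hstep a) (h0 _ _)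
      _ = (∑ a, P 0 a * Real.exp (l * (g a - ∑ b, P 0 b * g b))) *
            Real.exp (n * (l * c) ^ 2) := by
          rw [Finset.sum_mul]; exact Finset.sum_congr rfl fun a _ => by ring
      _ ≤ Real.exp ((l * c) ^ 2) * Real.exp (n * (l * c) ^ 2) := by
          gcongr
          exact exp_moment_le (h0 0) (h1 0) hl hgd
      _ = _ := by rw [← Real.exp_add]; push_cast; congr 1; ring

theorem prodExp_exp_le {ι α : Type*} [Fintype ι] [Fintype α] {c l : ℝ} (hl : |l| * c ≤ 1)
    {P : ι → α → ℝ} (h0 : ∀ i a, 0 ≤ P i a) (h1 : ∀ i, ∑ a, P i a = 1)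
    {f : (ι → α) → ℝ} (hf : ∀ x i a, |f x - f (Function.update x i a)| ≤ c) :
    prodExp P (fun x => Real.exp (l * (f x - prodExp P f)))
      ≤ Real.exp (Fintype.card ι * (l * c) ^ 2) := by
  let e := (Fintype.equivFin ι).symm
  rw [prodExp_equiv e f, prodExp_equiv e]
  refine prodExp_exp_le_fin hl _ (fun k => P (e k)) (fun i a => h0 _ _) (fun i => h1 _)
    (fun x => f (x ∘ e.symm)) fun x i a => ?_
  have := hf (x ∘ e.symm) (e i) a
  convert this using 4
  ext j
  by_cases h : j = e i
  · subst h; simp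
  · have : e.symm j ≠ i := fun h' => h (by rw [← h']; simp)
    simp [Function.update, h, this]

/-- Finitely many functions with bounded differences are simultaneously close to their means. -/
theorem exists_forall_abs_sub_prodExp_le {ι α σ : Type*} [Fintype ι] [Fintype α]
    {c l t : ℝ} (hl0 : 0 < l) (hl : l * c ≤ 1)
    {P : ι → α → ℝ} (h0 : ∀ i a, 0 ≤ P i a) (h1 : ∀ i, ∑ a, P i a = 1)
    (s : Finset σ) (f : σ → (ι → α) → ℝ)
    (hf : ∀ k ∈ s, ∀ x i a, |f k x - f k (Function.update x i a)| ≤ c)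
    (hsmall : 2 * (s.card : ℝ) * Real.exp (Fintype.card ι * (l * c) ^ 2 - l * t) < 1) :
    ∃ x, ∀ k ∈ s, |f k x - prodExp P (f k)| ≤ t := by
  set F : (ι → α) → ℝ := fun x => ∑ k ∈ s,
    (Real.exp (l * (f k x - prodExp P (f k))) + Real.exp (-l * (f k x - prodExp P (f k)))) with hF
  have hE : prodExp P F < Real.exp (l * t) := by
    rw [hF, prodExp_sum]
    calc _ ≤ ∑ k ∈ s, 2 * Real.exp (Fintype.card ι * (l * c) ^ 2) := by
          refine Finset.sum_le_sum fun k hk => ?_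
          rw [prodExp_add, two_mul]
          refine add_le_add (prodExp_exp_le (by rwa [abs_of_pos hl0]) h0 h1 (hf k hk)) ?_
          have := prodExp_exp_le (l := -l) (by rwa [abs_neg, abs_of_pos hl0]) h0 h1 (hf k hk)
          rwa [neg_mul, neg_sq] at this
      _ = 2 * (s.card : ℝ) * Real.exp (Fintype.card ι * (l * c) ^ 2 - l * t)
            * Real.exp (l * t) := by
          rw [mul_assoc, ← Real.exp_add, sub_add_cancel, Finset.sum_const, nsmul_eq_mul]; ring
      _ < 1 * Real.exp (l * t) := by gcongr
      _ = _ := one_mul _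
  obtain ⟨x, hx⟩ := exists_lt_of_prodExp_lt h0 h1 hE
  refine ⟨x, fun k hk => ?_⟩
  have hle : Real.exp (l * (f k x - prodExp P (f k))) +
      Real.exp (-l * (f k x - prodExp P (f k))) ≤ F x :=
    Finset.single_le_sum (f := fun k => Real.exp (l * (f k x - prodExp P (f k))) +
      Real.exp (-l * (f k x - prodExp P (f k)))) (fun k _ => by positivity) hk
  have e1 := Real.exp_pos (l * (f k x - prodExp P (f k)))
  have e2 := Real.exp_pos (-l * (f k x - prodExp P (f k)))
  have a1 := Real.exp_lt_exp.1 (by linarith : Real.exp (l * (f k x - prodExp P (f k))) < Real.exp (l * t))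
  have a2 := Real.exp_lt_exp.1 (by linarith : Real.exp (-l * (f k x - prodExp P (f k))) < Real.exp (l * t))
  rw [abs_le]
  constructor <;> nlinarith

/-! ### One round of the nibble -/

theorem exists_compensation {u k : ℝ} (hk0 : 0 < k) (hk1 : k < 1) :
    ∃ a b : ℝ, 0 ≤ a ∧ 0 ≤ b ∧ a + b ≤ 1 ∧ a + b * u = k ∧ (u ≤ k → a + b = 1) := by
  by_cases h : u ≤ k
  · have h1 : 0 < 1 - u := by linarith
    refine ⟨(k - u) / (1 - u), 1 - (k - u) / (1 - u), div_nonneg (by linarith) h1.le, ?_, by linarith,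
      by field_simp; ring, fun _ => by ring⟩
    rw [sub_nonneg, div_le_one h1]; linarith
  · push Not at h
    have hu : 0 < u := hk0.trans h
    refine ⟨0, k / u, le_rfl, by positivity, ?_, by field_simp; ring, fun h' => by linarith⟩
    rw [zero_add, div_le_one hu]; exact h.le

theorem one_sub_sum_le_prod {V : Type*} (A : Finset V) {p : V → ℝ} (h0 : ∀ v ∈ A, 0 ≤ p v)
    (h1 : ∀ v ∈ A, p v ≤ 1) : 1 - ∑ v ∈ A, p v ≤ ∏ v ∈ A, (1 - p v) := by
  induction A using Finset.induction_on with
  | empty => simp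
  | insert a A ha ih =>
    rw [Finset.sum_insert ha, Finset.prod_insert ha]
    have h2 := ih (fun v hv => h0 v (Finset.mem_insert_of_mem hv))
      fun v hv => h1 v (Finset.mem_insert_of_mem hv)
    have h3 := h0 a (Finset.mem_insert_self _ _)
    have h4 := h1 a (Finset.mem_insert_self _ _)
    have h5 : 0 ≤ ∑ v ∈ A, p v := Finset.sum_nonneg fun v hv => h0 v (Finset.mem_insert_of_mem hv)
    nlinarith

theorem prod_mul_le_one_sub_sum {V : Type*} (A : Finset V) {p : V → ℝ} {S : ℝ}
    (h0 : ∀ v ∈ A, 0 ≤ p v) (hS : ∑ v ∈ A, p v ≤ S) (hS1 : S ≤ 1 / 2) :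
    (∏ v ∈ A, (1 - p v)) * (1 - 2 * S ^ 2) ≤ 1 - ∑ v ∈ A, p v := by
  set s := ∑ v ∈ A, p v with hs
  have hs0 : 0 ≤ s := Finset.sum_nonneg h0
  have hle1 : ∀ v ∈ A, p v ≤ 1 := fun v hv =>
    (Finset.single_le_sum h0 hv).trans (by linarith)
  have hprod : ∏ v ∈ A, (1 - p v) ≤ 1 - s + s ^ 2 := by
    have h2 : ∏ v ∈ A, (1 - p v) ≤ Real.exp (-s) := by
      rw [hs, ← Finset.sum_neg_distrib, Real.exp_sum]
      refine Finset.prod_le_prod (fun v hv => by linarith [hle1 v hv]) fun v _ => ?_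
      linarith [Real.add_one_le_exp (-p v)]
    have h3 := (abs_le.1 (Real.abs_exp_sub_one_sub_id_le (x := -s)
      (by rw [abs_neg, abs_of_nonneg hs0]; linarith))).2
    nlinarith
  have hp0 : 0 ≤ ∏ v ∈ A, (1 - p v) := Finset.prod_nonneg fun v hv => by linarith [hle1 v hv]
  have hsS : s ^ 2 ≤ S ^ 2 := pow_le_pow_left₀ hs0 hS 2
  calc (∏ v ∈ A, (1 - p v)) * (1 - 2 * S ^ 2)
      ≤ (∏ v ∈ A, (1 - p v)) * (1 - 2 * s ^ 2) := by gcongr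
    _ ≤ (1 - s + s ^ 2) * (1 - 2 * s ^ 2) := by
        refine mul_le_mul_of_nonneg_right hprod ?_
        nlinarith
    _ ≤ 1 - s := by
        have h4 : 0 ≤ s ^ 2 * (1 - 2 * s) := mul_nonneg (sq_nonneg _) (by linarith)
        nlinarith [sq_nonneg (s ^ 2)]

/-- The vertices in the edge selected by `o`, if any. -/
def hitSet {A V : Type*} (e : A → Finset V) (o : Option A) : Finset V :=
  o.elim ∅ e

/-- Selection weights: label `a` with weight `p a`, no edge with the remaining weight. -/
noncomputable def selWeight {A : Type*} [Fintype A] (p : A → ℝ) (o : Option A) : ℝ :=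
  o.elim (1 - ∑ a, p a) p

theorem sum_selWeight {A : Type*} [Fintype A] (p : A → ℝ) : ∑ o, selWeight p o = 1 := by
  rw [Fintype.sum_option]; simp [selWeight]

theorem selWeight_nonneg {A : Type*} [Fintype A] {p : A → ℝ} (h0 : ∀ a, 0 ≤ p a)
    (h1 : ∑ a, p a ≤ 1) (o : Option A) : 0 ≤ selWeight p o := by
  cases o with
  | none => simpa [selWeight] using h1
  | some a => exact h0 a

section round
variable {ι A V : Type*} [Fintype ι]

/-- The weight with which a vertex is hit by a colour. -/
noncomputable def hitWeight [Fintype A] (p : ι → A → ℝ) (edge : ι → A → Finset V) (i : ι) (v : V) : ℝ :=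
  ∑ a with v ∈ edge i a, p i a

/-- Indicator that no vertex of `T` is hit. -/
noncomputable def missInd (edge : ι → A → Finset V) (T : Finset V) (x : ι → Option A) : ℝ :=
  ∏ i, if Disjoint T (hitSet (edge i) (x i)) then 1 else 0

theorem prodExp_missInd [Fintype A] {p : ι → A → ℝ} {edge : ι → A → Finset V} {T : Finset V}
    (hT : ∀ i a, (T ∩ edge i a).card ≤ 1) {B : Finset V} (hB : B ⊆ T) :
    prodExp (fun i => selWeight (p i)) (missInd edge B)
      = ∏ i, (1 - ∑ v ∈ B, hitWeight p edge i v) := by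
  unfold missInd
  rw [prodExp_prod (fun i o => if Disjoint B (hitSet (edge i) o) then (1 : ℝ) else 0)]
  refine Finset.prod_congr rfl fun i _ => ?_
  rw [Fintype.sum_option]
  simp only [hitSet, Option.elim, Finset.disjoint_empty_right, if_true, selWeight, hitWeight, mul_one]
  have : ∑ v ∈ B, ∑ a with v ∈ edge i a, p i a
      = ∑ a, p i a - ∑ a, p i a * (if Disjoint B (edge i a) then (1 : ℝ) else 0) := by
    simp only [Finset.sum_filter]
    rw [Finset.sum_comm, ← Finset.sum_sub_distrib]
    refine Finset.sum_congr rfl fun a _ => ?_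
    rw [← Finset.sum_filter, Finset.sum_const, Finset.filter_mem_eq_inter, nsmul_eq_mul]
    have hc : (B ∩ edge i a).card ≤ 1 :=
      (Finset.card_le_card (Finset.inter_subset_inter_right hB)).trans (hT i a)
    by_cases hd : Disjoint B (edge i a)
    · rw [if_pos hd, Finset.disjoint_iff_inter_eq_empty.1 hd]; simp
    · have : (B ∩ edge i a).card = 1 := by
        have : (B ∩ edge i a).card ≠ 0 := by
          rwa [Ne, Finset.card_eq_zero, ← Finset.disjoint_iff_inter_eq_empty]
        omega
      rw [if_neg hd, this]; simp
  rw [this, ← sub_add]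
  congr!

theorem missInd_eq_prod (edge : ι → A → Finset V) (B : Finset V) (x : ι → Option A) :
    missInd edge B x = ∏ v ∈ B, missInd edge {v} x := by
  unfold missInd
  rw [Finset.prod_comm]
  refine Finset.prod_congr rfl fun i _ => ?_
  by_cases h : Disjoint B (hitSet (edge i) (x i))
  · rw [if_pos h, Finset.prod_eq_one]
    intro v hv
    rw [if_pos]
    exact Finset.disjoint_of_subset_left (Finset.singleton_subset_iff.2 hv) h
  · rw [if_neg h]
    obtain ⟨v, hv, hv2⟩ := Finset.not_disjoint_iff.1 h
    exact (Finset.prod_eq_zero hv (by simp [hv2])).symm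

theorem missInd_mem (edge : ι → A → Finset V) (B : Finset V) (x : ι → Option A) :
    0 ≤ missInd edge B x ∧ missInd edge B x ≤ 1 := by
  unfold missInd
  refine ⟨Finset.prod_nonneg fun i _ => by split_ifs <;> norm_num,
    Finset.prod_le_one (fun i _ => by split_ifs <;> norm_num) fun i _ => by split_ifs <;> norm_num⟩

/-- Expectation of a product of compensated indicators over a set meeting each edge at most once. -/
theorem prodExp_prod_compensated [Fintype A] {p : ι → A → ℝ} {edge : ι → A → Finset V} {k r c : ℝ}
    (hp0 : ∀ i a, 0 ≤ p i a) (hpc : ∀ i v, hitWeight p edge i v ≤ c)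
    {T : Finset V} (hT : ∀ i a, (T ∩ edge i a).card ≤ 1) (hTr : (T.card : ℝ) ≤ r)
    (hrc : r * c ≤ 1 / 2) (hc1 : c ≤ 1) (hc0 : 0 ≤ c)
    {a b : V → ℝ} (ha : ∀ v, 0 ≤ a v) (hb : ∀ v, 0 ≤ b v)
    (hk : ∀ v, a v + b v * ∏ i, (1 - hitWeight p edge i v) = k) :
    prodExp (fun i => selWeight (p i)) (fun x => ∏ v ∈ T, (a v + b v * missInd edge {v} x))
        ≤ k ^ T.card ∧
      (1 - 2 * Fintype.card ι * (r * c) ^ 2) * k ^ T.card ≤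
        prodExp (fun i => selWeight (p i))
          (fun x => ∏ v ∈ T, (a v + b v * missInd edge {v} x)) := by
  have hh0 : ∀ i v, 0 ≤ hitWeight p edge i v := fun i v => Finset.sum_nonneg fun a _ => hp0 i a
  have hexp : prodExp (fun i => selWeight (p i))
        (fun x => ∏ v ∈ T, (a v + b v * missInd edge {v} x))
      = ∑ B ∈ T.powerset, ((∏ v ∈ B, b v) * ∏ v ∈ T \ B, a v) *
          ∏ i, (1 - ∑ v ∈ B, hitWeight p edge i v) := by
    have : (fun x => ∏ v ∈ T, (a v + b v * missInd edge {v} x))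
        = fun x => ∑ B ∈ T.powerset, ((∏ v ∈ B, b v) * ∏ v ∈ T \ B, a v) * missInd edge B x := by
      ext x
      rw [show (∏ v ∈ T, (a v + b v * missInd edge {v} x))
        = ∏ v ∈ T, (b v * missInd edge {v} x + a v) from
          Finset.prod_congr rfl fun v _ => add_comm _ _, Finset.prod_add]
      refine Finset.sum_congr rfl fun B _ => ?_
      rw [Finset.prod_mul_distrib, missInd_eq_prod]; ring
    rw [this, prodExp_sum]
    refine Finset.sum_congr rfl fun B hB => ?_
    rw [prodExp_const_mul, prodExp_missInd hT (Finset.mem_powerset.1 hB)]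
  have hpow : k ^ T.card = ∑ B ∈ T.powerset, ((∏ v ∈ B, b v) * ∏ v ∈ T \ B, a v) *
      ∏ i, ∏ v ∈ B, (1 - hitWeight p edge i v) := by
    rw [← Finset.prod_const, show (∏ _v ∈ T, k)
      = ∏ v ∈ T, (b v * ∏ i, (1 - hitWeight p edge i v) + a v) from
        Finset.prod_congr rfl fun v _ => by rw [add_comm, hk], Finset.prod_add]
    refine Finset.sum_congr rfl fun B _ => ?_
    rw [Finset.prod_mul_distrib, Finset.prod_comm (s := Finset.univ)]; ring
  have hw0 : ∀ B, 0 ≤ (∏ v ∈ B, b v) * ∏ v ∈ T \ B, a v := fun B =>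
    mul_nonneg (Finset.prod_nonneg fun v _ => hb v) (Finset.prod_nonneg fun v _ => ha v)
  have hSB : ∀ B ∈ T.powerset, ∀ i, ∑ v ∈ B, hitWeight p edge i v ≤ r * c := by
    intro B hB i
    calc ∑ v ∈ B, hitWeight p edge i v ≤ ∑ v ∈ B, c := Finset.sum_le_sum fun v _ => hpc i v
      _ = B.card * c := by rw [Finset.sum_const, nsmul_eq_mul]
      _ ≤ T.card * c := by
          gcongr; exact Finset.mem_powerset.1 hB
      _ ≤ r * c := by gcongr
  rw [hexp, hpow]
  constructor
  · refine Finset.sum_le_sum fun B hB => mul_le_mul_of_nonneg_left ?_ (hw0 B)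
    refine Finset.prod_le_prod (fun i _ => by linarith [hSB B hB i]) fun i _ => ?_
    exact one_sub_sum_le_prod B (fun v _ => hh0 i v) fun v _ => (hpc i v).trans hc1
  · rw [Finset.mul_sum]
    refine Finset.sum_le_sum fun B hB => ?_
    rw [mul_left_comm]
    refine mul_le_mul_of_nonneg_left ?_ (hw0 B)
    set y := (r * c) ^ 2 with hy
    have hr0 : 0 ≤ r := (Nat.cast_nonneg _).trans hTr
    have hrc0 : 0 ≤ r * c := by positivity
    have hy1 : 2 * y ≤ 1 := by rw [hy]; nlinarith
    have hpn : 0 ≤ ∏ i, ∏ v ∈ B, (1 - hitWeight p edge i v) :=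
      Finset.prod_nonneg fun i _ => Finset.prod_nonneg fun v _ => by
        linarith [(hpc i v).trans hc1]
    calc (1 - 2 * Fintype.card ι * y) * ∏ i, ∏ v ∈ B, (1 - hitWeight p edge i v)
        ≤ (1 - 2 * y) ^ Fintype.card ι * ∏ i, ∏ v ∈ B, (1 - hitWeight p edge i v) := by
          refine mul_le_mul_of_nonneg_right ?_ hpn
          have := one_add_mul_le_pow (a := -(2 * y)) (by linarith) (Fintype.card ι)
          rw [← sub_eq_add_neg] at this
          calc _ = 1 + (Fintype.card ι : ℝ) * -(2 * y) := by ring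
            _ ≤ _ := this
      _ = ∏ i, (∏ v ∈ B, (1 - hitWeight p edge i v)) * (1 - 2 * y) := by
          rw [Finset.prod_mul_distrib, Finset.prod_const, Finset.card_univ, mul_comm]
      _ ≤ _ := by
          refine Finset.prod_le_prod (fun i _ => mul_nonneg (Finset.prod_nonneg fun v _ => by
            linarith [(hpc i v).trans hc1]) (by linarith)) fun i _ => ?_
          exact prod_mul_le_one_sub_sum B (fun v _ => hh0 i v) (hSB B hB i) hrc

end round

theorem abs_prod_sub_prod_le_one {V : Type*} (T : Finset V) {f g : V → ℝ}
    (hf : ∀ v, 0 ≤ f v ∧ f v ≤ 1) (hg : ∀ v, 0 ≤ g v ∧ g v ≤ 1) :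
    |∏ v ∈ T, f v - ∏ v ∈ T, g v| ≤ 1 := by
  have h1 : 0 ≤ ∏ v ∈ T, f v := Finset.prod_nonneg fun v _ => (hf v).1
  have h2 : ∏ v ∈ T, f v ≤ 1 := Finset.prod_le_one (fun v _ => (hf v).1) fun v _ => (hf v).2
  have h3 : 0 ≤ ∏ v ∈ T, g v := Finset.prod_nonneg fun v _ => (hg v).1
  have h4 : ∏ v ∈ T, g v ≤ 1 := Finset.prod_le_one (fun v _ => (hg v).1) fun v _ => (hg v).2
  rw [abs_le]; constructor <;> linarith

/-- If `f` and `g` agree off `D`, multilinear statistics with small vertex weight differ little. -/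
theorem abs_stat_sub_le {V τ : Type*} (S : Finset τ) (T : τ → Finset V) {W : τ → ℝ}
    (hW : ∀ t ∈ S, 0 ≤ W t) {c : ℝ} (D : Finset V) (hc : ∀ u, ∑ t ∈ S with u ∈ T t, W t ≤ c)
    {f g : V → ℝ} (hf : ∀ v, 0 ≤ f v ∧ f v ≤ 1) (hg : ∀ v, 0 ≤ g v ∧ g v ≤ 1)
    (hfg : ∀ v ∉ D, f v = g v) :
    |∑ t ∈ S, W t * ∏ v ∈ T t, f v - ∑ t ∈ S, W t * ∏ v ∈ T t, g v| ≤ D.card * c := by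
  rw [← Finset.sum_sub_distrib]
  calc _ ≤ ∑ t ∈ S, |W t * ∏ v ∈ T t, f v - W t * ∏ v ∈ T t, g v| :=
        Finset.abs_sum_le_sum_abs _ _
    _ ≤ ∑ t ∈ S, ∑ u ∈ D, if u ∈ T t then W t else 0 := by
        refine Finset.sum_le_sum fun t ht => ?_
        rw [← mul_sub, abs_mul, abs_of_nonneg (hW t ht)]
        by_cases hd : ∃ u ∈ D, u ∈ T t
        · obtain ⟨u, hu, hut⟩ := hd
          calc W t * _ ≤ W t * 1 :=
                mul_le_mul_of_nonneg_left (abs_prod_sub_prod_le_one _ hf hg) (hW t ht)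
            _ = if u ∈ T t then W t else 0 := by rw [if_pos hut, mul_one]
            _ ≤ _ := Finset.single_le_sum (f := fun u => if u ∈ T t then W t else 0)
                (fun u _ => by split_ifs <;> simp [hW t ht]) hu
        · push Not at hd
          have : ∏ v ∈ T t, f v = ∏ v ∈ T t, g v :=
            Finset.prod_congr rfl fun v hv => hfg v fun hD => hd v hD hv
          rw [this, sub_self, abs_zero, mul_zero]
          exact Finset.sum_nonneg fun u _ => by split_ifs <;> simp [hW t ht]
    _ = ∑ u ∈ D, ∑ t ∈ S with u ∈ T t, W t := by
        rw [Finset.sum_comm]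
        exact Finset.sum_congr rfl fun u _ => (Finset.sum_filter _ _).symm
    _ ≤ ∑ u ∈ D, c := Finset.sum_le_sum fun u _ => hc u
    _ = _ := by rw [Finset.sum_const, nsmul_eq_mul]

theorem one_add_sum_le_prod {ι : Type*} (s : Finset ι) {p : ι → ℝ} (h0 : ∀ i ∈ s, 0 ≤ p i) :
    1 + ∑ i ∈ s, p i ≤ ∏ i ∈ s, (1 + p i) := by
  induction s using Finset.induction_on with
  | empty => simp
  | insert a s ha ih =>
    rw [Finset.sum_insert ha, Finset.prod_insert ha]
    have h2 := ih fun v hv => h0 v (Finset.mem_insert_of_mem hv)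
    have h3 := h0 a (Finset.mem_insert_self _ _)
    have h5 : 0 ≤ ∑ v ∈ s, p v := Finset.sum_nonneg fun v hv => h0 v (Finset.mem_insert_of_mem hv)
    nlinarith

theorem prod_one_sub_le_inv {ι : Type*} (s : Finset ι) {p : ι → ℝ} (h0 : ∀ i ∈ s, 0 ≤ p i)
    (h1 : ∀ i ∈ s, p i ≤ 1) : ∏ i ∈ s, (1 - p i) ≤ 1 / (1 + ∑ i ∈ s, p i) := by
  have hs : 0 ≤ ∑ i ∈ s, p i := Finset.sum_nonneg h0
  have h2 := one_add_sum_le_prod s h0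
  have h3 : (∏ i ∈ s, (1 - p i)) * ∏ i ∈ s, (1 + p i) ≤ 1 := by
    rw [← Finset.prod_mul_distrib]
    refine Finset.prod_le_one (fun i hi => mul_nonneg (by linarith [h1 i hi]) (by linarith [h0 i hi]))
      fun i _ => by nlinarith [sq_nonneg (p i)]
  have h4 : 0 ≤ ∏ i ∈ s, (1 - p i) := Finset.prod_nonneg fun i hi => by linarith [h1 i hi]
  rw [le_div_iff₀ (by linarith)]
  nlinarith

/-- One round: there is an outcome for which all statistics follow their expected evolution. -/
theorem exists_round {ι A V σ τ : Type*} [Fintype ι] [Fintype A]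
    (edge : ι → A → Finset V) (p : ι → A → ℝ) {k c l t : ℝ} {r : ℕ} (hk0 : 0 < k) (hk1 : k < 1)
    (hp0 : ∀ i a, 0 ≤ p i a) (hp1 : ∀ i, ∑ a, p i a ≤ 1)
    (hpc : ∀ i v, hitWeight p edge i v ≤ c) (hedge : ∀ i a, (edge i a).card ≤ r)
    (hc0 : 0 ≤ c) (hc1 : c ≤ 1) (hrc : r * c ≤ 1 / 2)
    (stats : Finset σ) (S : σ → Finset τ) (T : σ → τ → Finset V) (W : σ → τ → ℝ)
    (hW : ∀ s ∈ stats, ∀ j ∈ S s, 0 ≤ W s j)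
    (hT : ∀ s ∈ stats, ∀ j ∈ S s, ∀ i a, (T s j ∩ edge i a).card ≤ 1)
    (hTr : ∀ s ∈ stats, ∀ j ∈ S s, (T s j).card ≤ r)
    (hWc : ∀ s ∈ stats, ∀ u, ∑ j ∈ S s with u ∈ T s j, W s j * (k ^ (T s j).card)⁻¹ ≤ c)
    (φ : V → ℝ) (hφ : ∀ v, 0 ≤ φ v ∧ φ v ≤ 1)
    (hl0 : 0 < l) (hl : l * (2 * r * c) ≤ 1)
    (hsmall : 2 * (stats.card : ℝ) * Real.exp (Fintype.card ι * (l * (2 * r * c)) ^ 2 - l * t) < 1) :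
    ∃ (x : ι → Option A) (φ' : V → ℝ), (∀ v, 0 ≤ φ' v ∧ φ' v ≤ 1) ∧
      (∀ v, φ v = 1 → (∀ i, v ∉ hitSet (edge i) (x i)) → 1 / k - 1 ≤ ∑ i, hitWeight p edge i v →
        φ' v = 1) ∧
      ∀ s ∈ stats,
        ∑ j ∈ S s, W s j * (k ^ (T s j).card)⁻¹ * ∏ u ∈ T s j, φ' u
            ≤ ∑ j ∈ S s, W s j * ∏ u ∈ T s j, φ u + t ∧
        (1 - 2 * Fintype.card ι * (r * c) ^ 2) * ∑ j ∈ S s, W s j * ∏ u ∈ T s j, φ u - t ≤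
          ∑ j ∈ S s, W s j * (k ^ (T s j).card)⁻¹ * ∏ u ∈ T s j, φ' u := by
  have hh0 : ∀ i v, 0 ≤ hitWeight p edge i v := fun i v => Finset.sum_nonneg fun a _ => hp0 i a
  have hcomp := fun v => exists_compensation (u := ∏ i, (1 - hitWeight p edge i v)) hk0 hk1
  choose a b ha hb hab hk hab1 using hcomp
  set ψ : (ι → Option A) → V → ℝ := fun x v => a v + b v * missInd edge {v} x with hψ
  have hψ01 : ∀ x v, 0 ≤ ψ x v ∧ ψ x v ≤ 1 := by
    intro x v
    obtain ⟨h1, h2⟩ := missInd_mem edge {v} x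
    have := ha v; have := hb v; have := hab v
    constructor
    · simp only [hψ]; positivity
    · simp only [hψ]; nlinarith
  have hφψ : ∀ x v, 0 ≤ φ v * ψ x v ∧ φ v * ψ x v ≤ 1 := fun x v =>
    ⟨mul_nonneg (hφ v).1 (hψ01 x v).1, mul_le_one₀ (hφ v).2 (hψ01 x v).1 (hψ01 x v).2⟩
  set F : σ → (ι → Option A) → ℝ := fun s x =>
    ∑ j ∈ S s, W s j * (k ^ (T s j).card)⁻¹ * ∏ u ∈ T s j, (φ u * ψ x u) with hF
  have hP0 : ∀ i o, 0 ≤ selWeight (p i) o := fun i o => selWeight_nonneg (hp0 i) (hp1 i) o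
  have hP1 : ∀ i, ∑ o, selWeight (p i) o = 1 := fun i => sum_selWeight (p i)
  have hdiff : ∀ s ∈ stats, ∀ x i o, |F s x - F s (Function.update x i o)| ≤ 2 * r * c := by
    intro s hs x i o
    set D := hitSet (edge i) (x i) ∪ hitSet (edge i) o with hD
    have hcard : ∀ o, (hitSet (edge i) o).card ≤ r := by
      intro o
      cases o with
      | none => simp [hitSet]
      | some a => exact hedge i a
    have hDc : (D.card : ℝ) ≤ 2 * r := by
      have h1 := Finset.card_union_le (hitSet (edge i) (x i)) (hitSet (edge i) o)
      have h2 := hcard (x i)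
      have h3 := hcard o
      have : D.card ≤ 2 * r := by rw [hD]; omega
      exact_mod_cast this
    refine (abs_stat_sub_le (S s) (T s) (W := fun j => W s j * (k ^ (T s j).card)⁻¹)
      (fun j hj => mul_nonneg (hW s hs j hj) (by positivity)) D (hWc s hs) (hφψ x)
      (hφψ (Function.update x i o)) ?_).trans (mul_le_mul_of_nonneg_right hDc hc0)
    intro v hv
    have hv1 : v ∉ hitSet (edge i) (x i) := fun h => hv (Finset.mem_union_left _ h)
    have hv2 : v ∉ hitSet (edge i) o := fun h => hv (Finset.mem_union_right _ h)
    have : missInd edge {v} x = missInd edge {v} (Function.update x i o) := by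
      unfold missInd
      refine Finset.prod_congr rfl fun i' _ => ?_
      by_cases h : i' = i
      · subst h; simp [hv1, hv2]
      · simp [Function.update_of_ne h]
    simp only [hψ, this]
  obtain ⟨x, hx⟩ := exists_forall_abs_sub_prodExp_le hl0 hl hP0 hP1 stats F hdiff hsmall
  have hmean : ∀ s ∈ stats, prodExp (fun i => selWeight (p i)) (F s)
        ≤ ∑ j ∈ S s, W s j * ∏ u ∈ T s j, φ u ∧
      (1 - 2 * Fintype.card ι * (r * c) ^ 2) * ∑ j ∈ S s, W s j * ∏ u ∈ T s j, φ u
        ≤ prodExp (fun i => selWeight (p i)) (F s) := by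
    intro s hs
    have h1 : prodExp (fun i => selWeight (p i)) (F s) = ∑ j ∈ S s,
        (W s j * (k ^ (T s j).card)⁻¹ * ∏ u ∈ T s j, φ u) *
          prodExp (fun i => selWeight (p i)) (fun x => ∏ u ∈ T s j, ψ x u) := by
      simp only [hF, Finset.prod_mul_distrib, ← mul_assoc]
      rw [prodExp_sum]
      exact Finset.sum_congr rfl fun j _ => prodExp_const_mul _ _
    have h2 : ∀ j ∈ S s, 0 ≤ W s j * (k ^ (T s j).card)⁻¹ * ∏ u ∈ T s j, φ u := fun j hj =>
      mul_nonneg (mul_nonneg (hW s hs j hj) (by positivity))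
        (Finset.prod_nonneg fun u _ => (hφ u).1)
    have h3 : ∀ j ∈ S s, W s j * ∏ u ∈ T s j, φ u
        = (W s j * (k ^ (T s j).card)⁻¹ * ∏ u ∈ T s j, φ u) * k ^ (T s j).card := fun j _ => by
      have : k ^ (T s j).card ≠ 0 := by positivity
      field_simp
    have key := fun j (hj : j ∈ S s) => prodExp_prod_compensated (r := r) hp0 hpc (hT s hs j hj)
      (by exact_mod_cast hTr s hs j hj) hrc hc1 hc0 ha hb hk
    rw [h1, Finset.sum_congr rfl h3]
    constructor
    · exact Finset.sum_le_sum fun j hj => mul_le_mul_of_nonneg_left (key j hj).1 (h2 j hj)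
    · rw [Finset.mul_sum]
      refine Finset.sum_le_sum fun j hj => ?_
      rw [mul_left_comm]
      exact mul_le_mul_of_nonneg_left (key j hj).2 (h2 j hj)
  refine ⟨x, fun v => φ v * ψ x v, hφψ x, fun v hv hmiss hsum => ?_, fun s hs => ?_⟩
  · have h1 : missInd edge {v} x = 1 := by
      unfold missInd
      exact Finset.prod_eq_one fun i _ => by simp [hmiss i]
    have h2 : ∏ i, (1 - hitWeight p edge i v) ≤ k := by
      refine (prod_one_sub_le_inv _ (fun i _ => hh0 i v) fun i _ => (hpc i v).trans hc1).trans ?_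
      rw [div_le_iff₀ (by linarith [Finset.sum_nonneg fun i (_ : i ∈ Finset.univ) => hh0 i v])]
      have : k * (1 / k) ≤ k * (1 + ∑ i, hitWeight p edge i v) :=
        mul_le_mul_of_nonneg_left (by linarith) hk0.le
      rwa [mul_one_div_cancel hk0.ne'] at this
    simp only [hψ, h1, hv, mul_one, one_mul]
    exact hab1 v h2
  · have h1 := abs_le.1 (hx s hs)
    have h2 := hmean s hs
    constructor <;> linarith [h1.1, h1.2, h2.1, h2.2]

/-! ### The nibble -/

section nibble
variable {ι A V : Type*}

/-- The sets entering a statistic: edges (punctured for degree statistics) and single vertices. -/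
noncomputable def statSet (edge : ι → A → Finset V) :
    ι ⊕ (ℕ × V) ⊕ Unit → (ι × A) ⊕ V → Finset V
  | Sum.inr (Sum.inl (_, v)), Sum.inl (i, a) => (edge i a).erase v
  | _, Sum.inl (i, a) => edge i a
  | _, Sum.inr u => {u}

/-- The index set of a statistic. -/
noncomputable def statIdx [Fintype A] (Vs : Finset V) (I : ℕ → Finset ι) (edge : ι → A → Finset V) :
    ι ⊕ (ℕ × V) ⊕ Unit → Finset ((ι × A) ⊕ V)
  | Sum.inl i => (({i} : Finset ι) ×ˢ (Finset.univ : Finset A)).disjSum ∅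
  | Sum.inr (Sum.inl (j, v)) =>
      ((I j ×ˢ (Finset.univ : Finset A)).filter fun ia => v ∈ edge ia.1 ia.2).disjSum ∅
  | Sum.inr (Sum.inr _) => (∅ : Finset (ι × A)).disjSum Vs

/-- The initial weight attached to an index. -/
noncomputable def statWeight (ω : ι → A → ℝ) (Y : ℝ) : (ι × A) ⊕ V → ℝ
  | Sum.inl (i, a) => ω i a
  | Sum.inr _ => 1 / Y

/-- The value of a statistic after `K` rounds. -/
noncomputable def statVal [Fintype A] (Vs : Finset V) (I : ℕ → Finset ι) (edge : ι → A → Finset V)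
    (ω : ι → A → ℝ) (Y k : ℝ) (K : ℕ) (φ : V → ℝ) (s : ι ⊕ (ℕ × V) ⊕ Unit) : ℝ :=
  ∑ j ∈ statIdx Vs I edge s, statWeight (V := V) ω Y j *
    (k ^ (K * (statSet edge s j).card))⁻¹ * ∏ u ∈ statSet edge s j, φ u

/-- The statistics still of interest after round `K`. -/
noncomputable def statFam (Vs : Finset V) (I : ℕ → Finset ι) (m K : ℕ) :
    Finset (ι ⊕ (ℕ × V) ⊕ Unit) :=
  (((Finset.range m).filter fun j => K ≤ j).biUnion I).disjSum
    ((((Finset.range m).filter fun j => K ≤ j) ×ˢ Vs).disjSum {()})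

theorem sum_le_of_card_le_one {τ : Type*} {S : Finset τ} {f : τ → ℝ} {c : ℝ} (hc : 0 ≤ c)
    (h1 : ∀ a ∈ S, ∀ b ∈ S, a = b) (hf : ∀ a ∈ S, f a ≤ c) : ∑ a ∈ S, f a ≤ c := by
  rcases S.eq_empty_or_nonempty with rfl | ⟨a, ha⟩
  · simpa using hc
  · have : S = {a} := by
      ext b; simp only [Finset.mem_singleton]
      exact ⟨fun hb => h1 b hb a ha, fun h => h ▸ ha⟩
    rw [this, Finset.sum_singleton]; exact hf a ha

/-- Hypergraph data for the nibble. -/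
structure NibbleData [Fintype A] (Vs : Finset V) (I : ℕ → Finset ι) (edge : ι → A → Finset V)
    (ω : ι → A → ℝ) (m r n : ℕ) (k c Ω Y : ℝ) : Prop where
  hk0 : 0 < k
  hk1 : k < 1
  hI : ∀ j j', j ≠ j' → Disjoint (I j) (I j')
  hω0 : ∀ i a, 0 ≤ ω i a
  hω1 : ∀ i, ∑ a, ω i a ≤ 1
  hωΩ : ∀ i a, ω i a ≤ Ω
  hr1 : 1 ≤ r
  hr : ∀ i a, (edge i a).card ≤ r
  hdisj : ∀ i a a', a ≠ a' → Disjoint (edge i a) (edge i a')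
  hmeet : ∀ i i' a a', i ≠ i' → (edge i a ∩ edge i' a').card ≤ 1
  hn : ∀ j, (I j).card ≤ n
  hY : 0 < Y
  hcΩ : Ω * (k ^ (m * r))⁻¹ ≤ c
  hcY : 1 / Y * (k ^ m)⁻¹ ≤ c
  hc1 : c ≤ 1
  hrc : r * c ≤ 1 / 2

variable [Fintype A] {Vs : Finset V} {I : ℕ → Finset ι} {edge : ι → A → Finset V}
  {ω : ι → A → ℝ} {m r n : ℕ} {k c Ω Y : ℝ}

theorem inv_pow_le_inv_pow_of_le {k : ℝ} (hk0 : 0 < k) (hk1 : k < 1) {a b : ℕ} (h : a ≤ b) :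
    (k ^ a)⁻¹ ≤ (k ^ b)⁻¹ :=
  inv_anti₀ (pow_pos hk0 _) (pow_le_pow_of_le_one hk0.le hk1.le h)

theorem NibbleData.c_nonneg (H : NibbleData Vs I edge ω m r n k c Ω Y) : 0 ≤ c := by
  have := H.hk0; have := H.hY
  exact le_trans (by positivity) H.hcY

theorem NibbleData.statWeight_nonneg (H : NibbleData Vs I edge ω m r n k c Ω Y)
    (j : (ι × A) ⊕ V) : 0 ≤ statWeight ω Y j := by
  rcases j with ⟨i, a⟩ | u
  · exact H.hω0 i a
  · exact (one_div_pos.2 H.hY).le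

theorem NibbleData.card_statSet_le (H : NibbleData Vs I edge ω m r n k c Ω Y)
    (s : ι ⊕ (ℕ × V) ⊕ Unit) (j : (ι × A) ⊕ V) : (statSet edge s j).card ≤ r := by
  rcases s with i | ⟨j', v⟩ | ⟨⟩ <;> rcases j with ⟨i', a⟩ | u
  all_goals simp only [statSet, Finset.card_singleton]
  any_goals exact H.hr _ _
  any_goals exact H.hr1
  exact (Finset.card_le_card (Finset.erase_subset _ _)).trans (H.hr _ _)

theorem NibbleData.term_le (H : NibbleData Vs I edge ω m r n k c Ω Y) {K : ℕ} (hK : K ≤ m)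
    (s : ι ⊕ (ℕ × V) ⊕ Unit) (j : (ι × A) ⊕ V) :
    statWeight ω Y j * (k ^ (K * (statSet edge s j).card))⁻¹ ≤ c := by
  have hk0 := H.hk0
  have hY := H.hY
  have hcard := H.card_statSet_le s j
  rcases j with ⟨i', a⟩ | u
  · refine le_trans ?_ H.hcΩ
    refine mul_le_mul (H.hωΩ _ _) (inv_pow_le_inv_pow_of_le H.hk0 H.hk1 (Nat.mul_le_mul hK hcard))
      (by positivity) ((H.hω0 i' a).trans (H.hωΩ i' a))
  · refine le_trans ?_ H.hcY
    have : (statSet edge s (Sum.inr u)).card = 1 := by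
      rcases s with i | ⟨j', v⟩ | ⟨⟩ <;> simp [statSet]
    rw [this, mul_one]
    exact mul_le_mul_of_nonneg_left (inv_pow_le_inv_pow_of_le H.hk0 H.hk1 hK)
      (one_div_pos.2 hY).le

theorem NibbleData.vertex_weight_le (H : NibbleData Vs I edge ω m r n k c Ω Y) {K : ℕ} (hK : K ≤ m)
    (s : ι ⊕ (ℕ × V) ⊕ Unit) (u : V) :
    ∑ j ∈ statIdx Vs I edge s with u ∈ statSet edge s j,
      statWeight ω Y j * (k ^ (K * (statSet edge s j).card))⁻¹ ≤ c := by
  refine sum_le_of_card_le_one H.c_nonneg ?_ fun j _ => H.term_le hK s j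
  have hsame : ∀ i a a', u ∈ edge i a → u ∈ edge i a' → a = a' := by
    intro i a a' h h'
    by_contra hne
    exact Finset.disjoint_left.1 (H.hdisj i a a' hne) h h'
  intro x hx y hy
  rw [Finset.mem_filter] at hx hy
  obtain ⟨hx1, hx2⟩ := hx
  obtain ⟨hy1, hy2⟩ := hy
  rcases s with i | ⟨j', v⟩ | ⟨⟩ <;> rcases x with ⟨i1, a1⟩ | u1 <;> rcases y with ⟨i2, a2⟩ | u2 <;>
    simp [statIdx, statSet] at hx1 hy1 hx2 hy2 ⊢
  · subst hx1 hy1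
    exact ⟨rfl, hsame _ _ _ hx2 hy2⟩
  · by_cases hi : i1 = i2
    · subst hi
      exact ⟨rfl, hsame _ _ _ hx2.2 hy2.2⟩
    · exfalso
      have h1 := H.hmeet i1 i2 a1 a2 hi
      exact hx2.1 (Finset.card_le_one.1 h1 u (Finset.mem_inter.2 ⟨hx2.2, hy2.2⟩) v
        (Finset.mem_inter.2 ⟨hx1.2, hy1.2⟩))
  · rw [← hx2, ← hy2]

theorem NibbleData.statSet_inter_card_le (H : NibbleData Vs I edge ω m r n k c Ω Y) {K : ℕ}
    {s : ι ⊕ (ℕ × V) ⊕ Unit} (hs : s ∈ statFam Vs I m (K + 1)) {j : (ι × A) ⊕ V}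
    (hj : j ∈ statIdx Vs I edge s) {i : ι} (hi : i ∈ I K) (a : A) :
    (statSet edge s j ∩ edge i a).card ≤ 1 := by
  have hne : ∀ j' i', K + 1 ≤ j' → i' ∈ I j' → i' ≠ i := by
    intro j' i' h hi' heq
    exact Finset.disjoint_left.1 (H.hI j' K (by omega)) hi' (heq ▸ hi)
  rcases s with i1 | ⟨j', v⟩ | ⟨⟩ <;> rcases j with ⟨i2, a2⟩ | u <;>
    simp [statIdx, statSet, statFam] at hs hj ⊢
  · subst hj
    obtain ⟨j', ⟨_, h2⟩, h3⟩ := hs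
    exact H.hmeet _ _ _ _ (hne j' _ h2 h3)
  · refine (Finset.card_le_card (Finset.erase_subset _ _)).trans ?_
    exact H.hmeet _ _ _ _ (hne j' _ hs.1.2 hj.1)
  · exact (Finset.card_le_card Finset.inter_subset_left).trans (by simp)

theorem NibbleData.statVal_inl (K : ℕ) (φ : V → ℝ) (i : ι) :
    statVal Vs I edge ω Y k K φ (Sum.inl i)
      = ∑ a, ω i a * (k ^ (K * (edge i a).card))⁻¹ * ∏ u ∈ edge i a, φ u := by
  simp [statVal, statIdx, statSet, statWeight]

theorem NibbleData.statVal_degree (K : ℕ) (φ : V → ℝ) (j : ℕ) (v : V) :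
    statVal Vs I edge ω Y k K φ (Sum.inr (Sum.inl (j, v)))
      = ∑ i ∈ I j, ∑ a with v ∈ edge i a, ω i a * (k ^ (K * ((edge i a).erase v).card))⁻¹ *
          ∏ u ∈ (edge i a).erase v, φ u := by
  simp only [statVal, statIdx, statSet, statWeight, Finset.sum_disjSum, Finset.sum_empty, add_zero]
  rw [Finset.sum_filter, Finset.sum_product]
  exact Finset.sum_congr rfl fun i _ => (Finset.sum_filter _ _).symm

theorem NibbleData.statVal_size (K : ℕ) (φ : V → ℝ) (x : Unit) :
    statVal Vs I edge ω Y k K φ (Sum.inr (Sum.inr x))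
      = ∑ v ∈ Vs, 1 / Y * (k ^ K)⁻¹ * φ v := by
  simp [statVal, statIdx, statSet, statWeight]

theorem NibbleData.statVal_nonneg (H : NibbleData Vs I edge ω m r n k c Ω Y) (K : ℕ) {φ : V → ℝ}
    (hφ : ∀ v, 0 ≤ φ v ∧ φ v ≤ 1) (s : ι ⊕ (ℕ × V) ⊕ Unit) :
    0 ≤ statVal Vs I edge ω Y k K φ s := by
  have hk0 := H.hk0
  exact Finset.sum_nonneg fun j _ => mul_nonneg (mul_nonneg (H.statWeight_nonneg j) (by positivity))
    (Finset.prod_nonneg fun u _ => (hφ u).1)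

/-- The selection probabilities in round `K`. -/
noncomputable def roundProb (edge : ι → A → Finset V) (ω : ι → A → ℝ) (k N : ℝ) (K : ℕ)
    (φ : V → ℝ) (i : ι) (a : A) : ℝ :=
  ω i a * (k ^ (K * (edge i a).card))⁻¹ * (∏ u ∈ edge i a, φ u) / N

/-- The state of the nibble after `K` rounds. -/
structure NibbleState (Vs : Finset V) (I : ℕ → Finset ι) (edge : ι → A → Finset V)
    (ω : ι → A → ℝ) (m : ℕ) (k Y g η t : ℝ) (K : ℕ) (x : ι → Option A) (φ : V → ℝ) : Prop where
  range : ∀ v, 0 ≤ φ v ∧ φ v ≤ 1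
  uncovered : ∀ v ∈ Vs, (∀ j < K, ∀ i ∈ I j, v ∉ hitSet (edge i) (x i)) → φ v = 1
  mass : ∀ j, K ≤ j → j < m → ∀ i ∈ I j, statVal Vs I edge ω Y k K φ (Sum.inl i) ≤ 1 + K * t
  degree : ∀ j, K ≤ j → j < m → ∀ v ∈ Vs,
    (1 - K * η) * (g * k ^ j) - K * t ≤ statVal Vs I edge ω Y k K φ (Sum.inr (Sum.inl (j, v)))
  size : statVal Vs I edge ω Y k K φ (Sum.inr (Sum.inr ())) ≤ Vs.card / Y + K * t

theorem NibbleData.hit_sum_ge (H : NibbleData Vs I edge ω m r n k c Ω Y) {g η t : ℝ} (ht : 0 ≤ t)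
    (hg : 0 ≤ g) (hη : 0 ≤ η)
    (hfin : (1 / k - 1) * (1 + m * t) ≤ g * (1 - m * η) - m * t * (k ^ m)⁻¹)
    {K : ℕ} (hK : K < m) {x : ι → Option A} {φ : V → ℝ}
    (hS : NibbleState Vs I edge ω m k Y g η t K x φ) {v : V} (hv : v ∈ Vs) (hφv : φ v = 1) :
    1 / k - 1 ≤ ∑ i : I K, hitWeight (fun i : I K => roundProb edge ω k (1 + m * t) K φ i)
      (fun i : I K => edge i) i v := by
  have hk0 := H.hk0
  have hN : 0 < 1 + m * t := by positivity
  have h1 : ∑ i : I K, hitWeight (fun i : I K => roundProb edge ω k (1 + m * t) K φ i)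
      (fun i : I K => edge i) i v
      = (k ^ K)⁻¹ * statVal Vs I edge ω Y k K φ (Sum.inr (Sum.inl (K, v))) / (1 + m * t) := by
    rw [NibbleData.statVal_degree, Finset.mul_sum, Finset.sum_div, ← Finset.sum_coe_sort (I K)]
    refine Finset.sum_congr rfl fun i _ => ?_
    rw [hitWeight, Finset.mul_sum, Finset.sum_div]
    refine Finset.sum_congr rfl fun a ha => ?_
    have hva : v ∈ edge i a := (Finset.mem_filter.1 ha).2
    rw [roundProb, ← Finset.mul_prod_erase _ _ hva, hφv, one_mul,
      ← Finset.card_erase_add_one hva, mul_add, mul_one, pow_add, mul_inv]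
    ring
  have h2 := hS.degree K le_rfl hK v hv
  rw [h1, le_div_iff₀ hN]
  have hKm : (K : ℝ) ≤ m := by exact_mod_cast hK.le
  have h3 : (k ^ K)⁻¹ ≤ (k ^ m)⁻¹ := inv_pow_le_inv_pow_of_le H.hk0 H.hk1 hK.le
  calc (1 / k - 1) * (1 + m * t) ≤ g * (1 - m * η) - m * t * (k ^ m)⁻¹ := hfin
    _ ≤ g * (1 - K * η) - K * t * (k ^ K)⁻¹ := by
        have : K * η ≤ m * η := by gcongr
        have h4 : g * (1 - m * η) ≤ g * (1 - K * η) := by gcongr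
        have h5 : K * t * (k ^ K)⁻¹ ≤ m * t * (k ^ m)⁻¹ := by gcongr
        linarith
    _ = (k ^ K)⁻¹ * ((1 - K * η) * (g * k ^ K) - K * t) := by
        have : k ^ K ≠ 0 := by positivity
        field_simp
    _ ≤ _ := by gcongr

theorem NibbleData.step (H : NibbleData Vs I edge ω m r n k c Ω Y) {g η t l : ℝ} (ht : 0 ≤ t)
    (hg : 0 ≤ g) (hη : 2 * n * (r * c) ^ 2 ≤ η) (hη1 : η ≤ 1)
    (hfin : (1 / k - 1) * (1 + m * t) ≤ g * (1 - m * η) - m * t * (k ^ m)⁻¹)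
    (hl0 : 0 < l) (hl : l * (2 * r * c) ≤ 1) {Nst : ℝ}
    (hNst : ∀ K, ((statFam Vs I m K).card : ℝ) ≤ Nst)
    (hsmall : 2 * Nst * Real.exp (n * (l * (2 * r * c)) ^ 2 - l * t) < 1)
    {K : ℕ} (hK : K < m) {x : ι → Option A} {φ : V → ℝ}
    (hS : NibbleState Vs I edge ω m k Y g η t K x φ) :
    ∃ x' φ', NibbleState Vs I edge ω m k Y g η t (K + 1) x' φ' := by
  have hk0 := H.hk0
  have hc0 := H.c_nonneg
  have hη0 : 0 ≤ η := le_trans (by positivity) hη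
  have hN : 0 < 1 + m * t := by positivity
  have hN1 : 1 ≤ 1 + m * t := by nlinarith [mul_nonneg (Nat.cast_nonneg (α := ℝ) m) ht]
  have hKm : (K : ℝ) ≤ m := by exact_mod_cast hK.le
  have hKt : (K : ℝ) * t ≤ m * t := by gcongr
  have hcardI : (Fintype.card (I K) : ℝ) ≤ n := by
    rw [Fintype.card_coe]; exact_mod_cast H.hn K
  have hprod01 : ∀ T : Finset V, 0 ≤ ∏ u ∈ T, φ u ∧ ∏ u ∈ T, φ u ≤ 1 := fun T =>
    ⟨Finset.prod_nonneg fun u _ => (hS.range u).1,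
      Finset.prod_le_one (fun u _ => (hS.range u).1) fun u _ => (hS.range u).2⟩
  have hp0 : ∀ i a, 0 ≤ roundProb edge ω k (1 + m * t) K φ i a := fun i a =>
    div_nonneg (mul_nonneg (mul_nonneg (H.hω0 i a) (by positivity)) (hprod01 _).1) hN.le
  have hp1 : ∀ i : I K, ∑ a, roundProb edge ω k (1 + m * t) K φ i a ≤ 1 := by
    intro i
    have h1 := hS.mass K le_rfl hK i i.2
    rw [NibbleData.statVal_inl] at h1
    simp only [roundProb]
    rw [← Finset.sum_div, div_le_one hN]
    linarith
  have hpc : ∀ (i : I K) v, hitWeight (fun i : I K => roundProb edge ω k (1 + m * t) K φ i)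
      (fun i : I K => edge i) i v ≤ c := by
    intro i v
    refine sum_le_of_card_le_one hc0 ?_ fun a _ => ?_
    · intro a ha b hb
      by_contra hne
      exact Finset.disjoint_left.1 (H.hdisj i a b hne) (Finset.mem_filter.1 ha).2
        (Finset.mem_filter.1 hb).2
    · have h1 := H.term_le hK.le (Sum.inl i.1) (Sum.inl (i.1, a))
      simp only [statWeight, statSet] at h1
      change roundProb edge ω k (1 + m * t) K φ i a ≤ c
      unfold roundProb
      refine (div_le_self (mul_nonneg (mul_nonneg (H.hω0 i a) (by positivity)) (hprod01 _).1)
        hN1).trans (le_trans ?_ h1)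
      exact mul_le_of_le_one_right (mul_nonneg (H.hω0 i a) (by positivity)) (hprod01 _).2
  have hval : ∀ s (ψ : V → ℝ), ∑ j ∈ statIdx Vs I edge s,
      (statWeight ω Y j * (k ^ (K * (statSet edge s j).card))⁻¹) *
        (k ^ (statSet edge s j).card)⁻¹ * ∏ u ∈ statSet edge s j, ψ u
      = statVal Vs I edge ω Y k (K + 1) ψ s := by
    intro s ψ
    refine Finset.sum_congr rfl fun j _ => ?_
    rw [add_mul, one_mul, pow_add, mul_inv, mul_assoc (statWeight ω Y j)]
  obtain ⟨xr, φ', hφ', hcov, hst⟩ := exists_round (fun i : I K => edge i)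
    (fun i : I K => roundProb edge ω k (1 + m * t) K φ i) (t := t) (l := l) (r := r) (c := c)
    H.hk0 H.hk1 (fun i a => hp0 i a) hp1 hpc (fun i a => H.hr i a) hc0 H.hc1 H.hrc
    (statFam Vs I m (K + 1)) (statIdx Vs I edge) (statSet edge)
    (fun s j => statWeight ω Y j * (k ^ (K * (statSet edge s j).card))⁻¹)
    (fun s _ j _ => mul_nonneg (H.statWeight_nonneg j) (by positivity))
    (fun s hs j hj i a => H.statSet_inter_card_le hs hj i.2 a)
    (fun s _ j _ => H.card_statSet_le s j)
    (fun s _ u => by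
      have h1 := H.vertex_weight_le (K := K + 1) hK s u
      refine le_of_eq_of_le (Finset.sum_congr rfl fun j _ => ?_) h1
      rw [add_mul, one_mul, pow_add, mul_inv, mul_assoc (statWeight ω Y j)])
    φ hS.range hl0 hl (by
      refine lt_of_le_of_lt ?_ hsmall
      have := hNst (K + 1)
      have hNst0 : 0 ≤ Nst := (Nat.cast_nonneg _).trans this
      gcongr)
  simp only [hval] at hst
  have hold : ∀ s, ∑ j ∈ statIdx Vs I edge s,
      (statWeight ω Y j * (k ^ (K * (statSet edge s j).card))⁻¹) * ∏ u ∈ statSet edge s j, φ u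
      = statVal Vs I edge ω Y k K φ s := fun s => rfl
  simp only [hold] at hst
  refine ⟨fun i => if h : i ∈ I K then xr ⟨i, h⟩ else x i, φ', hφ', ?_, ?_, ?_, ?_⟩
  · intro v hv hunc
    have h1 : φ v = 1 := by
      refine hS.uncovered v hv fun j hj i hi => ?_
      have h2 := hunc j (by omega) i hi
      rwa [dif_neg] at h2
      exact fun h => Finset.disjoint_left.1 (H.hI j K (by omega)) hi h
    refine hcov v h1 (fun i => ?_) (H.hit_sum_ge ht hg hη0 hfin hK hS hv h1)
    have h2 := hunc K (by omega) i i.2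
    rwa [dif_pos i.2] at h2
  · intro j hj hjm i hi
    have h1 := (hst (Sum.inl i) (by
      simp only [statFam, Finset.inl_mem_disjSum, Finset.mem_biUnion, Finset.mem_filter,
        Finset.mem_range]
      exact ⟨j, ⟨hjm, hj⟩, hi⟩)).1
    have h2 := hS.mass j (by omega) hjm i hi
    push_cast
    linarith
  · intro j hj hjm v hv
    have h1 := (hst (Sum.inr (Sum.inl (j, v))) (by
      simp only [statFam, Finset.inr_mem_disjSum, Finset.inl_mem_disjSum, Finset.mem_product,
        Finset.mem_filter, Finset.mem_range]
      exact ⟨⟨hjm, hj⟩, hv⟩)).2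
    have h2 := hS.degree j (by omega) hjm v hv
    have h3 := H.statVal_nonneg K hS.range (Sum.inr (Sum.inl (j, v)))
    set F := statVal Vs I edge ω Y k K φ (Sum.inr (Sum.inl (j, v)))
    have h4 : (1 - η) * F ≤ (1 - 2 * Fintype.card (I K) * (r * c) ^ 2) * F := by
      refine mul_le_mul_of_nonneg_right ?_ h3
      have : 2 * (Fintype.card (I K) : ℝ) * (r * c) ^ 2 ≤ 2 * n * (r * c) ^ 2 := by gcongr
      linarith
    have h5 : (1 - η) * ((1 - K * η) * (g * k ^ j) - K * t) ≤ (1 - η) * F :=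
      mul_le_mul_of_nonneg_left h2 (by linarith)
    have h6 : 0 ≤ K * η * η * (g * k ^ j) := by positivity
    have h7 : 0 ≤ η * (K * t) := by positivity
    push_cast
    nlinarith
  · have h1 := (hst (Sum.inr (Sum.inr ())) (by
      simp [statFam])).1
    have h2 := hS.size
    push_cast
    linarith

/-- The nibble: a choice of edges leaving only about a proportion `k ^ m` of vertices uncovered. -/
theorem NibbleData.exists_cover (H : NibbleData Vs I edge ω m r n k c Ω Y) {g η t l : ℝ} (ht : 0 ≤ t)
    (hg : 0 ≤ g) (hη : 2 * n * (r * c) ^ 2 ≤ η) (hη1 : η ≤ 1)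
    (hfin : (1 / k - 1) * (1 + m * t) ≤ g * (1 - m * η) - m * t * (k ^ m)⁻¹)
    (hl0 : 0 < l) (hl : l * (2 * r * c) ≤ 1)
    (hsmall : 2 * (m * n + m * Vs.card + 1) * Real.exp (n * (l * (2 * r * c)) ^ 2 - l * t) < 1)
    (hD : ∀ j < m, ∀ v ∈ Vs, g * k ^ j ≤ ∑ i ∈ I j, ∑ a with v ∈ edge i a, ω i a) :
    ∃ x : ι → Option A,
      ((Vs.filter fun v => ∀ j < m, ∀ i ∈ I j, v ∉ hitSet (edge i) (x i)).card : ℝ)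
        ≤ k ^ m * (Vs.card + m * t * Y) := by
  have hk0 := H.hk0
  have hY := H.hY
  have hNst : ∀ K, ((statFam Vs I m K).card : ℝ) ≤ m * n + m * Vs.card + 1 := by
    intro K
    have hf : ((Finset.range m).filter fun j => K ≤ j).card ≤ m :=
      (Finset.card_filter_le _ _).trans (by simp)
    have h1 : (statFam Vs I m K).card ≤ m * n + m * Vs.card + 1 := by
      rw [statFam, Finset.card_disjSum, Finset.card_disjSum, Finset.card_product,
        Finset.card_singleton, ← add_assoc]
      gcongr
      refine (Finset.card_biUnion_le_card_mul _ _ n fun j _ => H.hn j).trans ?_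
      gcongr
    exact_mod_cast h1
  have hall : ∀ K ≤ m, ∃ x φ, NibbleState Vs I edge ω m k Y g η t K x φ := by
    intro K
    induction K with
    | zero =>
      intro _
      refine ⟨fun _ => none, fun _ => 1, fun v => by simp, fun v _ _ => rfl, ?_, ?_, ?_⟩
      · intro j _ _ i _
        rw [NibbleData.statVal_inl]
        simpa using H.hω1 i
      · intro j _ hj v hv
        rw [NibbleData.statVal_degree]
        simpa using hD j hj v hv
      · rw [NibbleData.statVal_size]
        simp only [pow_zero, inv_one, mul_one, Finset.sum_const, nsmul_eq_mul, Nat.cast_zero,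
          zero_mul, add_zero]
        rw [mul_one_div]
    | succ K ih =>
      intro hK
      obtain ⟨x, φ, hS⟩ := ih (by omega)
      exact H.step ht hg hη hη1 hfin hl0 hl hNst hsmall (by omega) hS
  obtain ⟨x, φ, hS⟩ := hall m le_rfl
  refine ⟨x, ?_⟩
  have h1 := hS.size
  rw [NibbleData.statVal_size, ← Finset.mul_sum] at h1
  have h2 : ((Vs.filter fun v => ∀ j < m, ∀ i ∈ I j, v ∉ hitSet (edge i) (x i)).card : ℝ)
      ≤ ∑ v ∈ Vs, φ v := by
    rw [Finset.card_eq_sum_ones, Nat.cast_sum]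
    calc _ = ∑ v ∈ Vs.filter fun v => ∀ j < m, ∀ i ∈ I j, v ∉ hitSet (edge i) (x i), φ v :=
          Finset.sum_congr rfl fun v hv => by
            rw [hS.uncovered v (Finset.mem_filter.1 hv).1 (Finset.mem_filter.1 hv).2]; simp
      _ ≤ _ := Finset.sum_le_sum_of_subset_of_nonneg (Finset.filter_subset _ _)
          fun v _ _ => (hS.range v).1
  refine h2.trans ?_
  have hkm : 0 < k ^ m := by positivity
  have h3 : ∑ v ∈ Vs, φ v = (Y * k ^ m) * (1 / Y * (k ^ m)⁻¹ * ∑ v ∈ Vs, φ v) := by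
    field_simp
  rw [h3]
  calc _ ≤ (Y * k ^ m) * (Vs.card / Y + m * t) := by gcongr
    _ = k ^ m * (Vs.card * (Y / Y) + m * t * Y) := by ring
    _ = _ := by rw [div_self hY.ne', mul_one]

end nibble

/-! ### Averaging over residue classes -/

/-- The average of `f` over all choices of residues `β p`, `0 ≤ β p < p`, for `p` in the list. -/
noncomputable def avg : List ℕ → ((ℕ → ℤ) → ℝ) → (ℕ → ℤ) → ℝ
  | [], f, β => f β
  | p :: l, f, β => (∑ r ∈ Finset.range p, avg l f (Function.update β p r)) / p

theorem avg_append (l₁ l₂ : List ℕ) (f : (ℕ → ℤ) → ℝ) (β : ℕ → ℤ) :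
    avg (l₁ ++ l₂) f β = avg l₁ (avg l₂ f) β := by
  induction l₁ generalizing β with
  | nil => rfl
  | cons p l ih => simp only [List.cons_append, avg, ih]

theorem avg_add (l : List ℕ) (f g : (ℕ → ℤ) → ℝ) (β : ℕ → ℤ) :
    avg l (fun β => f β + g β) β = avg l f β + avg l g β := by
  induction l generalizing β with
  | nil => rfl
  | cons p l ih => simp only [avg, ih, Finset.sum_add_distrib, add_div]

theorem avg_const_mul (l : List ℕ) (c : ℝ) (f : (ℕ → ℤ) → ℝ) (β : ℕ → ℤ) :
    avg l (fun β => c * f β) β = c * avg l f β := by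
  induction l generalizing β with
  | nil => rfl
  | cons p l ih => simp only [avg, ih, ← Finset.mul_sum, mul_div_assoc]

theorem avg_zero (l : List ℕ) (β : ℕ → ℤ) : avg l (fun _ => 0) β = 0 := by
  simpa using avg_const_mul l 0 (fun _ => 0) β

theorem avg_sum {τ : Type*} (l : List ℕ) (s : Finset τ) (f : τ → (ℕ → ℤ) → ℝ) (β : ℕ → ℤ) :
    avg l (fun β => ∑ i ∈ s, f i β) β = ∑ i ∈ s, avg l (f i) β := by
  induction s using Finset.induction_on with
  | empty => simpa using avg_zero l β
  | insert a s ha ih => simp only [Finset.sum_insert ha, avg_add, ih]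

theorem avg_mono {l : List ℕ} {f g : (ℕ → ℤ) → ℝ} {β : ℕ → ℤ}
    (h : ∀ β', (∀ p ∉ l, β' p = β p) → f β' ≤ g β') : avg l f β ≤ avg l g β := by
  induction l generalizing β with
  | nil => exact h β fun _ _ => rfl
  | cons p l ih =>
    simp only [avg]
    gcongr with r hr
    refine ih fun β' hβ' => h β' fun p' hp' => ?_
    rw [List.mem_cons, not_or] at hp'
    rw [hβ' p' hp'.2, Function.update_of_ne hp'.1]

theorem avg_congr {l : List ℕ} {f g : (ℕ → ℤ) → ℝ} {β : ℕ → ℤ}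
    (h : ∀ β', (∀ p ∉ l, β' p = β p) → f β' = g β') : avg l f β = avg l g β :=
  le_antisymm (avg_mono fun β' hβ' => (h β' hβ').le) (avg_mono fun β' hβ' => (h β' hβ').ge)

theorem avg_const {l : List ℕ} (hl : ∀ p ∈ l, 0 < p) (c : ℝ) (β : ℕ → ℤ) :
    avg l (fun _ => c) β = c := by
  induction l generalizing β with
  | nil => rfl
  | cons p l ih =>
    have hp : (p : ℝ) ≠ 0 := by exact_mod_cast (hl p (by simp)).ne'
    simp only [avg, ih fun p hp => hl p (by simp [hp]), Finset.sum_const, Finset.card_range,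
      nsmul_eq_mul]
    field_simp

theorem exists_le_of_avg_lt {l : List ℕ} (hl : ∀ p ∈ l, 0 < p) {f : (ℕ → ℤ) → ℝ} {c : ℝ}
    {β : ℕ → ℤ} (h : avg l f β < c) : ∃ β', f β' < c := by
  by_contra! hcon
  have := avg_mono (l := l) (f := fun _ => c) (g := f) (β := β) fun β' _ => hcon β'
  rw [avg_const hl] at this
  linarith

theorem avg_prod {l : List ℕ} (hl : l.Nodup) (G : ℕ → ℤ → ℝ) (β : ℕ → ℤ) :
    avg l (fun β' => ∏ p ∈ l.toFinset, G p (β' p)) β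
      = ∏ p ∈ l.toFinset, (∑ r ∈ Finset.range p, G p r) / p := by
  induction l generalizing β with
  | nil => simp [avg]
  | cons p l ih =>
    rw [List.nodup_cons] at hl
    have hp : p ∉ l.toFinset := by simpa using hl.1
    rw [List.toFinset_cons, Finset.prod_insert hp, avg, ← ih hl.2 β, Finset.sum_div, Finset.sum_div,
      Finset.sum_mul]
    refine Finset.sum_congr rfl fun r _ => ?_
    rw [div_mul_eq_mul_div, ← avg_const_mul]
    congr 1
    have h1 : avg l (fun β' => ∏ p ∈ insert p l.toFinset, G p (β' p)) (Function.update β p r)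
        = avg l (fun β' => G p r * ∏ p ∈ l.toFinset, G p (β' p)) (Function.update β p r) := by
      refine avg_congr fun β' hβ' => ?_
      rw [Finset.prod_insert hp, hβ' p hl.1, Function.update_self]
    rw [h1, avg_const_mul, avg_const_mul, ih hl.2, ih hl.2]

/-! ### Survival probabilities -/

/-- `v` avoids the residue class `β p` modulo every `p` in the list. -/
def Surv (l : List ℕ) (β : ℕ → ℤ) (v : ℤ) : Prop := ∀ p ∈ l, ¬ (p : ℤ) ∣ v - β p

/-- The number of residue classes modulo `p` met by `T`. -/
def resCard (p : ℕ) (T : Finset ℤ) : ℕ := (T.image fun v => v % (p : ℤ)).card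

theorem resCard_le_card (p : ℕ) (T : Finset ℤ) : resCard p T ≤ T.card := Finset.card_image_le

theorem sum_range_avoid {p : ℕ} (hp : 0 < p) (T : Finset ℤ) :
    ∑ r ∈ Finset.range p, (if ∀ u ∈ T, ¬ (p : ℤ) ∣ u - (r : ℤ) then (1 : ℝ) else 0)
      = p - resCard p T := by
  have hp' : (0 : ℤ) < p := by exact_mod_cast hp
  have h1 : ∀ r ∈ Finset.range p, (∀ u ∈ T, ¬ (p : ℤ) ∣ u - (r : ℤ)) ↔
      r ∉ T.image fun v => (v % (p : ℤ)).toNat := by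
    intro r hr
    have hr' : (r : ℤ) < p := by exact_mod_cast Finset.mem_range.1 hr
    simp only [Finset.mem_image, not_exists, not_and]
    refine forall₂_congr fun u _ => not_congr ?_
    have h2 : 0 ≤ u % (p : ℤ) := Int.emod_nonneg _ hp'.ne'
    have h3 : (u % (p : ℤ)).toNat = r ↔ u % (p : ℤ) = r := by omega
    rw [h3, Int.dvd_iff_emod_eq_zero, ← Int.emod_eq_emod_iff_emod_sub_eq_zero,
      Int.emod_eq_of_lt (by positivity : (0 : ℤ) ≤ r) hr']
  rw [Finset.sum_congr rfl fun r hr => by rw [if_congr (h1 r hr) rfl rfl], Finset.sum_ite,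
    Finset.sum_const_zero, add_zero, Finset.sum_const, nsmul_one]
  have h4 : (T.image fun v => (v % (p : ℤ)).toNat).card = resCard p T := by
    rw [resCard]
    have : (T.image fun v => (v % (p : ℤ)).toNat) = (T.image fun v => v % (p : ℤ)).image Int.toNat := by
      rw [Finset.image_image]; rfl
    rw [this]
    refine Finset.card_image_of_injOn ?_
    intro a ha b hb hab
    simp only [Finset.coe_image, Set.mem_image] at ha hb
    obtain ⟨u, _, rfl⟩ := ha
    obtain ⟨v, _, rfl⟩ := hb
    have h2 : 0 ≤ u % (p : ℤ) := Int.emod_nonneg _ hp'.ne'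
    have h3 : 0 ≤ v % (p : ℤ) := Int.emod_nonneg _ hp'.ne'
    omega
  have h5 : ((Finset.range p).filter fun r => r ∉ T.image fun v => (v % (p : ℤ)).toNat).card
      + resCard p T = p := by
    rw [← h4, ← Finset.sdiff_eq_filter, Finset.card_sdiff_add_card_eq_card, Finset.card_range]
    intro r hr
    obtain ⟨u, _, rfl⟩ := Finset.mem_image.1 hr
    have h2 : 0 ≤ u % (p : ℤ) := Int.emod_nonneg _ hp'.ne'
    have h3 : u % (p : ℤ) < p := Int.emod_lt_of_pos _ hp'
    rw [Finset.mem_range]; omega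
  rw [eq_sub_iff_add_eq]
  exact_mod_cast h5

/-- The probability that all of `T` survives. -/
noncomputable def survProb (P : Finset ℕ) (T : Finset ℤ) : ℝ := ∏ p ∈ P, (1 - (resCard p T : ℝ) / p)

/-- The probability that a set of `t` elements in distinct residue classes survives. -/
noncomputable def distProb (P : Finset ℕ) (t : ℕ) : ℝ := ∏ p ∈ P, (1 - (t : ℝ) / p)

theorem avg_surv {l : List ℕ} (hl : l.Nodup) (hl0 : ∀ p ∈ l, 0 < p) (T : Finset ℤ) (β : ℕ → ℤ) :
    avg l (fun β' => if ∀ u ∈ T, Surv l β' u then 1 else 0) β = survProb l.toFinset T := by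
  have h1 : (fun β' : ℕ → ℤ => if ∀ u ∈ T, Surv l β' u then (1 : ℝ) else 0)
      = fun β' => ∏ p ∈ l.toFinset,
        (fun (p : ℕ) (r : ℤ) => if ∀ u ∈ T, ¬ (p : ℤ) ∣ u - r then (1 : ℝ) else 0) p (β' p) := by
    funext β'
    simp only [Finset.prod_ite_zero, Finset.prod_const_one, List.mem_toFinset, Surv]
    congr 1
    exact propext ⟨fun h p hp u hu => h u hu p hp, fun h u hu p hp => h p hp u hu⟩
  rw [h1]
  refine (avg_prod hl
    (fun (p : ℕ) (r : ℤ) => if ∀ u ∈ T, ¬ (p : ℤ) ∣ u - r then (1 : ℝ) else 0) β).trans ?_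
  refine Finset.prod_congr rfl fun p hp => ?_
  have hp0 := hl0 p (by simpa using hp)
  rw [sum_range_avoid hp0, sub_div, div_self (by positivity)]

/-! ### Pair correlations -/

/-- The elements of `e` lie in distinct residue classes modulo `p`. -/
def DistinctMod (p : ℕ) (e : Finset ℤ) : Prop := ∀ u ∈ e, ∀ v ∈ e, (p : ℤ) ∣ u - v → u = v

theorem DistinctMod.resCard_eq {p : ℕ} {e : Finset ℤ} (h : DistinctMod p e) :
    resCard p e = e.card := by
  refine Finset.card_image_of_injOn fun u hu v hv huv => h u hu v hv ?_
  rw [Int.dvd_iff_emod_eq_zero, ← Int.emod_eq_emod_iff_emod_sub_eq_zero]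
  exact huv

theorem survProb_eq_distProb {P : Finset ℕ} {e : Finset ℤ} (h : ∀ p ∈ P, DistinctMod p e) :
    survProb P e = distProb P e.card :=
  Finset.prod_congr rfl fun p hp => by rw [(h p hp).resCard_eq]

/-- The number of pairs in `e × e'` congruent modulo `p`. -/
noncomputable def congPairs (p : ℕ) (e e' : Finset ℤ) : ℕ :=
  ((e ×ˢ e').filter fun x => (p : ℤ) ∣ x.1 - x.2).card

theorem card_add_card_le_resCard_union {p : ℕ} {e e' : Finset ℤ} (h : DistinctMod p e)
    (h' : DistinctMod p e') : e.card + e'.card ≤ resCard p (e ∪ e') + congPairs p e e' := by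
  rw [← h.resCard_eq, ← h'.resCard_eq]
  unfold resCard
  rw [Finset.image_union, ← Finset.card_union_add_card_inter]
  gcongr
  have : (e.image fun v => v % (p : ℤ)) ∩ (e'.image fun v => v % (p : ℤ)) ⊆
      ((e ×ˢ e').filter fun x => (p : ℤ) ∣ x.1 - x.2).image fun x => x.1 % (p : ℤ) := by
    intro r hr
    rw [Finset.mem_inter, Finset.mem_image, Finset.mem_image] at hr
    obtain ⟨⟨u, hu, rfl⟩, v, hv, huv⟩ := hr
    refine Finset.mem_image.2 ⟨(u, v), Finset.mem_filter.2 ⟨Finset.mk_mem_product hu hv, ?_⟩, rfl⟩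
    rw [Int.dvd_iff_emod_eq_zero, ← Int.emod_eq_emod_iff_emod_sub_eq_zero]
    exact huv.symm
  exact (Finset.card_le_card this).trans Finset.card_image_le

theorem congPairs_le_erase {p : ℕ} {e e' : Finset ℤ} (h : DistinctMod p e)
    (h' : DistinctMod p e') {v : ℤ} (hv : v ∈ e) (hv' : v ∈ e') :
    congPairs p e e' ≤ 1 + congPairs p (e.erase v) (e'.erase v) := by
  unfold congPairs
  have : ((e ×ˢ e').filter fun x => (p : ℤ) ∣ x.1 - x.2) ⊆
      {(v, v)} ∪ (((e.erase v) ×ˢ (e'.erase v)).filter fun x => (p : ℤ) ∣ x.1 - x.2) := by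
    rintro ⟨a, b⟩ hab
    simp only [Finset.mem_filter, Finset.mem_product] at hab
    obtain ⟨⟨ha, hb⟩, hd⟩ := hab
    simp only [Finset.mem_union, Finset.mem_singleton, Finset.mem_filter, Finset.mem_product,
      Finset.mem_erase, Prod.mk.injEq]
    by_cases hav : a = v
    · subst hav
      exact Or.inl ⟨rfl, (h' a hv' b hb hd).symm⟩
    · by_cases hbv : b = v
      · subst hbv
        exact absurd (h a ha b hv hd) hav
      · exact Or.inr ⟨⟨⟨hav, ha⟩, hbv, hb⟩, hd⟩
  refine (Finset.card_le_card this).trans ((Finset.card_union_le _ _).trans ?_)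
  simp

theorem survProb_union_le {P : Finset ℕ} {e e' : Finset ℤ} (h : ∀ p ∈ P, DistinctMod p e)
    (h' : ∀ p ∈ P, DistinctMod p e') (hP : ∀ p ∈ P, 0 < p ∧ 2 * (e.card + e'.card) ≤ p) :
    survProb P (e ∪ e') ≤ distProb P e.card * distProb P e'.card *
      ∏ p ∈ P, (1 + 2 * (congPairs p e e' : ℝ) / p) := by
  unfold survProb distProb
  rw [← Finset.prod_mul_distrib, ← Finset.prod_mul_distrib]
  refine Finset.prod_le_prod (fun p hp => ?_) fun p hp => ?_
  · rw [sub_nonneg]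
    refine div_le_one_of_le₀ ?_ (Nat.cast_nonneg p)
    have := (resCard_le_card p (e ∪ e')).trans (Finset.card_union_le _ _)
    have := (hP p hp).2
    exact_mod_cast (by omega : resCard p (e ∪ e') ≤ p)
  · have hp0 : (0 : ℝ) < p := by exact_mod_cast (hP p hp).1
    have h1 : (e.card : ℝ) + e'.card ≤ resCard p (e ∪ e') + congPairs p e e' := by
      exact_mod_cast card_add_card_le_resCard_union (h p hp) (h' p hp)
    have h2 : 2 * ((e.card : ℝ) + e'.card) ≤ p := by exact_mod_cast (hP p hp).2
    set a := (e.card : ℝ) / p with ha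
    set b := (e'.card : ℝ) / p with hb
    set o := (congPairs p e e' : ℝ) / p with ho
    have ha0 : 0 ≤ a := by positivity
    have hb0 : 0 ≤ b := by positivity
    have ho0 : 0 ≤ o := by positivity
    have h3 : a + b ≤ (resCard p (e ∪ e') : ℝ) / p + o := by
      rw [ha, hb, ho, ← add_div, ← add_div]; gcongr
    have h4 : a + b ≤ 1 / 2 := by
      rw [ha, hb, ← add_div, div_le_iff₀ hp0]; linarith
    rw [mul_div_assoc, ← ho]
    nlinarith [mul_nonneg ha0 hb0, mul_nonneg (mul_nonneg ha0 hb0) ho0,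
      mul_nonneg ho0 (sub_nonneg.2 h4)]

theorem survProb_union_mul_le {P : Finset ℕ} {e e' : Finset ℤ} (h : ∀ p ∈ P, DistinctMod p e)
    (h' : ∀ p ∈ P, DistinctMod p e') (hP : ∀ p ∈ P, 0 < p ∧ 2 * (e.card + e'.card) ≤ p)
    {v : ℤ} (hv : v ∈ e) (hv' : v ∈ e') :
    survProb P (e ∪ e') * distProb P 1 ≤ distProb P e.card * distProb P e'.card *
      ∏ p ∈ P, (1 + 2 * (congPairs p (e.erase v) (e'.erase v) : ℝ) / p) := by
  have he1 : 1 ≤ e.card := Finset.card_pos.2 ⟨v, hv⟩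
  have he1' : 1 ≤ e'.card := Finset.card_pos.2 ⟨v, hv'⟩
  unfold survProb distProb
  rw [← Finset.prod_mul_distrib, ← Finset.prod_mul_distrib, ← Finset.prod_mul_distrib]
  refine Finset.prod_le_prod (fun p hp => ?_) fun p hp => ?_
  · have h2 := (hP p hp).2
    refine mul_nonneg ?_ ?_
    · rw [sub_nonneg]
      refine div_le_one_of_le₀ ?_ (Nat.cast_nonneg p)
      have := (resCard_le_card p (e ∪ e')).trans (Finset.card_union_le _ _)
      exact_mod_cast (by omega : resCard p (e ∪ e') ≤ p)
    · rw [sub_nonneg]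
      refine div_le_one_of_le₀ ?_ (Nat.cast_nonneg p)
      exact_mod_cast (by omega : 1 ≤ p)
  · have hp0 : (0 : ℝ) < p := by exact_mod_cast (hP p hp).1
    have h1 : (e.card : ℝ) + e'.card
        ≤ resCard p (e ∪ e') + (1 + congPairs p (e.erase v) (e'.erase v)) := by
      have h3 := card_add_card_le_resCard_union (h p hp) (h' p hp)
      have h4 := congPairs_le_erase (h p hp) (h' p hp) hv hv'
      exact_mod_cast h3.trans (by omega)
    have h2 : 2 * ((e.card : ℝ) + e'.card) ≤ p := by exact_mod_cast (hP p hp).2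
    set a := (e.card : ℝ) / p with ha
    set b := (e'.card : ℝ) / p with hb
    set o := (congPairs p (e.erase v) (e'.erase v) : ℝ) / p with ho
    set i := (1 : ℝ) / p with hi
    have hia : i ≤ a := by rw [hi, ha]; gcongr; exact_mod_cast he1
    have hib : i ≤ b := by rw [hi, hb]; gcongr; exact_mod_cast he1'
    have hi0 : 0 ≤ i := by positivity
    have ho0 : 0 ≤ o := by positivity
    have h3 : a + b ≤ (resCard p (e ∪ e') : ℝ) / p + (i + o) := by
      rw [ha, hb, ho, hi, ← add_div, ← add_div, ← add_div]; gcongr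
    have h4 : a + b ≤ 1 / 2 := by
      rw [ha, hb, ← add_div, div_le_iff₀ hp0]; linarith
    rw [mul_div_assoc, ← ho, Nat.cast_one, ← hi]
    have h5 : (1 - (resCard p (e ∪ e') : ℝ) / p) * (1 - i) ≤ (1 - a - b + i + o) * (1 - i) := by
      refine mul_le_mul_of_nonneg_right (by linarith) (by linarith)
    refine h5.trans ?_
    have h6 : (1 / 2) * (2 * o) ≤ (1 - a) * (1 - b) * (2 * o) := by
      refine mul_le_mul_of_nonneg_right ?_ (by linarith)
      nlinarith [mul_nonneg (hi0.trans hia) (hi0.trans hib)]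
    nlinarith [mul_nonneg (sub_nonneg.2 hia) (sub_nonneg.2 hib), mul_nonneg hi0 ho0]

/-- The singular-series type factor of `m` over the primes in `P`. -/
noncomputable def divFactor (P : Finset ℕ) (K : ℝ) (m : ℤ) : ℝ :=
  ∏ p ∈ P.filter (fun p : ℕ => (p : ℤ) ∣ m), (1 + K / p)

theorem prod_congPairs_le {τ : Type*} {P : Finset ℕ} {s : Finset τ} (hs : s.Nonempty) (m : τ → ℤ)
    (hP : ∀ p ∈ P, 0 < p ∧ 2 * s.card ≤ p) {o : ℕ → ℕ}
    (ho : ∀ p ∈ P, o p ≤ (s.filter fun i => (p : ℤ) ∣ m i).card) :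
    ∏ p ∈ P, (1 + 2 * (o p : ℝ) / p) ≤ (∑ i ∈ s, divFactor P (4 * s.card) (m i)) / s.card := by
  have hs0 : (0 : ℝ) < s.card := by exact_mod_cast hs.card_pos
  have h1 : ∏ p ∈ P, (1 + 2 * (o p : ℝ) / p) ≤ ∏ i ∈ s, divFactor P 2 (m i) := by
    have h2 : ∀ i, divFactor P 2 (m i) = ∏ p ∈ P, (1 + if (p : ℤ) ∣ m i then (2 : ℝ) / p else 0) := by
      intro i
      rw [divFactor, Finset.prod_filter]
      refine Finset.prod_congr rfl fun p _ => ?_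
      split_ifs <;> simp
    simp only [h2]
    rw [Finset.prod_comm]
    refine Finset.prod_le_prod (fun p _ => by positivity) fun p hp => ?_
    refine le_trans ?_ (one_add_sum_le_prod s (fun i _ => by split_ifs <;> positivity))
    rw [← Finset.sum_filter, Finset.sum_const, nsmul_eq_mul]
    have : (o p : ℝ) ≤ (s.filter fun i => (p : ℤ) ∣ m i).card := by exact_mod_cast ho p hp
    calc 1 + 2 * (o p : ℝ) / p = 1 + o p * (2 / p) := by ring
      _ ≤ _ := by gcongr
  refine h1.trans ?_
  have h3 : ∀ i, 0 ≤ divFactor P 2 (m i) := fun i => Finset.prod_nonneg fun p _ => by positivity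
  have h4 := Real.geom_mean_le_arith_mean_weighted s (fun _ => (s.card : ℝ)⁻¹)
    (fun i => divFactor P 2 (m i) ^ s.card) (fun i _ => by positivity)
    (by rw [Finset.sum_const, nsmul_eq_mul, mul_inv_cancel₀ hs0.ne'])
    (fun i _ => pow_nonneg (h3 i) _)
  simp only [Real.pow_rpow_inv_natCast (h3 _) hs.card_pos.ne'] at h4
  refine h4.trans ?_
  rw [Finset.sum_div]
  refine Finset.sum_le_sum fun i _ => ?_
  rw [inv_mul_eq_div]
  gcongr
  rw [divFactor, divFactor, ← Finset.prod_pow]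
  refine Finset.prod_le_prod (fun p _ => by positivity) fun p hp => ?_
  have hpP := hP p (Finset.mem_filter.1 hp).1
  have hp0 : (0 : ℝ) < p := by exact_mod_cast hpP.1
  have hx : (s.card : ℝ) * (2 / p) ≤ 1 := by
    rw [← mul_div_assoc, div_le_one hp0, mul_comm]; exact_mod_cast hpP.2
  have hx0 : 0 ≤ (s.card : ℝ) * (2 / p) := by positivity
  calc (1 + 2 / (p : ℝ)) ^ s.card ≤ (Real.exp (2 / p)) ^ s.card := by
        gcongr; rw [add_comm]; exact Real.add_one_le_exp _
    _ = Real.exp (s.card * (2 / p)) := (Real.exp_nat_mul _ _).symm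
    _ ≤ 1 + 2 * (s.card * (2 / p)) := by
        have := Real.abs_exp_sub_one_le (x := s.card * (2 / p)) (by rwa [abs_of_nonneg hx0])
        rw [abs_of_nonneg hx0] at this
        linarith [le_abs_self (Real.exp (s.card * (2 / p)) - 1)]
    _ = 1 + 4 * s.card / p := by ring

/-! ### Averages of the divisor factors -/

theorem natCast_prod_dvd_iff {S : Finset ℕ} (hS : ∀ p ∈ S, p.Prime) (m : ℤ) :
    ((∏ p ∈ S, p : ℕ) : ℤ) ∣ m ↔ ∀ p ∈ S, (p : ℤ) ∣ m := by
  constructor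
  · intro h p hp
    exact (Int.natCast_dvd_natCast.2 (Finset.dvd_prod_of_mem _ hp)).trans h
  · intro h
    rw [Int.natCast_dvd]
    refine Finset.prod_primes_dvd _ (fun p hp => (hS p hp).prime) fun p hp => ?_
    exact Int.natCast_dvd.1 (h p hp)

theorem divFactor_sub_one_eq (P : Finset ℕ) (hP : ∀ p ∈ P, p.Prime) (K : ℝ) (m : ℤ) :
    divFactor P K m - 1 = ∑ S ∈ P.powerset.erase ∅,
      if ((∏ p ∈ S, p : ℕ) : ℤ) ∣ m then ∏ p ∈ S, K / (p : ℝ) else 0 := by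
  have h1 : divFactor P K m = ∑ S ∈ P.powerset,
      if ((∏ p ∈ S, p : ℕ) : ℤ) ∣ m then ∏ p ∈ S, K / (p : ℝ) else 0 := by
    rw [divFactor, Finset.prod_one_add, ← Finset.sum_filter]
    refine Finset.sum_congr ?_ fun _ _ => rfl
    ext S
    simp only [Finset.mem_powerset, Finset.mem_filter]
    constructor
    · intro h
      have h2 : S ⊆ P := h.trans (Finset.filter_subset _ _)
      exact ⟨h2, (natCast_prod_dvd_iff (fun p hp => hP p (h2 hp)) m).2 fun p hp =>
        (Finset.mem_filter.1 (h hp)).2⟩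
    · rintro ⟨h2, h3⟩ p hp
      exact Finset.mem_filter.2 ⟨h2 hp,
        (natCast_prod_dvd_iff (fun p hp => hP p (h2 hp)) m).1 h3 p hp⟩
  rw [h1, ← Finset.add_sum_erase _ _ (Finset.empty_mem_powerset P)]
  simp

theorem card_filter_dvd_le {P : Finset ℕ} {w M : ℝ} (hw : 1 < w) (hP : ∀ p ∈ P, p.Prime ∧ w < p)
    {m : ℤ} (hm0 : m ≠ 0) (hm : |(m : ℝ)| ≤ M) :
    ((P.filter fun p : ℕ => (p : ℤ) ∣ m).card : ℝ) ≤ Real.log M / Real.log w := by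
  set T := P.filter fun p : ℕ => (p : ℤ) ∣ m with hT
  have hlw : 0 < Real.log w := Real.log_pos hw
  have h1 : ((∏ p ∈ T, p : ℕ) : ℤ) ∣ m :=
    (natCast_prod_dvd_iff (fun p hp => (hP p (Finset.mem_filter.1 hp).1).1) m).2 fun p hp =>
      (Finset.mem_filter.1 hp).2
  have h2 : ((∏ p ∈ T, p : ℕ) : ℝ) ≤ |(m : ℝ)| := by
    have := Int.le_of_dvd (abs_pos.2 hm0) ((dvd_abs _ _).2 h1)
    exact_mod_cast this
  have h3 : w ^ T.card ≤ ((∏ p ∈ T, p : ℕ) : ℝ) := by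
    rw [← Finset.prod_const, Nat.cast_prod]
    exact Finset.prod_le_prod (fun _ _ => by linarith) fun p hp =>
      (hP p (Finset.mem_filter.1 hp).1).2.le
  rw [le_div_iff₀ hlw, ← Real.log_pow]
  exact Real.log_le_log (by positivity) ((h3.trans h2).trans hm)

theorem sum_divFactor_sub_one_le {τ : Type*} (s : Finset τ) {μ : τ → ℝ} (hμ : ∀ t ∈ s, 0 ≤ μ t)
    {m : τ → ℤ} {M w K A D S₁ : ℝ} {P : Finset ℕ} (hw : 1 < w) (hP : ∀ p ∈ P, p.Prime ∧ w < p)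
    (hm : ∀ t ∈ s, m t ≠ 0 ∧ |(m t : ℝ)| ≤ M) (hK : 0 ≤ K) (hKw : K ^ 2 ≤ w) (hA0 : 0 ≤ A)
    (hD : 0 < D) (hS : ∑ p ∈ P, (1 : ℝ) / p ≤ S₁)
    (hA : ∀ S ⊆ P, S.Nonempty → ((∏ p ∈ S, p : ℕ) : ℝ) ≤ D →
      ∑ t ∈ s with ((∏ p ∈ S, p : ℕ) : ℤ) ∣ m t, μ t
        ≤ A * ((∏ p ∈ S, p : ℕ) : ℝ) ^ (-(7 / 8) : ℝ)) :
    ∑ t ∈ s, μ t * (divFactor P K (m t) - 1)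
      ≤ A * (Real.exp (K * w ^ (-(7 / 8) : ℝ) * S₁) - 1)
        + (∑ t ∈ s, μ t) * (D ^ (-(1 / 2) : ℝ) * 2 ^ (Real.log M / Real.log w)) := by
  have hpp : ∀ p ∈ P, p.Prime := fun p hp => (hP p hp).1
  have hw0 : 0 < w := by linarith
  have hf0 : ∀ S : Finset ℕ, 0 ≤ ∏ p ∈ S, K / (p : ℝ) := fun S =>
    Finset.prod_nonneg fun p _ => by positivity
  have hdpos : ∀ S ⊆ P, (0 : ℝ) < ((∏ p ∈ S, p : ℕ) : ℝ) := fun S hS => by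
    exact_mod_cast Finset.prod_pos fun p hp => (hpp p (hS hp)).pos
  -- splitting according to the size of the divisor
  have hsplit : ∀ t ∈ s, μ t * (divFactor P K (m t) - 1) ≤
      (∑ S ∈ P.powerset.erase ∅ with ((∏ p ∈ S, p : ℕ) : ℝ) ≤ D,
        if ((∏ p ∈ S, p : ℕ) : ℤ) ∣ m t then μ t * ∏ p ∈ S, K / (p : ℝ) else 0)
      + μ t * (D ^ (-(1 / 2) : ℝ) * 2 ^ (Real.log M / Real.log w)) := by
    intro t ht
    rw [divFactor_sub_one_eq P hpp, ← Finset.sum_filter_add_sum_filter_not _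
      (fun S : Finset ℕ => ((∏ p ∈ S, p : ℕ) : ℝ) ≤ D), mul_add, Finset.mul_sum]
    refine add_le_add (le_of_eq ?_) ?_
    · exact Finset.sum_congr rfl fun S _ => by split_ifs <;> simp
    · refine mul_le_mul_of_nonneg_left ?_ (hμ t ht)
      rw [← Finset.sum_filter]
      calc _ ≤ ∑ S ∈ (P.filter fun p : ℕ => (p : ℤ) ∣ m t).powerset, D ^ (-(1 / 2) : ℝ) := by
            refine (Finset.sum_le_sum (g := fun _ => D ^ (-(1 / 2) : ℝ)) ?_).trans
              (Finset.sum_le_sum_of_subset_of_nonneg ?_ fun _ _ _ => by positivity)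
            · intro S hS
              simp only [Finset.mem_filter, Finset.mem_erase, Finset.mem_powerset, not_le] at hS
              obtain ⟨⟨⟨_, hSP⟩, hSD⟩, _⟩ := hS
              calc ∏ p ∈ S, K / (p : ℝ) ≤ ∏ p ∈ S, (p : ℝ) ^ (-(1 / 2) : ℝ) := by
                    refine Finset.prod_le_prod (fun p _ => by positivity) fun p hp => ?_
                    have hp0 : (0 : ℝ) < p := by exact_mod_cast (hpp p (hSP hp)).pos
                    have h1 : K ≤ (p : ℝ) ^ (1 / 2 : ℝ) := by
                      rw [← Real.sqrt_eq_rpow]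
                      exact Real.le_sqrt_of_sq_le (hKw.trans (hP p (hSP hp)).2.le)
                    rw [div_le_iff₀ hp0]
                    nth_rw 2 [← Real.rpow_one (p : ℝ)]
                    rw [← Real.rpow_add hp0]
                    norm_num
                    norm_num at h1
                    exact h1
                _ = ((∏ p ∈ S, p : ℕ) : ℝ) ^ (-(1 / 2) : ℝ) := by
                    rw [Nat.cast_prod, Real.finsetProd_rpow _ _ fun p _ => Nat.cast_nonneg p]
                _ ≤ D ^ (-(1 / 2) : ℝ) :=
                    Real.rpow_le_rpow_of_nonpos hD hSD.le (by norm_num)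
            · intro S hS
              simp only [Finset.mem_filter, Finset.mem_erase, Finset.mem_powerset, not_le] at hS ⊢
              obtain ⟨⟨⟨_, hSP⟩, _⟩, hSm⟩ := hS
              intro p hp
              exact Finset.mem_filter.2 ⟨hSP hp, (natCast_prod_dvd_iff
                (fun p hp => hpp p (hSP hp)) (m t)).1 hSm p hp⟩
        _ = D ^ (-(1 / 2) : ℝ) * (2 : ℝ) ^ ((P.filter fun p : ℕ => (p : ℤ) ∣ m t).card : ℝ) := by
            rw [Finset.sum_const, Finset.card_powerset, nsmul_eq_mul, Real.rpow_natCast]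
            push_cast; ring
        _ ≤ _ := by
            gcongr
            · norm_num
            · exact card_filter_dvd_le hw hP (hm t ht).1 (hm t ht).2
  refine (Finset.sum_le_sum hsplit).trans ?_
  rw [Finset.sum_add_distrib, ← Finset.sum_mul]
  gcongr
  rw [Finset.sum_comm]
  calc _ ≤ ∑ S ∈ P.powerset.erase ∅ with ((∏ p ∈ S, p : ℕ) : ℝ) ≤ D,
        A * ∏ p ∈ S, (K / (p : ℝ) * (p : ℝ) ^ (-(7 / 8) : ℝ)) := by
        refine Finset.sum_le_sum fun S hS => ?_
        simp only [Finset.mem_filter, Finset.mem_erase, Finset.mem_powerset] at hS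
        obtain ⟨⟨hne, hSP⟩, hSD⟩ := hS
        rw [← Finset.sum_filter, ← Finset.sum_mul, Finset.prod_mul_distrib]
        have := hA S hSP (Finset.nonempty_iff_ne_empty.2 hne) hSD
        rw [Real.finsetProd_rpow _ _ fun p _ => Nat.cast_nonneg p, ← Nat.cast_prod]
        calc _ ≤ (A * ((∏ p ∈ S, p : ℕ) : ℝ) ^ (-(7 / 8) : ℝ)) * ∏ p ∈ S, K / (p : ℝ) :=
              mul_le_mul_of_nonneg_right this (hf0 S)
          _ = _ := by ring
    _ ≤ ∑ S ∈ P.powerset.erase ∅, A * ∏ p ∈ S, (K / (p : ℝ) * (p : ℝ) ^ (-(7 / 8) : ℝ)) :=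
        Finset.sum_le_sum_of_subset_of_nonneg (Finset.filter_subset _ _) fun S _ _ =>
          mul_nonneg hA0 (Finset.prod_nonneg fun p _ => by positivity)
    _ = A * (∏ p ∈ P, (1 + K / (p : ℝ) * (p : ℝ) ^ (-(7 / 8) : ℝ)) - 1) := by
        rw [← Finset.mul_sum, Finset.prod_one_add,
          ← Finset.add_sum_erase _ _ (Finset.empty_mem_powerset P)]
        simp
    _ ≤ _ := by
        gcongr
        calc ∏ p ∈ P, (1 + K / (p : ℝ) * (p : ℝ) ^ (-(7 / 8) : ℝ))
            ≤ ∏ p ∈ P, Real.exp (K * w ^ (-(7 / 8) : ℝ) * (1 / p)) := by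
              refine Finset.prod_le_prod (fun p _ => by positivity) fun p hp => ?_
              rw [add_comm]
              refine le_trans ?_ (Real.add_one_le_exp _)
              have h1 : (p : ℝ) ^ (-(7 / 8) : ℝ) ≤ w ^ (-(7 / 8) : ℝ) :=
                Real.rpow_le_rpow_of_nonpos hw0 (hP p hp).2.le (by norm_num)
              calc K / (p : ℝ) * (p : ℝ) ^ (-(7 / 8) : ℝ) + 1
                  ≤ K / (p : ℝ) * w ^ (-(7 / 8) : ℝ) + 1 := by gcongr
                _ = _ := by ring
          _ = Real.exp (K * w ^ (-(7 / 8) : ℝ) * ∑ p ∈ P, (1 / (p : ℝ))) := by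
              rw [← Real.exp_sum, Finset.mul_sum]
          _ ≤ _ := by gcongr

/-! ### Second moments of the random sieve -/

/-- The elements of `U` congruent to `a` modulo `q`. -/
noncomputable def fiber (U : Finset ℤ) (q : ℕ) (a : ℤ) : Finset ℤ :=
  U.filter fun u => (q : ℤ) ∣ u - a

theorem mem_fiber {U : Finset ℤ} {q : ℕ} {a u : ℤ} :
    u ∈ fiber U q a ↔ u ∈ U ∧ (q : ℤ) ∣ u - a := Finset.mem_filter

theorem fiber_eq_of_dvd {U : Finset ℤ} {q : ℕ} {a b : ℤ} (h : (q : ℤ) ∣ a - b) :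
    fiber U q a = fiber U q b := by
  refine Finset.filter_congr fun u _ => ?_
  rw [← dvd_add_left h (b := u - a)]
  simp

/-- The normalised indicator that a fiber survives. -/
noncomputable def fiberWeight (l : List ℕ) (U : Finset ℤ) (q : ℕ) (a : ℤ) (β : ℕ → ℤ) : ℝ :=
  (distProb l.toFinset (fiber U q a).card)⁻¹ * if ∀ u ∈ fiber U q a, Surv l β u then 1 else 0

/-- Hypotheses on one block of sieving primes. -/
structure BlockData (l : List ℕ) (h y : ℕ) (w S₁ D M Y₁ Y₂ : ℝ) : Prop where
  nodup : l.Nodup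
  prime : ∀ p ∈ l, p.Prime ∧ w < p ∧ (p : ℝ) ≤ Y₁
  hh : 1 ≤ h
  hw : 256 * (h : ℝ) ^ 4 ≤ w
  hS : ∑ p ∈ l.toFinset, (1 : ℝ) / p ≤ S₁
  hD : 0 < D
  hDY : D ≤ Y₁
  hY : 1 < Y₁
  hY₂ : Y₁ ≤ Y₂
  hhY : (h : ℝ) < Y₁
  hM : 2 * h * Y₂ ≤ M
  hyh : (y : ℝ) ≤ h * Y₁
  hm : Y₂ / w + 1 ≤ Y₁

variable {l : List ℕ} {h y : ℕ} {w S₁ D M Y₁ Y₂ : ℝ}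

theorem BlockData.h_pos (H : BlockData l h y w S₁ D M Y₁ Y₂) : (1 : ℝ) ≤ h := by
  exact_mod_cast H.hh

theorem BlockData.sq_lt (H : BlockData l h y w S₁ D M Y₁ Y₂) {p : ℕ} (hp : p ∈ l) :
    8 * h ^ 2 ≤ p := by
  have h1 := H.h_pos
  have h2 : (h : ℝ) ^ 2 ≤ (h : ℝ) ^ 4 := by gcongr; norm_num
  have h3 : (8 : ℝ) * (h : ℝ) ^ 2 ≤ p := by
    have := (H.prime p hp).2.1
    have := H.hw
    nlinarith
  exact_mod_cast h3

theorem BlockData.lt_prime (H : BlockData l h y w S₁ D M Y₁ Y₂) {p : ℕ} (hp : p ∈ l) : 8 * h ≤ p := by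
  have h1 := H.sq_lt hp
  have h2 := H.hh
  nlinarith

theorem BlockData.one_lt_w (H : BlockData l h y w S₁ D M Y₁ Y₂) : 1 < w := by
  have h1 := H.h_pos
  have h2 : (1 : ℝ) ≤ (h : ℝ) ^ 4 := one_le_pow₀ h1
  linarith [H.hw]

theorem BlockData.distProb_factor (H : BlockData l h y w S₁ D M Y₁ Y₂) {t : ℕ} (ht : t ≤ h) {p : ℕ}
    (hp : p ∈ l.toFinset) : 0 < 1 - (t : ℝ) / p := by
  have h1 := H.lt_prime (by simpa using hp)
  have h2 := H.hh
  have hp0 : (0 : ℝ) < p := by exact_mod_cast (by omega : 0 < p)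
  rw [sub_pos, div_lt_one hp0]
  exact_mod_cast (by omega : t < p)

theorem BlockData.distProb_pos (H : BlockData l h y w S₁ D M Y₁ Y₂) {t : ℕ} (ht : t ≤ h) :
    0 < distProb l.toFinset t :=
  Finset.prod_pos fun _ hp => H.distProb_factor ht hp

theorem BlockData.distProb_inv_le (H : BlockData l h y w S₁ D M Y₁ Y₂) {t : ℕ} (ht : t ≤ h) :
    (distProb l.toFinset t)⁻¹ ≤ (distProb l.toFinset h)⁻¹ := by
  refine inv_anti₀ (H.distProb_pos le_rfl) ?_
  refine Finset.prod_le_prod (fun p hp => (H.distProb_factor le_rfl hp).le) fun p _ => ?_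
  gcongr

theorem BlockData.distProb_le_one (H : BlockData l h y w S₁ D M Y₁ Y₂) {t : ℕ} (ht : t ≤ h) :
    distProb l.toFinset t ≤ 1 := by
  refine Finset.prod_le_one (fun p hp => (H.distProb_factor ht hp).le) fun p _ => ?_
  have : (0 : ℝ) ≤ (t : ℝ) / p := by positivity
  linarith

variable {U : Finset ℤ} {A₀ : ℤ} {q : ℕ}

theorem BlockData.y_le (H : BlockData l h y w S₁ D M Y₁ Y₂) (hq : Y₁ < q) : (y : ℤ) ≤ h * q := by
  have h1 := H.hyh
  have h2 : (y : ℝ) ≤ h * q := h1.trans (by gcongr)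
  exact_mod_cast h2

/-- Elements of a fiber differ by fewer than `h` steps of length `q`. -/
theorem BlockData.exists_mul_eq (H : BlockData l h y w S₁ D M Y₁ Y₂)
    (hU : ∀ u ∈ U, A₀ ≤ u ∧ u < A₀ + y) (hq : Y₁ < q) {u v : ℤ} (hu : u ∈ U) (hv : v ∈ U)
    (huv : (q : ℤ) ∣ u - v) : ∃ k : ℤ, u - v = k * q ∧ |k| < h := by
  obtain ⟨k, hk⟩ := huv
  refine ⟨k, by rw [hk, mul_comm], ?_⟩
  have h1 := H.y_le hq
  have h2 := hU u hu
  have h3 := hU v hv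
  have h4 : |u - v| < y := by rw [abs_lt]; constructor <;> linarith
  have hq0 : (0 : ℤ) < q := by
    have : (0 : ℝ) < q := by linarith [H.hY]
    exact_mod_cast this
  rw [hk, abs_mul, abs_of_pos hq0, mul_comm] at h4
  exact lt_of_mul_lt_mul_right (h4.trans_le h1) hq0.le

theorem BlockData.distinctMod (H : BlockData l h y w S₁ D M Y₁ Y₂)
    (hU : ∀ u ∈ U, A₀ ≤ u ∧ u < A₀ + y) (hq : Y₁ < q) (hqp : q.Prime) (a : ℤ) {p : ℕ} (hp : p ∈ l) :
    DistinctMod p (fiber U q a) := by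
  intro u hu v hv hpuv
  rw [mem_fiber] at hu hv
  have h1 : (q : ℤ) ∣ u - v := by
    have := dvd_sub hu.2 hv.2
    simpa using this
  obtain ⟨k, hk, hk1⟩ := H.exists_mul_eq hU hq hu.1 hv.1 h1
  have hpp := (H.prime p hp).1
  rw [hk] at hpuv
  rcases (Nat.prime_iff_prime_int.1 hpp).dvd_or_dvd hpuv with h2 | h2
  · have h3 : k = 0 := by
      refine Int.eq_zero_of_abs_lt_dvd h2 (hk1.trans_le ?_)
      have := H.lt_prime hp
      exact_mod_cast (by omega : h ≤ p)
    rw [h3, zero_mul] at hk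
    linarith
  · have h3 := (Nat.prime_dvd_prime_iff_eq hpp hqp).1 (Int.natCast_dvd_natCast.1 h2)
    have h4 := (H.prime p hp).2.2
    rw [h3] at h4
    linarith

theorem BlockData.card_fiber_le (H : BlockData l h y w S₁ D M Y₁ Y₂)
    (hU : ∀ u ∈ U, A₀ ≤ u ∧ u < A₀ + y) (hq : Y₁ < q) (a : ℤ) : (fiber U q a).card ≤ h := by
  have hq0 : (0 : ℤ) < q := by
    have : (0 : ℝ) < q := by linarith [H.hY]
    exact_mod_cast this
  have h1 : (fiber U q a).card ≤ (Finset.Ico (0 : ℤ) h).card := by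
    refine Finset.card_le_card_of_injOn (fun u => (u - A₀) / q) ?_ ?_
    · intro u hu
      have hu' := hU u (mem_fiber.1 hu).1
      simp only [Finset.coe_Ico, Set.mem_Ico]
      refine ⟨Int.ediv_nonneg (by linarith) hq0.le, ?_⟩
      rw [Int.ediv_lt_iff_lt_mul hq0]
      linarith [H.y_le hq]
    · intro u hu v hv huv
      have hu' := (mem_fiber.1 hu).2
      have hv' := (mem_fiber.1 hv).2
      have h2 : (u - A₀) % q = (v - A₀) % q := by
        rw [Int.emod_eq_emod_iff_emod_sub_eq_zero, ← Int.dvd_iff_emod_eq_zero]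
        have := dvd_sub hu' hv'
        simpa using this
      have h3 := Int.mul_ediv_add_emod (u - A₀) q
      have h4 := Int.mul_ediv_add_emod (v - A₀) q
      simp only at huv
      rw [huv, h2] at h3
      linarith
  simpa using h1

theorem BlockData.fiberWeight_nonneg (H : BlockData l h y w S₁ D M Y₁ Y₂)
    (hU : ∀ u ∈ U, A₀ ≤ u ∧ u < A₀ + y) (hq : Y₁ < q) (a : ℤ) (β : ℕ → ℤ) :
    0 ≤ fiberWeight l U q a β := by
  refine mul_nonneg (inv_nonneg.2 (H.distProb_pos (H.card_fiber_le hU hq a)).le) ?_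
  split_ifs <;> norm_num

theorem BlockData.fiberWeight_le (H : BlockData l h y w S₁ D M Y₁ Y₂)
    (hU : ∀ u ∈ U, A₀ ≤ u ∧ u < A₀ + y) (hq : Y₁ < q) (a : ℤ) (β : ℕ → ℤ) :
    fiberWeight l U q a β ≤ (distProb l.toFinset h)⁻¹ := by
  have h1 := H.distProb_inv_le (H.card_fiber_le hU hq a)
  have h2 := H.distProb_pos (H.card_fiber_le hU hq a)
  refine le_trans ?_ h1
  unfold fiberWeight
  split_ifs
  · rw [mul_one]
  · rw [mul_zero]; exact (inv_pos.2 h2).le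

theorem BlockData.avg_fiberWeight (H : BlockData l h y w S₁ D M Y₁ Y₂)
    (hU : ∀ u ∈ U, A₀ ≤ u ∧ u < A₀ + y) (hq : Y₁ < q) (hqp : q.Prime) (a : ℤ) (β : ℕ → ℤ) :
    avg l (fiberWeight l U q a) β = 1 := by
  have h1 := H.distProb_pos (H.card_fiber_le hU hq a)
  have h2 := avg_surv H.nodup (fun p hp => (H.prime p hp).1.pos) (fiber U q a) β
  rw [survProb_eq_distProb fun p hp => H.distinctMod hU hq hqp a (by simpa using hp)] at h2
  unfold fiberWeight
  rw [avg_const_mul, h2, inv_mul_cancel₀ h1.ne']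

theorem BlockData.avg_fiberWeight_mul (H : BlockData l h y w S₁ D M Y₁ Y₂)
    (q q' : ℕ) (a a' : ℤ) (β : ℕ → ℤ) :
    avg l (fun β => fiberWeight l U q a β * fiberWeight l U q' a' β) β
      = (distProb l.toFinset (fiber U q a).card)⁻¹ * (distProb l.toFinset (fiber U q' a').card)⁻¹
        * survProb l.toFinset (fiber U q a ∪ fiber U q' a') := by
  rw [← avg_surv H.nodup (fun p hp => (H.prime p hp).1.pos) (fiber U q a ∪ fiber U q' a') β,
    ← avg_const_mul]
  congr 1
  funext β
  unfold fiberWeight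
  have : (∀ u ∈ fiber U q a ∪ fiber U q' a', Surv l β u) ↔
      (∀ u ∈ fiber U q a, Surv l β u) ∧ ∀ u ∈ fiber U q' a', Surv l β u := by
    simp only [Finset.mem_union, or_imp, forall_and]
  rw [if_congr this rfl rfl, ite_and]
  split_ifs <;> ring

theorem BlockData.avg_fiberWeight_sq_le (H : BlockData l h y w S₁ D M Y₁ Y₂)
    (hU : ∀ u ∈ U, A₀ ≤ u ∧ u < A₀ + y) (hq : Y₁ < q) (hqp : q.Prime) (a : ℤ) (β : ℕ → ℤ) :
    avg l (fun β => fiberWeight l U q a β * fiberWeight l U q a β) β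
      ≤ (distProb l.toFinset h)⁻¹ := by
  have h1 := H.avg_fiberWeight hU hq hqp a β
  calc _ ≤ avg l (fun β => (distProb l.toFinset h)⁻¹ * fiberWeight l U q a β) β :=
        avg_mono fun β' _ => mul_le_mul_of_nonneg_right (H.fiberWeight_le hU hq a β')
          (H.fiberWeight_nonneg hU hq a β')
    _ = _ := by rw [avg_const_mul, h1, mul_one]

theorem BlockData.two_mul_card_le (H : BlockData l h y w S₁ D M Y₁ Y₂)
    (hU : ∀ u ∈ U, A₀ ≤ u ∧ u < A₀ + y) (hq : Y₁ < q) {q' : ℕ} (hq' : Y₁ < q') (a a' : ℤ)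
    {p : ℕ} (hp : p ∈ l.toFinset) :
    0 < p ∧ 2 * ((fiber U q a).card + (fiber U q' a').card) ≤ p := by
  have hp' : p ∈ l := by simpa using hp
  have h1 := H.lt_prime hp'
  have h2 := H.card_fiber_le hU hq a
  have h3 := H.card_fiber_le hU hq' a'
  exact ⟨(H.prime p hp').1.pos, by omega⟩

/-- The relative error from small divisors. -/
noncomputable def smallErr (h : ℕ) (w S₁ : ℝ) : ℝ :=
  Real.exp (16 * h ^ 2 * w ^ (-(7 / 8) : ℝ) * S₁) - 1

/-- The relative error from large divisors. -/
noncomputable def tailErr (D M w : ℝ) : ℝ := D ^ (-(1 / 2) : ℝ) * 2 ^ (Real.log M / Real.log w)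

theorem BlockData.S_nonneg (H : BlockData l h y w S₁ D M Y₁ Y₂) : 0 ≤ S₁ :=
  le_trans (Finset.sum_nonneg fun p _ => by positivity) H.hS

theorem BlockData.smallErr_nonneg (H : BlockData l h y w S₁ D M Y₁ Y₂) : 0 ≤ smallErr h w S₁ := by
  have h1 := H.S_nonneg
  have h2 := H.one_lt_w
  have : 0 ≤ 16 * (h : ℝ) ^ 2 * w ^ (-(7 / 8) : ℝ) * S₁ := by positivity
  have := Real.add_one_le_exp (16 * (h : ℝ) ^ 2 * w ^ (-(7 / 8) : ℝ) * S₁)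
  unfold smallErr
  linarith

theorem BlockData.tailErr_nonneg (H : BlockData l h y w S₁ D M Y₁ Y₂) : 0 ≤ tailErr D M w := by
  have := H.hD
  unfold tailErr
  positivity

theorem BlockData.toFinset_prime (H : BlockData l h y w S₁ D M Y₁ Y₂) :
    ∀ p ∈ l.toFinset, p.Prime ∧ w < p := fun p hp => by
  have := H.prime p (by simpa using hp)
  exact ⟨this.1, this.2.1⟩

theorem BlockData.sum_divFactor_le {τ : Type*} (H : BlockData l h y w S₁ D M Y₁ Y₂) (s : Finset τ)
    {μ : τ → ℝ} (hμ : ∀ t ∈ s, 0 ≤ μ t) {m : τ → ℤ} {K A : ℝ}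
    (hm : ∀ t ∈ s, m t ≠ 0 ∧ |(m t : ℝ)| ≤ M) (hK : 0 ≤ K) (hK' : K ≤ 16 * h ^ 2) (hA0 : 0 ≤ A)
    (hA : ∀ S ⊆ l.toFinset, S.Nonempty → ((∏ p ∈ S, p : ℕ) : ℝ) ≤ D →
      ∑ t ∈ s with ((∏ p ∈ S, p : ℕ) : ℤ) ∣ m t, μ t
        ≤ A * ((∏ p ∈ S, p : ℕ) : ℝ) ^ (-(7 / 8) : ℝ)) :
    ∑ t ∈ s, μ t * divFactor l.toFinset K (m t)
      ≤ ∑ t ∈ s, μ t + A * smallErr h w S₁ + (∑ t ∈ s, μ t) * tailErr D M w := by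
  have h1 := H.S_nonneg
  have h2 := H.one_lt_w
  have h3 : K ^ 2 ≤ w := by
    calc K ^ 2 ≤ (16 * (h : ℝ) ^ 2) ^ 2 := by gcongr
      _ = 256 * (h : ℝ) ^ 4 := by ring
      _ ≤ w := H.hw
  have h4 := sum_divFactor_sub_one_le s hμ h2 H.toFinset_prime hm hK h3 hA0 H.hD H.hS hA
  have h5 : A * (Real.exp (K * w ^ (-(7 / 8) : ℝ) * S₁) - 1) ≤ A * smallErr h w S₁ := by
    unfold smallErr
    gcongr
  simp only [mul_sub, mul_one, Finset.sum_sub_distrib] at h4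
  unfold tailErr
  linarith

end SieveGap

namespace SieveGap

variable {l : List ℕ} {h y : ℕ} {w S₁ D M Y₁ Y₂ : ℝ} {U : Finset ℤ} {A₀ : ℤ} {q : ℕ}

theorem BlockData.q_pos (H : BlockData l h y w S₁ D M Y₁ Y₂) (hq : Y₁ < q) : 0 < q := by
  have : (0 : ℝ) < q := by linarith [H.hY]
  exact_mod_cast this

theorem BlockData.exists_index (H : BlockData l h y w S₁ D M Y₁ Y₂)
    (hU : ∀ u ∈ U, A₀ ≤ u ∧ u < A₀ + y) (hq : Y₁ < q) {a : ℕ} (ha : a < q) {u : ℤ}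
    (hu : u ∈ fiber U q (A₀ + a)) : ∃ j < h, u = A₀ + a + (j : ℤ) * q := by
  obtain ⟨hu1, k, hk⟩ := mem_fiber.1 hu
  have hq0 : (0 : ℤ) < q := by exact_mod_cast H.q_pos hq
  have h1 := hU u hu1
  have h2 := H.y_le hq
  have ha' : (a : ℤ) < q := by exact_mod_cast ha
  have hk0 : 0 ≤ k := by
    by_contra hneg
    have : (q : ℤ) * k ≤ q * (-1) := mul_le_mul_of_nonneg_left (by omega) hq0.le
    linarith
  have hkh : k < h := by
    refine lt_of_mul_lt_mul_left (a := (q : ℤ)) ?_ hq0.le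
    have : (0 : ℤ) ≤ a := by positivity
    linarith [mul_comm (h : ℤ) q]
  refine ⟨k.toNat, by omega, ?_⟩
  rw [Int.toNat_of_nonneg hk0]
  linarith [mul_comm k (q : ℤ)]

theorem BlockData.avg_mul_le_of_ne (H : BlockData l h y w S₁ D M Y₁ Y₂)
    (hU : ∀ u ∈ U, A₀ ≤ u ∧ u < A₀ + y) (hq : Y₁ < q) (hqp : q.Prime) {a a' : ℕ} (ha : a < q)
    (ha' : a' < q) (β : ℕ → ℤ) :
    avg l (fun β => fiberWeight l U q (A₀ + a) β * fiberWeight l U q (A₀ + a') β) β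
      ≤ (∑ x ∈ Finset.range h ×ˢ Finset.range h, divFactor l.toFinset (4 * (h ^ 2 : ℕ))
          ((a : ℤ) - a' + ((x.1 : ℤ) - x.2) * q)) / (h ^ 2 : ℕ) := by
  have hcard : (Finset.range h ×ˢ Finset.range h).card = h ^ 2 := by
    rw [Finset.card_product, Finset.card_range, sq]
  have hd : ∀ a : ℤ, ∀ p ∈ l.toFinset, DistinctMod p (fiber U q a) := fun a p hp =>
    H.distinctMod hU hq hqp a (by simpa using hp)
  have h1 := survProb_union_le (hd (A₀ + a)) (hd (A₀ + a')) fun p hp =>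
    H.two_mul_card_le hU hq hq _ _ hp
  have hne : (Finset.range h ×ˢ Finset.range h).Nonempty := by
    rw [← Finset.card_pos, hcard]; have := H.hh; positivity
  have h2 := prod_congPairs_le (P := l.toFinset) hne
    (fun x => (a : ℤ) - a' + ((x.1 : ℤ) - x.2) * q)
    (fun p hp => by
      have hp' : p ∈ l := by simpa using hp
      have := H.sq_lt hp'
      rw [hcard]
      exact ⟨(H.prime p hp').1.pos, by omega⟩)
    (o := fun p => congPairs p (fiber U q (A₀ + a)) (fiber U q (A₀ + a')))
    (fun p hp => by
      have hex : ∀ (a : ℕ) (u : ℤ), ∃ j : ℕ, a < q → u ∈ fiber U q (A₀ + a) →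
          j < h ∧ u = A₀ + a + (j : ℤ) * q := by
        intro a u
        by_cases hc : a < q ∧ u ∈ fiber U q (A₀ + a)
        · obtain ⟨j, hj⟩ := H.exists_index hU hq hc.1 hc.2
          exact ⟨j, fun _ _ => hj⟩
        · exact ⟨0, fun h1 h2 => absurd ⟨h1, h2⟩ hc⟩
      choose J hJ using hex
      refine Finset.card_le_card_of_injOn (fun x => (J a x.1, J a' x.2)) ?_ ?_
      · rintro ⟨u, v⟩ huv
        simp only [Finset.coe_filter, Finset.mem_product, Set.mem_ofPred_eq] at huv
        obtain ⟨⟨hu, hv⟩, hp⟩ := huv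
        have hJu := hJ a u ha hu
        have hJv := hJ a' v ha' hv
        simp only [Finset.coe_filter, Finset.mem_product, Set.mem_ofPred_eq, Finset.mem_range]
        refine ⟨⟨hJu.1, hJv.1⟩, ?_⟩
        rw [hJu.2, hJv.2] at hp
        convert hp using 1
        ring
      · rintro ⟨u, v⟩ huv ⟨u', v'⟩ huv' heq
        simp only [Finset.coe_filter, Finset.mem_product, Set.mem_ofPred_eq] at huv huv'
        simp only [Prod.mk.injEq] at heq
        rw [Prod.mk.injEq, (hJ a u ha huv.1.1).2, (hJ a u' ha huv'.1.1).2, (hJ a' v ha' huv.1.2).2,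
          (hJ a' v' ha' huv'.1.2).2, heq.1, heq.2]
        exact ⟨rfl, rfl⟩)
  rw [hcard] at h2
  refine le_trans ?_ h2
  rw [H.avg_fiberWeight_mul]
  have hp1 := H.distProb_pos (H.card_fiber_le hU hq (A₀ + a))
  have hp2 := H.distProb_pos (H.card_fiber_le hU hq (A₀ + a'))
  rw [← mul_inv, inv_mul_le_iff₀ (mul_pos hp1 hp2)]
  exact h1

theorem card_filter_dvd_sub_le {q d : ℕ} (hd : 0 < d) (c : ℤ) :
    ((((Finset.range q).filter fun a : ℕ => (d : ℤ) ∣ (a : ℤ) - c).card : ℕ) : ℝ) ≤ (q : ℝ) / d + 1 := by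
  have hd' : (0 : ℤ) < d := by exact_mod_cast hd
  have h1 : ((Finset.range q).filter fun a : ℕ => (d : ℤ) ∣ (a : ℤ) - c).card ≤ q / d + 1 := by
    rw [← Finset.card_range (q / d + 1)]
    refine Finset.card_le_card_of_injOn (fun a => a / d) ?_ ?_
    · intro a ha
      simp only [Finset.coe_filter, Finset.mem_range, Set.mem_ofPred_eq] at ha
      simp only [Finset.coe_range, Set.mem_Iio]
      have := Nat.div_le_div_right (c := d) ha.1.le
      omega
    · intro a ha b hb hab
      simp only [Finset.coe_filter, Finset.mem_range, Set.mem_ofPred_eq] at ha hb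
      have h2 := dvd_sub ha.2 hb.2
      have h3 : a % d = b % d := by
        have : (a : ℤ) % d = b % d := by
          rw [Int.emod_eq_emod_iff_emod_sub_eq_zero, ← Int.dvd_iff_emod_eq_zero]
          simpa using h2
        exact_mod_cast this
      have h4 := Nat.div_add_mod a d
      have h5 := Nat.div_add_mod b d
      simp only at hab
      rw [hab, h3] at h4
      omega
  have h2 : ((q / d : ℕ) : ℝ) ≤ (q : ℝ) / d := Nat.cast_div_le
  calc _ ≤ (((q / d + 1 : ℕ)) : ℝ) := by exact_mod_cast h1
    _ ≤ _ := by push_cast; linarith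

theorem inv_le_rpow_neg {d : ℝ} (hd : 1 ≤ d) : 1 / d ≤ d ^ (-(7 / 8) : ℝ) := by
  rw [one_div, ← Real.rpow_neg_one]
  exact Real.rpow_le_rpow_of_exponent_le hd (by norm_num)

theorem one_le_natCast_prod {P S : Finset ℕ} (hP : ∀ p ∈ P, p.Prime) (hS : S ⊆ P) :
    (1 : ℝ) ≤ ((∏ p ∈ S, p : ℕ) : ℝ) := by
  exact_mod_cast Nat.one_le_iff_ne_zero.2 (Finset.prod_ne_zero_iff.2 fun p hp =>
    (hP p (hS hp)).ne_zero)

/-- The total weight of the fibers modulo `q`. -/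
noncomputable def totalWeight (l : List ℕ) (U : Finset ℤ) (A₀ : ℤ) (q : ℕ) (β : ℕ → ℤ) : ℝ :=
  ∑ a ∈ Finset.range q, fiberWeight l U q (A₀ + a) β

theorem BlockData.avg_totalWeight (H : BlockData l h y w S₁ D M Y₁ Y₂)
    (hU : ∀ u ∈ U, A₀ ≤ u ∧ u < A₀ + y) (hq : Y₁ < q) (hqp : q.Prime) (β : ℕ → ℤ) :
    avg l (totalWeight l U A₀ q) β = q := by
  unfold totalWeight
  rw [avg_sum, Finset.sum_congr rfl fun (a : ℕ) _ => H.avg_fiberWeight hU hq hqp (A₀ + a) β]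
  simp

/-- The relative variance of the total weight. -/
noncomputable def massErr (l : List ℕ) (h : ℕ) (w S₁ D M Y₁ : ℝ) : ℝ :=
  1 / Y₁ * (distProb l.toFinset h)⁻¹ + 2 * smallErr h w S₁ + tailErr D M w

theorem BlockData.sum_divFactor_range_le (H : BlockData l h y w S₁ D M Y₁ Y₂) (hq : Y₁ < q)
    (hq2 : q ≤ Y₂) {a' : ℕ} (ha' : a' < q) {x : ℕ × ℕ} (hx : x.1 < h ∧ x.2 < h) :
    ∑ a ∈ (Finset.range q).erase a', divFactor l.toFinset (4 * (h ^ 2 : ℕ))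
          ((a : ℤ) - a' + ((x.1 : ℤ) - x.2) * q)
      ≤ q * (1 + 2 * smallErr h w S₁ + tailErr D M w) := by
  have hq0 : 0 < q := H.q_pos hq
  have hT := H.tailErr_nonneg
  have h1 := H.sum_divFactor_le ((Finset.range q).erase a') (μ := fun _ => 1)
    (m := fun a => (a : ℤ) - a' + ((x.1 : ℤ) - x.2) * q) (K := 4 * (h ^ 2 : ℕ)) (A := 2 * q)
    (fun _ _ => zero_le_one)
    (fun a ha => by
      rw [Finset.mem_erase, Finset.mem_range] at ha
      constructor
      · intro h0
        have h2 : (q : ℤ) ∣ (a : ℤ) - a' := ⟨-((x.1 : ℤ) - x.2), by linarith [mul_comm ((x.1 : ℤ) - x.2) (q : ℤ)]⟩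
        have h3 := Int.eq_zero_of_abs_lt_dvd h2 (by rw [abs_lt]; omega)
        exact ha.1 (by omega)
      · have h2 : |(a : ℤ) - a'| ≤ q := by rw [abs_le]; omega
        have h3 : |(x.1 : ℤ) - x.2| ≤ h := by rw [abs_le]; omega
        have h2' : |(a : ℝ) - a'| ≤ q := by exact_mod_cast h2
        have h3' : |(x.1 : ℝ) - x.2| ≤ h := by exact_mod_cast h3
        push_cast
        have hh1 := H.h_pos
        calc |(a : ℝ) - a' + ((x.1 : ℝ) - x.2) * q|
            ≤ |(a : ℝ) - a'| + |((x.1 : ℝ) - x.2) * q| := abs_add_le _ _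
          _ ≤ q + h * q := by
              rw [abs_mul, Nat.abs_cast]; gcongr
          _ ≤ h * Y₂ + h * Y₂ := by
              have : (q : ℝ) ≤ h * Y₂ := by nlinarith
              have : (h : ℝ) * q ≤ h * Y₂ := by gcongr
              linarith
          _ ≤ M := by linarith [H.hM])
    (by positivity) (by push_cast; nlinarith [sq_nonneg (h : ℝ)]) (by positivity)
    (fun S hS hne hSD => by
      have hd1 := one_le_natCast_prod (fun p hp => (H.toFinset_prime p hp).1) hS
      set d := ∏ p ∈ S, p with hd
      have hd0 : 0 < d := by
        have : (0 : ℝ) < d := by linarith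
        exact_mod_cast this
      have hdq : (d : ℝ) ≤ q := (hSD.trans H.hDY).trans hq.le
      rw [Finset.sum_const, nsmul_one]
      have h2 : (((Finset.range q).erase a').filter
          fun a : ℕ => (d : ℤ) ∣ (a : ℤ) - a' + ((x.1 : ℤ) - x.2) * q).card ≤
          ((Finset.range q).filter fun a : ℕ => (d : ℤ) ∣ (a : ℤ) -
            (a' - ((x.1 : ℤ) - x.2) * q)).card := by
        refine Finset.card_le_card fun a ha => ?_
        rw [Finset.mem_filter, Finset.mem_erase] at ha
        rw [Finset.mem_filter]
        refine ⟨ha.1.2, ?_⟩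
        convert ha.2 using 1
        ring
      have h3 := card_filter_dvd_sub_le (q := q) hd0 (a' - ((x.1 : ℤ) - x.2) * q)
      have h4 : (1 : ℝ) ≤ q / d := by rw [le_div_iff₀ (by linarith)]; linarith
      calc _ ≤ (q : ℝ) / d + 1 := le_trans (by exact_mod_cast h2) h3
        _ ≤ 2 * q * (1 / d) := by
            have : 2 * (q : ℝ) * (1 / d) = 2 * (q / d) := by ring
            linarith
        _ ≤ 2 * q * (d : ℝ) ^ (-(7 / 8) : ℝ) := by
            gcongr
            exact inv_le_rpow_neg hd1)
  simp only [one_mul, Finset.sum_const, nsmul_one] at h1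
  have h2 : (((Finset.range q).erase a').card : ℝ) ≤ q := by
    have := (Finset.card_le_card (Finset.erase_subset a' (Finset.range q)))
    rw [Finset.card_range] at this
    exact_mod_cast this
  calc _ ≤ _ := h1
    _ ≤ q + 2 * q * smallErr h w S₁ + q * tailErr D M w := by gcongr
    _ = _ := by ring

theorem BlockData.avg_totalWeight_sq_le (H : BlockData l h y w S₁ D M Y₁ Y₂)
    (hU : ∀ u ∈ U, A₀ ≤ u ∧ u < A₀ + y) (hq : Y₁ < q) (hq2 : q ≤ Y₂) (hqp : q.Prime) (β : ℕ → ℤ) :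
    avg l (fun β => totalWeight l U A₀ q β ^ 2) β
      ≤ (q : ℝ) ^ 2 * (1 + massErr l h w S₁ D M Y₁) := by
  have hq0 : (0 : ℝ) < q := by exact_mod_cast H.q_pos hq
  have hh : (0 : ℝ) < (h ^ 2 : ℕ) := by have := H.hh; positivity
  have hpi := H.distProb_pos le_rfl
  have h1 : avg l (fun β => totalWeight l U A₀ q β ^ 2) β
      = ∑ a' ∈ Finset.range q, ∑ a ∈ Finset.range q,
        avg l (fun β => fiberWeight l U q (A₀ + a) β * fiberWeight l U q (A₀ + a') β) β := by
    simp only [← avg_sum]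
    congr 1
    funext β
    rw [sq, totalWeight, Finset.sum_mul_sum, Finset.sum_comm]
  have h2 : ∀ a' ∈ Finset.range q, ∑ a ∈ Finset.range q,
        avg l (fun β => fiberWeight l U q (A₀ + a) β * fiberWeight l U q (A₀ + a') β) β
      ≤ q * (1 + massErr l h w S₁ D M Y₁) := by
    intro a' ha'
    have ha'q := Finset.mem_range.1 ha'
    rw [← Finset.add_sum_erase _ _ ha']
    have h3 := H.avg_fiberWeight_sq_le hU hq hqp (A₀ + a') β
    have h4 : ∑ a ∈ (Finset.range q).erase a',
        avg l (fun β => fiberWeight l U q (A₀ + a) β * fiberWeight l U q (A₀ + a') β) β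
        ≤ q * (1 + 2 * smallErr h w S₁ + tailErr D M w) := by
      calc _ ≤ ∑ a ∈ (Finset.range q).erase a',
            (∑ x ∈ Finset.range h ×ˢ Finset.range h, divFactor l.toFinset (4 * (h ^ 2 : ℕ))
              ((a : ℤ) - a' + ((x.1 : ℤ) - x.2) * q)) / (h ^ 2 : ℕ) :=
            Finset.sum_le_sum fun a ha => H.avg_mul_le_of_ne hU hq hqp
              (Finset.mem_range.1 (Finset.mem_erase.1 ha).2) ha'q β
        _ = (∑ x ∈ Finset.range h ×ˢ Finset.range h, ∑ a ∈ (Finset.range q).erase a',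
              divFactor l.toFinset (4 * (h ^ 2 : ℕ))
              ((a : ℤ) - a' + ((x.1 : ℤ) - x.2) * q)) / (h ^ 2 : ℕ) := by
            rw [← Finset.sum_div, Finset.sum_comm]
        _ ≤ (∑ x ∈ Finset.range h ×ˢ Finset.range h,
              q * (1 + 2 * smallErr h w S₁ + tailErr D M w)) / (h ^ 2 : ℕ) := by
            gcongr with x hx
            rw [Finset.mem_product, Finset.mem_range, Finset.mem_range] at hx
            exact H.sum_divFactor_range_le hq hq2 ha'q hx
        _ = _ := by
            rw [Finset.sum_const, nsmul_eq_mul, Finset.card_product, Finset.card_range, ← sq]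
            exact mul_div_cancel_left₀ _ hh.ne'
    have h5 : (distProb l.toFinset h)⁻¹ ≤ q * (1 / Y₁ * (distProb l.toFinset h)⁻¹) := by
      have hY := H.hY
      have : 1 ≤ (q : ℝ) / Y₁ := by rw [le_div_iff₀ (by linarith)]; linarith
      calc (distProb l.toFinset h)⁻¹ = 1 * (distProb l.toFinset h)⁻¹ := (one_mul _).symm
        _ ≤ (q : ℝ) / Y₁ * (distProb l.toFinset h)⁻¹ := by gcongr
        _ = _ := by ring
    unfold massErr
    linarith
  rw [h1]
  refine (Finset.sum_le_sum h2).trans (le_of_eq ?_)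
  rw [Finset.sum_const, Finset.card_range, nsmul_eq_mul]
  ring

end SieveGap

namespace SieveGap

variable {l : List ℕ} {h y : ℕ} {w S₁ D M Y₁ Y₂ : ℝ} {U : Finset ℤ} {A₀ : ℤ} {q : ℕ}

/-- The nonzero integers of absolute value at most `h`. -/
noncomputable def steps (h : ℕ) : Finset ℤ := (Finset.Icc (-(h : ℤ)) h).erase 0

theorem card_steps (h : ℕ) : (steps h).card = 2 * h := by
  rw [steps, Finset.card_erase_of_mem (by simp), Int.card_Icc]
  omega

theorem mem_steps {h : ℕ} {k : ℤ} : k ∈ steps h ↔ k ≠ 0 ∧ |k| ≤ h := by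
  rw [steps, Finset.mem_erase, Finset.mem_Icc, abs_le]

theorem BlockData.avg_mul_le_of_prime_ne (H : BlockData l h y w S₁ D M Y₁ Y₂)
    (hU : ∀ u ∈ U, A₀ ≤ u ∧ u < A₀ + y) (hq : Y₁ < q) (hqp : q.Prime) {q' : ℕ} (hq' : Y₁ < q')
    (hqp' : q'.Prime) {v : ℤ} (hv : v ∈ U) (β : ℕ → ℤ) :
    avg l (fun β => fiberWeight l U q v β * fiberWeight l U q' v β) β * distProb l.toFinset 1
      ≤ (∑ x ∈ steps h ×ˢ steps h, divFactor l.toFinset (4 * (4 * h ^ 2 : ℕ))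
          (x.1 * q - x.2 * q')) / (4 * h ^ 2 : ℕ) := by
  have hcard : (steps h ×ˢ steps h).card = 4 * h ^ 2 := by
    rw [Finset.card_product, card_steps]; ring
  have hself : ∀ q : ℕ, v ∈ fiber U q v := fun q => mem_fiber.2 ⟨hv, by simp⟩
  have h1 := survProb_union_mul_le
    (fun p hp => H.distinctMod hU hq hqp v (p := p) (by simpa using hp))
    (fun p hp => H.distinctMod hU hq' hqp' v (p := p) (by simpa using hp))
    (fun p hp => H.two_mul_card_le hU hq hq' v v hp) (hself q) (hself q')
  have hne : (steps h ×ˢ steps h).Nonempty := by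
    rw [← Finset.card_pos, hcard]; have := H.hh; positivity
  have hex : ∀ (q : ℕ) (u : ℤ), ∃ k : ℤ, Y₁ < q → u ∈ (fiber U q v).erase v →
      k ∈ steps h ∧ u - v = k * q := by
    intro q u
    by_cases hc : Y₁ < q ∧ u ∈ (fiber U q v).erase v
    · obtain ⟨hne, hu⟩ := Finset.mem_erase.1 hc.2
      obtain ⟨k, hk, hk1⟩ := H.exists_mul_eq hU hc.1 (mem_fiber.1 hu).1 hv (mem_fiber.1 hu).2
      refine ⟨k, fun _ _ => ⟨mem_steps.2 ⟨?_, hk1.le⟩, hk⟩⟩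
      rintro rfl
      rw [zero_mul] at hk
      exact hne (by linarith)
    · exact ⟨0, fun h1 h2 => absurd ⟨h1, h2⟩ hc⟩
  choose J hJ using hex
  have h2 := prod_congPairs_le (P := l.toFinset) hne
    (fun x => x.1 * q - x.2 * q')
    (fun p hp => by
      have hp' : p ∈ l := by simpa using hp
      have := H.sq_lt hp'
      rw [hcard]
      exact ⟨(H.prime p hp').1.pos, by omega⟩)
    (o := fun p => congPairs p ((fiber U q v).erase v) ((fiber U q' v).erase v))
    (fun p hp => by
      refine Finset.card_le_card_of_injOn (fun x => (J q x.1, J q' x.2)) ?_ ?_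
      · rintro ⟨u, u'⟩ huv
        simp only [Finset.coe_filter, Finset.mem_product, Set.mem_ofPred_eq] at huv
        obtain ⟨⟨hu, hu'⟩, hp⟩ := huv
        have hJu := hJ q u hq hu
        have hJv := hJ q' u' hq' hu'
        simp only [Finset.coe_filter, Finset.mem_product, Set.mem_ofPred_eq]
        refine ⟨⟨hJu.1, hJv.1⟩, ?_⟩
        rw [← hJu.2, ← hJv.2]
        convert hp using 1
        ring
      · rintro ⟨u, u'⟩ huv ⟨v', v''⟩ huv' heq
        simp only [Finset.coe_filter, Finset.mem_product, Set.mem_ofPred_eq] at huv huv'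
        simp only [Prod.mk.injEq] at heq
        have e1 := (hJ q u hq huv.1.1).2
        have e2 := (hJ q v' hq huv'.1.1).2
        have e3 := (hJ q' u' hq' huv.1.2).2
        have e4 := (hJ q' v'' hq' huv'.1.2).2
        rw [heq.1] at e1
        rw [heq.2] at e3
        rw [Prod.mk.injEq]
        exact ⟨by linarith, by linarith⟩)
  rw [hcard] at h2
  refine le_trans ?_ h2
  rw [H.avg_fiberWeight_mul, mul_assoc]
  have hp1 := H.distProb_pos (H.card_fiber_le hU hq v)
  have hp2 := H.distProb_pos (H.card_fiber_le hU hq' v)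
  rw [← mul_inv, inv_mul_le_iff₀ (mul_pos hp1 hp2)]
  exact h1

/-- The density of primes of the block in progressions, relative to `d ^ (-7 / 8)`. -/
noncomputable def progDensity (Y₁ Y₂ : ℝ) : ℝ := 32 * Y₂ / (Y₁ * Real.log Y₁)

theorem BlockData.sum_inv_progression_le (H : BlockData l h y w S₁ D M Y₁ Y₂) {Q : Finset ℕ}
    (hQ : ∀ q ∈ Q, q.Prime ∧ Y₁ < q ∧ (q : ℝ) ≤ Y₂) {k : ℤ} (hk : k ∈ steps h) (c : ℤ)
    {S : Finset ℕ} (hS : S ⊆ l.toFinset) (hne : S.Nonempty) (hSD : ((∏ p ∈ S, p : ℕ) : ℝ) ≤ D) :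
    ∑ q ∈ Q.filter (fun q : ℕ => ((∏ p ∈ S, p : ℕ) : ℤ) ∣ k * (q : ℤ) - c), 1 / (q : ℝ)
      ≤ progDensity Y₁ Y₂ * ((∏ p ∈ S, p : ℕ) : ℝ) ^ (-(7 / 8) : ℝ) := by
  have hd1 := one_le_natCast_prod (fun p hp => (H.toFinset_prime p hp).1) hS
  have hcop : IsCoprime k ((∏ p ∈ S, p : ℕ) : ℤ) := by
    rw [Nat.cast_prod]
    refine IsCoprime.prod_right fun p hp => ?_
    have hpp := H.toFinset_prime p (hS hp)
    rw [isCoprime_comm]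
    refine ((Nat.prime_iff_prime_int.1 hpp.1).coprime_iff_not_dvd).2 fun hdvd => ?_
    have h2 := mem_steps.1 hk
    have h3 := H.lt_prime (p := p) (by simpa using hS hp)
    have h4 := H.hh
    exact h2.1 (Int.eq_zero_of_abs_lt_dvd hdvd (lt_of_le_of_lt h2.2 (by exact_mod_cast (by omega : h < p))))
  have hwd : w < ((∏ p ∈ S, p : ℕ) : ℝ) := by
    obtain ⟨p, hp⟩ := hne
    have hpp := H.toFinset_prime p (hS hp)
    refine hpp.2.trans_le ?_
    have h2 : p ∣ ∏ p ∈ S, p := Finset.dvd_prod_of_mem _ hp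
    have h3 : 0 < ∏ p ∈ S, p := by
      have : (0 : ℝ) < ((∏ p ∈ S, p : ℕ) : ℝ) := by linarith
      exact_mod_cast this
    exact_mod_cast Nat.le_of_dvd h3 h2
  set d := ∏ p ∈ S, p with hd
  have hw := H.one_lt_w
  have hY := H.hY
  have hY₂ := H.hY₂
  have hlog : 0 < Real.log Y₁ := Real.log_pos hY
  have hd2 : 2 ≤ d := by
    have : (1 : ℝ) < d := hw.trans hwd
    exact_mod_cast this
  obtain ⟨r, t, hrt⟩ := hcop
  have hdY : (d : ℝ) ≤ Y₁ := hSD.trans H.hDY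
  have h1 := card_primes_in_progression_le hd2 hY (by linarith : 0 ≤ Y₂) hdY
    (by
      have : Y₂ / d ≤ Y₂ / w := by gcongr; linarith
      linarith [H.hm]) (r * c)
    (Q.filter fun q : ℕ => (d : ℤ) ∣ k * (q : ℤ) - c)
    (fun q hq => by
      rw [Finset.mem_filter] at hq
      obtain ⟨hq1, hq2⟩ := hq
      refine ⟨(hQ q hq1).1, (hQ q hq1).2.1, (hQ q hq1).2.2, ?_⟩
      have : (q : ℤ) - r * c = r * (k * q - c) + d * (t * q) := by
        linear_combination (-(q : ℤ)) * hrt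
      rw [this]
      exact dvd_add (dvd_mul_of_dvd_right hq2 _) (dvd_mul_right _ _))
  set Q' := Q.filter fun q : ℕ => (d : ℤ) ∣ k * (q : ℤ) - c with hQ'
  have hd0 : (0 : ℝ) < d := by linarith
  have h2 : (1 : ℝ) ≤ Y₂ / d := by rw [le_div_iff₀ hd0]; linarith
  have h3 : Real.log d ≤ 8 * (d : ℝ) ^ (1 / 8 : ℝ) := by
    have := Real.log_le_rpow_div hd0.le (by norm_num : (0 : ℝ) < 1 / 8)
    linarith
  have h4 : (d : ℝ) ^ (1 / 8 : ℝ) / d = (d : ℝ) ^ (-(7 / 8) : ℝ) := by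
    nth_rw 2 [← Real.rpow_one (d : ℝ)]
    rw [← Real.rpow_sub hd0]
    norm_num
  have h5 : (Q'.card : ℝ) ≤ 32 * Y₂ * (d : ℝ) ^ (-(7 / 8) : ℝ) / Real.log Y₁ := by
    rw [le_div_iff₀ hlog]
    have hlogd : 0 ≤ Real.log d := Real.log_nonneg hd1
    calc _ ≤ _ := h1
      _ ≤ 2 * (Y₂ / d + Y₂ / d) * (8 * (d : ℝ) ^ (1 / 8 : ℝ)) := by
          gcongr
      _ = 32 * Y₂ * ((d : ℝ) ^ (1 / 8 : ℝ) / d) := by ring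
      _ = _ := by rw [h4]
  calc ∑ q ∈ Q', 1 / (q : ℝ) ≤ ∑ q ∈ Q', 1 / Y₁ := by
        refine Finset.sum_le_sum fun q hq => ?_
        have := (hQ q (Finset.mem_filter.1 hq).1).2.1
        gcongr
    _ = Q'.card * (1 / Y₁) := by rw [Finset.sum_const, nsmul_eq_mul]
    _ ≤ 32 * Y₂ * (d : ℝ) ^ (-(7 / 8) : ℝ) / Real.log Y₁ * (1 / Y₁) := by gcongr
    _ = _ := by unfold progDensity; field_simp

theorem BlockData.sum_divFactor_primes_le (H : BlockData l h y w S₁ D M Y₁ Y₂) {Q : Finset ℕ}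
    (hQ : ∀ q ∈ Q, q.Prime ∧ Y₁ < q ∧ (q : ℝ) ≤ Y₂) {q' : ℕ} (hq' : q' ∈ Q) {x : ℤ × ℤ}
    (hx : x.1 ∈ steps h ∧ x.2 ∈ steps h) :
    ∑ q ∈ Q.erase q', 1 / (q : ℝ) * divFactor l.toFinset (4 * (4 * h ^ 2 : ℕ))
          (x.1 * q - x.2 * q')
      ≤ (∑ q ∈ Q, 1 / (q : ℝ)) * (1 + tailErr D M w) + progDensity Y₁ Y₂ * smallErr h w S₁ := by
  have hT := H.tailErr_nonneg
  have hY := H.hY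
  have hY₂ := H.hY₂
  have hlog : 0 < Real.log Y₁ := Real.log_pos hY
  have hQ' : ∀ q ∈ Q.erase q', q.Prime ∧ Y₁ < q ∧ (q : ℝ) ≤ Y₂ := fun q hq =>
    hQ q (Finset.mem_of_mem_erase hq)
  have h1 := H.sum_divFactor_le (Q.erase q') (μ := fun q => 1 / (q : ℝ))
    (m := fun q : ℕ => x.1 * (q : ℤ) - x.2 * q') (K := 4 * (4 * h ^ 2 : ℕ))
    (A := progDensity Y₁ Y₂) (fun _ _ => by positivity)
    (fun q hq => by
      have hqne := Finset.ne_of_mem_erase hq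
      have h1 := mem_steps.1 hx.1
      have h2 := mem_steps.1 hx.2
      constructor
      · intro h0
        have h3 : (q : ℤ) ∣ x.2 * q' := ⟨x.1, by linarith [mul_comm x.1 (q : ℤ)]⟩
        rcases (Nat.prime_iff_prime_int.1 (hQ' q hq).1).dvd_or_dvd h3 with h4 | h4
        · refine h2.1 (Int.eq_zero_of_abs_lt_dvd h4 (lt_of_le_of_lt h2.2 ?_))
          have : (h : ℝ) < q := H.hhY.trans (hQ' q hq).2.1
          exact_mod_cast this
        · exact hqne ((Nat.prime_dvd_prime_iff_eq (hQ' q hq).1 (hQ q' hq').1).1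
            (Int.natCast_dvd_natCast.1 h4))
      · have h3 : |(x.1 : ℝ)| ≤ h := by exact_mod_cast h1.2
        have h4 : |(x.2 : ℝ)| ≤ h := by exact_mod_cast h2.2
        push_cast
        calc |(x.1 : ℝ) * q - x.2 * q'| ≤ |(x.1 : ℝ) * q| + |(x.2 : ℝ) * q'| := abs_sub _ _
          _ ≤ h * Y₂ + h * Y₂ := by
              rw [abs_mul, abs_mul, Nat.abs_cast, Nat.abs_cast]
              gcongr
              · exact (hQ' q hq).2.2
              · exact (hQ q' hq').2.2
          _ ≤ M := by linarith [H.hM])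
    (by positivity) (by push_cast; linarith)
    (by have h0 : 0 < Y₁ := by linarith
        have h1 : 0 < Y₂ := by linarith
        unfold progDensity; positivity)
    (fun S hS hne hSD => H.sum_inv_progression_le hQ' hx.1 (x.2 * q') hS hne hSD)
  have h2 : ∑ q ∈ Q.erase q', 1 / (q : ℝ) ≤ ∑ q ∈ Q, 1 / (q : ℝ) :=
    Finset.sum_le_sum_of_subset_of_nonneg (Finset.erase_subset _ _) fun _ _ _ => by positivity
  calc _ ≤ _ := h1
    _ ≤ (∑ q ∈ Q, 1 / (q : ℝ)) + progDensity Y₁ Y₂ * smallErr h w S₁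
        + (∑ q ∈ Q, 1 / (q : ℝ)) * tailErr D M w := by gcongr
    _ = _ := by ring

/-- The weighted degree of `v` with respect to the primes in `Q`. -/
noncomputable def wdeg (l : List ℕ) (U : Finset ℤ) (Q : Finset ℕ) (v : ℤ) (β : ℕ → ℤ) : ℝ :=
  ∑ q ∈ Q, 1 / (q : ℝ) * fiberWeight l U q v β

/-- The variance parameter of the degrees. -/
noncomputable def degErr (l : List ℕ) (h : ℕ) (w S₁ D M Y₁ Y₂ R : ℝ) : ℝ :=
  1 / Y₁ * (distProb l.toFinset h)⁻¹ + progDensity Y₁ Y₂ * smallErr h w S₁ + R * tailErr D M w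

theorem BlockData.avg_wdeg (H : BlockData l h y w S₁ D M Y₁ Y₂)
    (hU : ∀ u ∈ U, A₀ ≤ u ∧ u < A₀ + y) {Q : Finset ℕ}
    (hQ : ∀ q ∈ Q, q.Prime ∧ Y₁ < q ∧ (q : ℝ) ≤ Y₂) (v : ℤ) (β : ℕ → ℤ) :
    avg l (wdeg l U Q v) β = ∑ q ∈ Q, 1 / (q : ℝ) := by
  unfold wdeg
  rw [avg_sum]
  refine Finset.sum_congr rfl fun q hq => ?_
  rw [avg_const_mul, H.avg_fiberWeight hU (hQ q hq).2.1 (hQ q hq).1, mul_one]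

theorem BlockData.avg_wdeg_sq_le (H : BlockData l h y w S₁ D M Y₁ Y₂)
    (hU : ∀ u ∈ U, A₀ ≤ u ∧ u < A₀ + y) {Q : Finset ℕ}
    (hQ : ∀ q ∈ Q, q.Prime ∧ Y₁ < q ∧ (q : ℝ) ≤ Y₂) {v : ℤ} (hv : v ∈ U) (β : ℕ → ℤ) {R : ℝ}
    (hR : R = ∑ q ∈ Q, 1 / (q : ℝ)) :
    avg l (fun β => wdeg l U Q v β ^ 2) β * distProb l.toFinset 1
      ≤ R * (R + degErr l h w S₁ D M Y₁ Y₂ R) := by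
  have hh : (0 : ℝ) < (4 * h ^ 2 : ℕ) := by have := H.hh; positivity
  have hpi := H.distProb_pos le_rfl
  have hpi1 := H.distProb_pos H.hh
  have hpi2 := H.distProb_le_one H.hh
  have hY := H.hY
  have h1 : avg l (fun β => wdeg l U Q v β ^ 2) β
      = ∑ q' ∈ Q, 1 / (q' : ℝ) * ∑ q ∈ Q, 1 / (q : ℝ) *
        avg l (fun β => fiberWeight l U q v β * fiberWeight l U q' v β) β := by
    simp only [← avg_sum, ← avg_const_mul]
    congr 1
    funext β
    rw [sq, wdeg, Finset.sum_mul_sum, Finset.sum_comm]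
    refine Finset.sum_congr rfl fun q' _ => ?_
    rw [Finset.mul_sum]
    refine Finset.sum_congr rfl fun q _ => ?_
    ring
  have h2 : ∀ q' ∈ Q, (∑ q ∈ Q, 1 / (q : ℝ) *
        avg l (fun β => fiberWeight l U q v β * fiberWeight l U q' v β) β) * distProb l.toFinset 1
      ≤ R + degErr l h w S₁ D M Y₁ Y₂ R := by
    intro q' hq'
    obtain ⟨hqp', hq1', hq2'⟩ := hQ q' hq'
    rw [← Finset.add_sum_erase _ _ hq', add_mul]
    have h3 : 1 / (q' : ℝ) * avg l (fun β => fiberWeight l U q' v β * fiberWeight l U q' v β) β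
        * distProb l.toFinset 1 ≤ 1 / Y₁ * (distProb l.toFinset h)⁻¹ := by
      have h4 := H.avg_fiberWeight_sq_le hU hq1' hqp' v β
      have h5 : 0 ≤ avg l (fun β => fiberWeight l U q' v β * fiberWeight l U q' v β) β := by
        rw [← avg_zero l β]
        exact avg_mono fun β' _ => mul_self_nonneg _
      calc _ ≤ 1 / Y₁ * (distProb l.toFinset h)⁻¹ * 1 := by gcongr
        _ = _ := mul_one _
    have h4 : (∑ q ∈ Q.erase q', 1 / (q : ℝ) *
        avg l (fun β => fiberWeight l U q v β * fiberWeight l U q' v β) β) * distProb l.toFinset 1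
        ≤ R * (1 + tailErr D M w) + progDensity Y₁ Y₂ * smallErr h w S₁ := by
      rw [Finset.sum_mul]
      calc _ ≤ ∑ q ∈ Q.erase q', 1 / (q : ℝ) *
            ((∑ x ∈ steps h ×ˢ steps h, divFactor l.toFinset (4 * (4 * h ^ 2 : ℕ))
              (x.1 * q - x.2 * q')) / (4 * h ^ 2 : ℕ)) := by
            refine Finset.sum_le_sum fun q hq => ?_
            obtain ⟨hqp, hq1, hq2⟩ := hQ q (Finset.mem_of_mem_erase hq)
            rw [mul_assoc]
            refine mul_le_mul_of_nonneg_left ?_ (by positivity)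
            exact H.avg_mul_le_of_prime_ne hU hq1 hqp hq1' hqp' hv β
        _ = (∑ x ∈ steps h ×ˢ steps h, ∑ q ∈ Q.erase q', 1 / (q : ℝ) *
              divFactor l.toFinset (4 * (4 * h ^ 2 : ℕ))
              (x.1 * q - x.2 * q')) / (4 * h ^ 2 : ℕ) := by
            rw [Finset.sum_comm, Finset.sum_div]
            refine Finset.sum_congr rfl fun q _ => ?_
            rw [← Finset.mul_sum, mul_div_assoc]
        _ ≤ (∑ x ∈ steps h ×ˢ steps h,
              (R * (1 + tailErr D M w) + progDensity Y₁ Y₂ * smallErr h w S₁))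
                / (4 * h ^ 2 : ℕ) := by
            gcongr with x hx
            rw [Finset.mem_product] at hx
            rw [hR]
            exact H.sum_divFactor_primes_le hQ hq' hx
        _ = _ := by
            rw [Finset.sum_const, nsmul_eq_mul, Finset.card_product, card_steps,
              show 2 * h * (2 * h) = 4 * h ^ 2 by ring]
            exact mul_div_cancel_left₀ _ hh.ne'
    unfold degErr
    linarith
  rw [h1, Finset.sum_mul]
  calc _ ≤ ∑ q' ∈ Q, 1 / (q' : ℝ) * (R + degErr l h w S₁ D M Y₁ Y₂ R) := by
        refine Finset.sum_le_sum fun q' hq' => ?_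
        rw [mul_assoc]
        exact mul_le_mul_of_nonneg_left (h2 q' hq') (by positivity)
    _ = _ := by rw [← Finset.sum_mul, ← hR]

end SieveGap

namespace SieveGap

variable {l : List ℕ} {h y : ℕ} {w S₁ D M Y₁ Y₂ : ℝ} {U : Finset ℤ} {A₀ : ℤ} {q : ℕ}

/-- The primes of `Q` whose total weight is not much larger than expected. -/
noncomputable def goodPrimes (l : List ℕ) (U : Finset ℤ) (A₀ : ℤ) (ε : ℝ) (Q : Finset ℕ)
    (β : ℕ → ℤ) : Finset ℕ :=
  Q.filter fun q : ℕ => totalWeight l U A₀ q β ≤ (1 + ε) * q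

/-- The survivors whose weighted degree is noticeably smaller than expected. -/
noncomputable def badPoints (l : List ℕ) (U : Finset ℤ) (A₀ : ℤ) (ε : ℝ) (Q : Finset ℕ)
    (β : ℕ → ℤ) : Finset ℤ :=
  U.filter fun v => Surv l β v ∧ wdeg l U (goodPrimes l U A₀ ε Q β) v β
    < (1 - 2 * ε) * ((∑ q ∈ Q, 1 / (q : ℝ)) / distProb l.toFinset 1)

theorem fiberWeight_eq_zero_of_not_surv {v : ℤ} (hv : v ∈ U) {β : ℕ → ℤ} (h : ¬ Surv l β v) :
    fiberWeight l U q v β = 0 := by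
  unfold fiberWeight
  rw [if_neg, mul_zero]
  exact fun h' => h (h' v (mem_fiber.2 ⟨hv, by simp⟩))

theorem fiberWeight_congr {a b : ℤ} (hab : (q : ℤ) ∣ a - b) (β : ℕ → ℤ) :
    fiberWeight l U q a β = fiberWeight l U q b β := by
  unfold fiberWeight
  rw [fiber_eq_of_dvd hab]

theorem BlockData.sum_fiberWeight_le (H : BlockData l h y w S₁ D M Y₁ Y₂)
    (hU : ∀ u ∈ U, A₀ ≤ u ∧ u < A₀ + y) (hq : Y₁ < q) (β : ℕ → ℤ) :
    ∑ v ∈ U, fiberWeight l U q v β ≤ h * totalWeight l U A₀ q β := by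
  have hq0 : (0 : ℤ) < q := by exact_mod_cast H.q_pos hq
  have hdvd : ∀ v : ℤ, (q : ℤ) ∣ v - (A₀ + ((v - A₀) % q).toNat) := by
    intro v
    rw [Int.toNat_of_nonneg (Int.emod_nonneg _ hq0.ne')]
    have := Int.emod_add_mul_ediv (v - A₀) q
    exact ⟨(v - A₀) / q, by linarith⟩
  rw [← Finset.sum_fiberwise_of_maps_to (t := Finset.range q)
    (g := fun v => ((v - A₀) % q).toNat) (fun v _ => by
      rw [Finset.mem_range]
      have := Int.emod_lt_of_pos (v - A₀) hq0
      have := Int.emod_nonneg (v - A₀) hq0.ne'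
      omega), totalWeight, Finset.mul_sum]
  refine Finset.sum_le_sum fun a ha => ?_
  have h1 : ∑ v ∈ U with ((v - A₀) % q).toNat = a, fiberWeight l U q v β
      = ∑ v ∈ U with ((v - A₀) % q).toNat = a, fiberWeight l U q (A₀ + a) β := by
    refine Finset.sum_congr rfl fun v hv => ?_
    have h2 := hdvd v
    rw [(Finset.mem_filter.1 hv).2] at h2
    exact fiberWeight_congr h2 β
  rw [h1, Finset.sum_const, nsmul_eq_mul]
  refine mul_le_mul_of_nonneg_right ?_ (H.fiberWeight_nonneg hU hq _ _)
  have h2 : (U.filter fun v => ((v - A₀) % q).toNat = a) ⊆ fiber U q (A₀ + a) := by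
    intro v hv
    have h2 := hdvd v
    rw [(Finset.mem_filter.1 hv).2] at h2
    exact mem_fiber.2 ⟨(Finset.mem_filter.1 hv).1, h2⟩
  exact_mod_cast (Finset.card_le_card h2).trans (H.card_fiber_le hU hq _)

theorem BlockData.avg_surv_singleton (H : BlockData l h y w S₁ D M Y₁ Y₂) (v : ℤ) (β : ℕ → ℤ) :
    avg l (fun β => if Surv l β v then 1 else 0) β = distProb l.toFinset 1 := by
  have h1 := avg_surv H.nodup (fun p hp => (H.prime p hp).1.pos) {v} β
  simp only [Finset.mem_singleton, forall_eq] at h1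
  rw [h1, survProb_eq_distProb (fun p _ => by
    intro u hu v hv _
    rw [Finset.mem_singleton] at hu hv
    rw [hu, hv])]
  simp

theorem BlockData.avg_degree_variance_le (H : BlockData l h y w S₁ D M Y₁ Y₂)
    (hU : ∀ u ∈ U, A₀ ≤ u ∧ u < A₀ + y) {Q : Finset ℕ}
    (hQ : ∀ q ∈ Q, q.Prime ∧ Y₁ < q ∧ (q : ℝ) ≤ Y₂) {v : ℤ} (hv : v ∈ U) (β : ℕ → ℤ) {R : ℝ}
    (hR : R = ∑ q ∈ Q, 1 / (q : ℝ)) :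
    avg l (fun β => if Surv l β v then (wdeg l U Q v β - R / distProb l.toFinset 1) ^ 2 else 0) β
      ≤ R * degErr l h w S₁ D M Y₁ Y₂ R / distProb l.toFinset 1 := by
  have hσ := H.distProb_pos H.hh
  set σ := distProb l.toFinset 1 with hσdef
  have h1 : (fun β => if Surv l β v then (wdeg l U Q v β - R / σ) ^ 2 else 0)
      = fun β => wdeg l U Q v β ^ 2 + (-2 * (R / σ) * wdeg l U Q v β
        + (R / σ) ^ 2 * (if Surv l β v then 1 else 0)) := by
    funext β
    by_cases hs : Surv l β v
    · rw [if_pos hs, if_pos hs]; ring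
    · rw [if_neg hs, if_neg hs]
      have : wdeg l U Q v β = 0 := Finset.sum_eq_zero fun q _ => by
        rw [fiberWeight_eq_zero_of_not_surv hv hs, mul_zero]
      rw [this]; ring
  rw [h1, avg_add, avg_add, avg_const_mul, avg_const_mul, H.avg_surv_singleton,
    H.avg_wdeg hU hQ, ← hR, ← hσdef]
  have h2 := H.avg_wdeg_sq_le hU hQ hv β hR
  rw [← hσdef, ← le_div_iff₀ hσ] at h2
  calc _ ≤ R * (R + degErr l h w S₁ D M Y₁ Y₂ R) / σ + (-2 * (R / σ) * R + (R / σ) ^ 2 * σ) := by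
        gcongr
    _ = _ := by field_simp; ring

theorem large_le_sq {X q ε : ℝ} (hq : 0 < q) (hε : 0 < ε) (hε1 : ε ≤ 1) (hX : (1 + ε) * q < X) :
    X ≤ 2 / (ε ^ 2 * q) * (X - q) ^ 2 := by
  rw [div_mul_eq_mul_div, le_div_iff₀ (by positivity)]
  have h1 : ε * q ≤ X - q := by linarith
  have h2 : (ε * q) ^ 2 ≤ (X - q) ^ 2 := by gcongr
  have h3 : (ε * q) * (X - q) ≤ (X - q) ^ 2 := by
    rw [sq]; gcongr
    nlinarith
  have h4 : ε ^ 2 * q * (X - q) ≤ ε * q * (X - q) := by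
    have : ε ^ 2 ≤ ε := by nlinarith
    have h0 : 0 ≤ X - q := by nlinarith
    gcongr
  nlinarith

theorem BlockData.avg_lost_le (H : BlockData l h y w S₁ D M Y₁ Y₂)
    (hU : ∀ u ∈ U, A₀ ≤ u ∧ u < A₀ + y) (hq : Y₁ < q) (hq2 : q ≤ Y₂) (hqp : q.Prime)
    {ε : ℝ} (hε : 0 < ε) (hε1 : ε ≤ 1) (β : ℕ → ℤ) :
    avg l (fun β => if totalWeight l U A₀ q β ≤ (1 + ε) * q then 0 else totalWeight l U A₀ q β) β
      ≤ 2 * q * massErr l h w S₁ D M Y₁ / ε ^ 2 := by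
  have hq0 : (0 : ℝ) < q := by exact_mod_cast H.q_pos hq
  have hl0 : ∀ p ∈ l, 0 < p := fun p hp => (H.prime p hp).1.pos
  calc _ ≤ avg l (fun β => 2 / (ε ^ 2 * q) * (totalWeight l U A₀ q β ^ 2
          + (-2 * q * totalWeight l U A₀ q β + q ^ 2))) β := by
        refine avg_mono fun β' _ => ?_
        split_ifs with hc
        · have : totalWeight l U A₀ q β' ^ 2 + (-2 * q * totalWeight l U A₀ q β' + q ^ 2)
            = (totalWeight l U A₀ q β' - q) ^ 2 := by ring
          rw [this]; positivity
        · refine (large_le_sq hq0 hε hε1 (not_le.1 hc)).trans (le_of_eq ?_)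
          ring
    _ = 2 / (ε ^ 2 * q) * (avg l (fun β => totalWeight l U A₀ q β ^ 2) β - q ^ 2) := by
        rw [avg_const_mul, avg_add, avg_add, avg_const_mul, H.avg_totalWeight hU hq hqp,
          avg_const hl0]
        ring
    _ ≤ 2 / (ε ^ 2 * q) * ((q : ℝ) ^ 2 * (1 + massErr l h w S₁ D M Y₁) - q ^ 2) := by
        gcongr
        exact H.avg_totalWeight_sq_le hU hq hq2 hqp β
    _ = _ := by field_simp; ring

theorem BlockData.card_badPoints_le (H : BlockData l h y w S₁ D M Y₁ Y₂)
    (hU : ∀ u ∈ U, A₀ ≤ u ∧ u < A₀ + y) {Q : Finset ℕ}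
    (hQ : ∀ q ∈ Q, q.Prime ∧ Y₁ < q ∧ (q : ℝ) ≤ Y₂) {ε R : ℝ} (hε : 0 < ε)
    (hR : R = ∑ q ∈ Q, 1 / (q : ℝ)) (hR0 : 0 < R) (β : ℕ → ℤ) :
    ((badPoints l U A₀ ε Q β).card : ℝ) ≤
      (distProb l.toFinset 1 / (ε * R)) ^ 2 *
        ∑ v ∈ U, (if Surv l β v then (wdeg l U Q v β - R / distProb l.toFinset 1) ^ 2 else 0)
      + distProb l.toFinset 1 / (ε * R) * ∑ q ∈ Q, 1 / (q : ℝ) * (h *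
        if totalWeight l U A₀ q β ≤ (1 + ε) * q then 0 else totalWeight l U A₀ q β) := by
  have hσ := H.distProb_pos H.hh
  set σ := distProb l.toFinset 1 with hσdef
  have hfw : ∀ q ∈ Q, ∀ v, 0 ≤ fiberWeight l U q v β := fun q hq v =>
    H.fiberWeight_nonneg hU (hQ q hq).2.1 _ _
  have hlost0 : ∀ v, 0 ≤ wdeg l U Q v β - wdeg l U (goodPrimes l U A₀ ε Q β) v β := by
    intro v
    rw [sub_nonneg]
    exact Finset.sum_le_sum_of_subset_of_nonneg (Finset.filter_subset _ _) fun q hq _ =>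
      mul_nonneg (by positivity) (hfw q hq v)
  have hlost : ∑ v ∈ U, (wdeg l U Q v β - wdeg l U (goodPrimes l U A₀ ε Q β) v β)
      ≤ ∑ q ∈ Q, 1 / (q : ℝ) * (h *
        if totalWeight l U A₀ q β ≤ (1 + ε) * q then 0 else totalWeight l U A₀ q β) := by
    have h1 : ∀ v, wdeg l U Q v β - wdeg l U (goodPrimes l U A₀ ε Q β) v β
        = ∑ q ∈ Q, 1 / (q : ℝ) *
          (if totalWeight l U A₀ q β ≤ (1 + ε) * q then 0 else fiberWeight l U q v β) := by
      intro v
      unfold wdeg goodPrimes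
      rw [Finset.sum_filter, ← Finset.sum_sub_distrib]
      refine Finset.sum_congr rfl fun q _ => ?_
      split_ifs <;> ring
    simp only [h1]
    rw [Finset.sum_comm]
    refine Finset.sum_le_sum fun q hq => ?_
    rw [← Finset.mul_sum]
    refine mul_le_mul_of_nonneg_left ?_ (by positivity)
    split_ifs with hc
    · simp
    · exact H.sum_fiberWeight_le hU (hQ q hq).2.1 β
  have h2 : ((badPoints l U A₀ ε Q β).card : ℝ) = ∑ v ∈ U, if Surv l β v ∧
      wdeg l U (goodPrimes l U A₀ ε Q β) v β < (1 - 2 * ε) * (R / σ) then 1 else 0 := by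
    rw [badPoints, ← hσdef, ← hR, Finset.sum_boole]
  rw [h2]
  calc _ ≤ ∑ v ∈ U, ((σ / (ε * R)) ^ 2 *
          (if Surv l β v then (wdeg l U Q v β - R / σ) ^ 2 else 0) + σ / (ε * R) *
          (wdeg l U Q v β - wdeg l U (goodPrimes l U A₀ ε Q β) v β)) := by
        refine Finset.sum_le_sum fun v _ => ?_
        have h3 : 0 ≤ σ / (ε * R) * (wdeg l U Q v β - wdeg l U (goodPrimes l U A₀ ε Q β) v β) :=
          mul_nonneg (by positivity) (hlost0 v)
        have h4 : 0 ≤ (σ / (ε * R)) ^ 2 *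
            (if Surv l β v then (wdeg l U Q v β - R / σ) ^ 2 else 0) := by
          refine mul_nonneg (by positivity) ?_
          split_ifs <;> positivity
        split_ifs with hc h5
        · rw [if_pos hc.1] at h4
          by_cases hY : wdeg l U Q v β < (1 - ε) * (R / σ)
          · have h6 : ε * (R / σ) ≤ R / σ - wdeg l U Q v β := by linarith
            have h7 : (ε * (R / σ)) ^ 2 ≤ (R / σ - wdeg l U Q v β) ^ 2 := by gcongr
            have h8 : (σ / (ε * R)) ^ 2 * (ε * (R / σ)) ^ 2 = 1 := by field_simp
            have h9 : (σ / (ε * R)) ^ 2 * (ε * (R / σ)) ^ 2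
                ≤ (σ / (ε * R)) ^ 2 * (wdeg l U Q v β - R / σ) ^ 2 := by
              gcongr 1
              rw [← neg_sq (wdeg l U Q v β - R / σ), neg_sub]
              exact h7
            linarith
          · have h6 : ε * (R / σ) ≤ wdeg l U Q v β - wdeg l U (goodPrimes l U A₀ ε Q β) v β := by
              linarith [hc.2, not_lt.1 hY]
            have h8 : (σ / (ε * R)) * (ε * (R / σ)) = 1 := by field_simp
            have h9 : (σ / (ε * R)) * (ε * (R / σ)) ≤ σ / (ε * R) *
                (wdeg l U Q v β - wdeg l U (goodPrimes l U A₀ ε Q β) v β) := by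
              gcongr
            linarith
        · exact absurd hc.1 h5
        all_goals first
          | (rw [if_pos (by assumption)] at h4; linarith)
          | (rw [if_neg (by assumption)] at h4; linarith)
    _ = (σ / (ε * R)) ^ 2 * (∑ v ∈ U,
          (if Surv l β v then (wdeg l U Q v β - R / σ) ^ 2 else 0)) + σ / (ε * R) *
          ∑ v ∈ U, (wdeg l U Q v β - wdeg l U (goodPrimes l U A₀ ε Q β) v β) := by
        rw [Finset.sum_add_distrib, Finset.mul_sum, Finset.mul_sum]
    _ ≤ _ := by gcongr

theorem BlockData.avg_card_badPoints_le (H : BlockData l h y w S₁ D M Y₁ Y₂)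
    (hU : ∀ u ∈ U, A₀ ≤ u ∧ u < A₀ + y) {Q : Finset ℕ}
    (hQ : ∀ q ∈ Q, q.Prime ∧ Y₁ < q ∧ (q : ℝ) ≤ Y₂) {ε R : ℝ} (hε : 0 < ε) (hε1 : ε ≤ 1)
    (hR : R = ∑ q ∈ Q, 1 / (q : ℝ)) (hR0 : 0 < R) (β : ℕ → ℤ) :
    avg l (fun β => ((badPoints l U A₀ ε Q β).card : ℝ)) β ≤
      U.card * distProb l.toFinset 1 * degErr l h w S₁ D M Y₁ Y₂ R / (ε ^ 2 * R)
        + 2 * h * Y₂ * massErr l h w S₁ D M Y₁ * distProb l.toFinset 1 / ε ^ 3 := by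
  have hσ := H.distProb_pos H.hh
  have hmass : 0 ≤ massErr l h w S₁ D M Y₁ := by
    have := H.distProb_pos le_rfl
    have := H.smallErr_nonneg
    have := H.tailErr_nonneg
    have : 0 < Y₁ := by linarith [H.hY]
    unfold massErr; positivity
  refine (avg_mono fun β' _ => H.card_badPoints_le hU hQ hε hR hR0 β').trans ?_
  set σ := distProb l.toFinset 1 with hσdef
  rw [avg_add, avg_const_mul, avg_const_mul, avg_sum, avg_sum]
  refine add_le_add ?_ ?_
  · calc _ ≤ (σ / (ε * R)) ^ 2 * ∑ v ∈ U, R * degErr l h w S₁ D M Y₁ Y₂ R / σ := by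
          gcongr with v hv
          exact H.avg_degree_variance_le hU hQ hv β hR
      _ = _ := by rw [Finset.sum_const, nsmul_eq_mul]; field_simp
  · have hcard : (Q.card : ℝ) ≤ R * Y₂ := by
      rw [hR, Finset.sum_mul]
      have : (Q.card : ℝ) = ∑ q ∈ Q, (1 : ℝ) := by simp
      rw [this]
      refine Finset.sum_le_sum fun q hq => ?_
      have h0 : (0 : ℝ) < q := by linarith [H.hY, (hQ q hq).2.1]
      rw [div_mul_eq_mul_div, one_mul, le_div_iff₀ h0, one_mul]
      exact (hQ q hq).2.2
    calc _ ≤ σ / (ε * R) * ∑ q ∈ Q, 2 * h * massErr l h w S₁ D M Y₁ / ε ^ 2 := by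
          gcongr with q hq
          have h0 : (0 : ℝ) < q := by linarith [H.hY, (hQ q hq).2.1]
          rw [avg_const_mul, avg_const_mul]
          have := H.avg_lost_le hU (hQ q hq).2.1 (hQ q hq).2.2 (hQ q hq).1 hε hε1 β
          calc _ ≤ 1 / (q : ℝ) * (h * (2 * q * massErr l h w S₁ D M Y₁ / ε ^ 2)) := by gcongr
            _ = _ := by field_simp
      _ = Q.card * (σ / (ε * R) * (2 * h * massErr l h w S₁ D M Y₁ / ε ^ 2)) := by
          rw [Finset.sum_const, nsmul_eq_mul]; ring
      _ ≤ R * Y₂ * (σ / (ε * R) * (2 * h * massErr l h w S₁ D M Y₁ / ε ^ 2)) := by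
          gcongr
      _ = _ := by field_simp

end SieveGap

namespace SieveGap

/-- The blocks of sieving primes together with the families `Q k s` of primes used in round `k`
and block `s`, on one interval `[A₀, A₀ + y)`. -/
structure RoundData (B m y n r : ℕ) (A₀ : ℤ) (l : ℕ → List ℕ) (h : ℕ → ℕ) (w Y : ℕ → ℝ)
    (S₁ D M Ω : ℝ) (U : ℕ → Finset ℤ) (Q : ℕ → ℕ → Finset ℕ) : Prop where
  block : ∀ s < B, BlockData (l s) (h s) y (w s) S₁ D M (Y (s + 1)) (Y s)
  hU : ∀ s < B, ∀ u ∈ U s, A₀ ≤ u ∧ u < A₀ + y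
  hQ : ∀ k < m, ∀ s < B, ∀ q ∈ Q k s, q.Prime ∧ Y (s + 1) < q ∧ (q : ℝ) ≤ Y s
  hQd : ∀ k < m, ∀ k' < m, ∀ s < B, ∀ s' < B, ∀ q, q ∈ Q k s → q ∈ Q k' s' → k = k' ∧ s = s'
  hr1 : 1 ≤ r
  hr : ∀ s < B, h s ≤ r
  hy : ∀ s < B, (y : ℝ) ≤ Y (s + 1) ^ 2
  hn : ∀ s < B, Y s ≤ n
  hΩ : ∀ s < B, (distProb (l s).toFinset (h s))⁻¹ / Y (s + 1) ≤ Ω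
  hΩ0 : 0 ≤ Ω

variable {B m y n r : ℕ} {A₀ : ℤ} {l : ℕ → List ℕ} {h : ℕ → ℕ} {w Y : ℕ → ℝ}
    {S₁ D M Ω : ℝ} {U : ℕ → Finset ℤ} {Q : ℕ → ℕ → Finset ℕ}

theorem RoundData.exists_index (H : RoundData B m y n r A₀ l h w Y S₁ D M Ω U Q) :
    ∃ blk : ℕ → ℕ, (∀ k < m, ∀ s < B, ∀ q ∈ Q k s, blk q = s) := by
  refine ⟨fun q => if hq : ∃ s < B, ∃ k < m, q ∈ Q k s then hq.choose else 0, ?_⟩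
  intro k hk s hs q hq
  have hex : ∃ s < B, ∃ k < m, q ∈ Q k s := ⟨s, hs, k, hk, hq⟩
  simp only [dif_pos hex]
  obtain ⟨h1, k', hk', h2⟩ := hex.choose_spec
  exact (H.hQd k' hk' k hk _ h1 s hs q h2 hq).2

theorem fiberWeight_sum_fin {l : List ℕ} {U : Finset ℤ} {q : ℕ} (hq : q ≤ n) (β : ℕ → ℤ) :
    ∑ a : Fin n, (if (a : ℕ) < q then fiberWeight l U q (A₀ + (a : ℕ)) β else 0)
      = totalWeight l U A₀ q β := by
  rw [Fin.sum_univ_eq_sum_range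
    (fun a => if a < q then fiberWeight l U q (A₀ + (a : ℕ)) β else 0) n, totalWeight,
    ← Finset.sum_filter]
  refine Finset.sum_congr ?_ fun _ _ => rfl
  ext a
  simp only [Finset.mem_filter, Finset.mem_range]
  omega

theorem RoundData.exists_residues (H : RoundData B m y n r A₀ l h w Y S₁ D M Ω U Q) {β : ℕ → ℤ}
    {V : Finset ℤ} (hV : ∀ v ∈ V, ∀ s < B, v ∈ U s ∧ Surv (l s) β v) (hy0 : 0 < y)
    {ε κ c g η t L : ℝ} (hε : 0 < ε) (hκ0 : 0 < κ) (hκ1 : κ < 1)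
    (hcΩ : Ω * (κ ^ (m * r))⁻¹ ≤ c) (hcY : 1 / (y : ℝ) * (κ ^ m)⁻¹ ≤ c) (hc1 : c ≤ 1)
    (hrc : r * c ≤ 1 / 2) (ht : 0 ≤ t) (hg : 0 ≤ g) (hη : 2 * n * (r * c) ^ 2 ≤ η) (hη1 : η ≤ 1)
    (hfin : (1 / κ - 1) * (1 + m * t) ≤ g * (1 - m * η) - m * t * (κ ^ m)⁻¹)
    (hL0 : 0 < L) (hL : L * (2 * r * c) ≤ 1)
    (hsmall : 2 * (m * n + m * V.card + 1) * Real.exp (n * (L * (2 * r * c)) ^ 2 - L * t) < 1)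
    (hdeg : ∀ k < m, g * κ ^ k ≤ (1 - 2 * ε) / (1 + ε) *
      ∑ s ∈ Finset.range B, (∑ q ∈ Q k s, 1 / (q : ℝ)) / distProb (l s).toFinset 1) :
    ∃ ρ : ℕ → ℤ, ((V.filter fun v => ∀ k < m, ∀ s < B, ∀ q ∈ Q k s, ¬ (q : ℤ) ∣ v - ρ q).card : ℝ)
      ≤ κ ^ m * (V.card + m * t * y) + ∑ k ∈ Finset.range m, ∑ s ∈ Finset.range B,
        ((badPoints (l s) (U s) A₀ ε (Q k s) β).card : ℝ) := by
  obtain ⟨blk, hblk⟩ := H.exists_index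
  set bad : Finset ℤ := (Finset.range m).biUnion fun k => (Finset.range B).biUnion fun s =>
    badPoints (l s) (U s) A₀ ε (Q k s) β with hbad
  set V' := V \ bad with hV'
  set used : ℕ → Prop := fun q => ∃ k < m, ∃ s < B, q ∈ Q k s with hused
  set I : ℕ → Finset ℕ := fun j => if j < m then (Finset.range B).biUnion (Q j) else ∅ with hI
  set edge : ℕ → Fin n → Finset ℤ := fun q a =>
    if used q ∧ (a : ℕ) < q then fiber V' q (A₀ + (a : ℕ)) else ∅ with hedge
  set good : ℕ → Prop := fun q => used q ∧
    totalWeight (l (blk q)) (U (blk q)) A₀ q β ≤ (1 + ε) * q with hgood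
  set ω : ℕ → Fin n → ℝ := fun q a => if good q then ((1 + ε) * q)⁻¹ *
    (if (a : ℕ) < q then fiberWeight (l (blk q)) (U (blk q)) q (A₀ + (a : ℕ)) β else 0)
      else 0 with hω
  have huse : ∀ q, used q → blk q < B ∧ q.Prime ∧ Y (blk q + 1) < q ∧ (q : ℝ) ≤ Y (blk q)
      ∧ 0 < q ∧ q ≤ n := by
    rintro q ⟨k, hk, s, hs, hq⟩
    rw [hblk k hk s hs q hq]
    have h1 := H.hQ k hk s hs q hq
    refine ⟨hs, h1.1, h1.2.1, h1.2.2, h1.1.pos, ?_⟩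
    exact_mod_cast h1.2.2.trans (H.hn s hs)
  have hfw : ∀ q, used q → ∀ a : ℕ, 0 ≤ fiberWeight (l (blk q)) (U (blk q)) q (A₀ + a) β :=
    fun q hq a => (H.block _ (huse q hq).1).fiberWeight_nonneg (H.hU _ (huse q hq).1)
      (huse q hq).2.2.1 _ _
  have hVU : ∀ v ∈ V', ∀ s < B, v ∈ U s ∧ Surv (l s) β v := fun v hv =>
    hV v (Finset.mem_sdiff.1 hv).1
  have hω0 : ∀ q a, 0 ≤ ω q a := by
    intro q a
    simp only [hω]
    split_ifs with h1 h2
    · exact mul_nonneg (by positivity) (hfw q h1.1 a)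
    · simp
    · exact le_rfl
  have hND : NibbleData V' I edge ω m r n κ c Ω y := by
    refine ⟨hκ0, hκ1, ?_, hω0, ?_, ?_, H.hr1, ?_, ?_, ?_, ?_, by exact_mod_cast hy0, hcΩ, hcY,
      hc1, hrc⟩
    · intro j j' hjj
      rw [Finset.disjoint_left]
      intro q hq hq'
      simp only [hI] at hq hq'
      split_ifs at hq hq' with h1 h2
      all_goals try simp at hq
      all_goals try simp at hq'
      obtain ⟨s, hs, hqs⟩ := hq
      obtain ⟨s', hs', hqs'⟩ := hq'
      exact hjj (H.hQd j h1 j' h2 s hs s' hs' q hqs hqs').1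
    · intro q
      by_cases hq : good q
      · have hq0 : (0 : ℝ) < q := by exact_mod_cast (huse q hq.1).2.2.2.2.1
        simp only [hω, if_pos hq]
        rw [← Finset.mul_sum, fiberWeight_sum_fin (huse q hq.1).2.2.2.2.2,
          inv_mul_le_iff₀ (by positivity), mul_one]
        exact hq.2
      · simp [hω, if_neg hq]
    · intro q a
      simp only [hω]
      split_ifs with h1 h2
      · obtain ⟨hs, hp, hY1, hY2, hq0, hqn⟩ := huse q h1.1
        refine le_trans ?_ (H.hΩ _ hs)
        have h3 := (H.block _ hs).fiberWeight_le (H.hU _ hs) hY1 (A₀ + (a : ℕ)) β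
        have h4 := (H.block _ hs).hY
        have h5 := (H.block _ hs).distProb_pos le_rfl
        rw [div_eq_inv_mul]
        have h6 : Y (blk q + 1) ≤ (1 + ε) * q := by nlinarith
        have h7 := hfw q h1.1 a
        gcongr
      · simpa using H.hΩ0
      · exact H.hΩ0
    · intro q a
      simp only [hedge]
      split_ifs with h1
      · obtain ⟨hs, hp, hY1, hY2, hq0, hqn⟩ := huse q h1.1
        refine le_trans ?_ (H.hr _ hs)
        refine ((H.block _ hs).card_fiber_le (H.hU _ hs) hY1 (A₀ + (a : ℕ))).trans' ?_
        refine Finset.card_le_card fun u hu => ?_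
        rw [mem_fiber] at hu ⊢
        exact ⟨(hVU u hu.1 _ hs).1, hu.2⟩
      · simp
    · intro q a a' haa
      rw [Finset.disjoint_left]
      intro u hu hu'
      simp only [hedge] at hu hu'
      split_ifs at hu hu' with h1 h2
      all_goals try simp at hu
      all_goals try simp at hu'
      rw [mem_fiber] at hu hu'
      have h3 := dvd_sub hu'.2 hu.2
      have h4 : (q : ℤ) ∣ (a : ℕ) - (a' : ℕ) := by
        have h6 : (u - (A₀ + (a' : ℕ))) - (u - (A₀ + (a : ℕ))) = ((a : ℕ) : ℤ) - (a' : ℕ) := by ring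
        rwa [h6] at h3
      have h5 := Int.eq_zero_of_abs_lt_dvd h4 (by rw [abs_lt]; omega)
      exact haa (Fin.ext (by omega))
    · intro q q' a a' hqq
      rw [Finset.card_le_one]
      intro u hu u' hu'
      simp only [hedge, Finset.mem_inter] at hu hu'
      split_ifs at hu hu' with h1 h2
      all_goals try simp at hu
      simp only [mem_fiber] at hu hu'
      obtain ⟨hs, hp, hY1, hY2, hq0, hqn⟩ := huse q h1.1
      obtain ⟨hs', hp', hY1', hY2', hq0', hqn'⟩ := huse q' h2.1
      have h3 : (q : ℤ) ∣ u - u' := by simpa using dvd_sub hu.1.2 hu'.1.2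
      have h4 : (q' : ℤ) ∣ u - u' := by simpa using dvd_sub hu.2.2 hu'.2.2
      have hcop : IsCoprime (q : ℤ) q' :=
        Nat.isCoprime_iff_coprime.2 ((Nat.coprime_primes hp hp').2 hqq)
      have h5 := hcop.mul_dvd h3 h4
      have hu1 := H.hU _ hs u (hVU u hu.1.1 _ hs).1
      have hu2 := H.hU _ hs u' (hVU u' hu'.1.1 _ hs).1
      have h6 : (y : ℝ) < q * q' := by
        have ha := H.hy _ hs
        have hb := H.hy _ hs'
        have ha1 := (H.block _ hs).hY
        have hb1 := (H.block _ hs').hY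
        have hyq : (y : ℝ) < (q : ℝ) ^ 2 := ha.trans_lt (by gcongr)
        have hyq' : (y : ℝ) < (q' : ℝ) ^ 2 := hb.trans_lt (by gcongr)
        rcases le_total q q' with hle | hle
        · have : (q : ℝ) ≤ q' := by exact_mod_cast hle
          nlinarith
        · have : (q' : ℝ) ≤ q := by exact_mod_cast hle
          nlinarith
      have h7 : (y : ℤ) < q * q' := by exact_mod_cast h6
      have h8 := Int.eq_zero_of_abs_lt_dvd h5 (by rw [abs_lt]; constructor <;> linarith)
      linarith
    · intro j
      simp only [hI]
      split_ifs with hj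
      · have h1 : (Finset.range B).biUnion (Q j) ⊆ Finset.Icc 1 n := by
          intro q hq
          rw [Finset.mem_biUnion] at hq
          obtain ⟨s, hs, hqs⟩ := hq
          have := huse q ⟨j, hj, s, Finset.mem_range.1 hs, hqs⟩
          rw [Finset.mem_Icc]
          exact ⟨this.2.2.2.2.1, this.2.2.2.2.2⟩
        simpa using Finset.card_le_card h1
      · simp
  have hcardV : (V'.card : ℝ) ≤ V.card := by exact_mod_cast Finset.card_le_card Finset.sdiff_subset
  have hD : ∀ j < m, ∀ v ∈ V', g * κ ^ j ≤ ∑ i ∈ I j, ∑ a with v ∈ edge i a, ω i a := by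
    intro k hk v hv
    refine (hdeg k hk).trans ?_
    have hIk : I k = (Finset.range B).biUnion (Q k) := if_pos hk
    rw [hIk, Finset.sum_biUnion, Finset.mul_sum]
    · refine Finset.sum_le_sum fun s hs => ?_
      have hs' := Finset.mem_range.1 hs
      have hvU := hVU v hv s hs'
      have hvbad : v ∉ badPoints (l s) (U s) A₀ ε (Q k s) β := by
        intro hb
        refine (Finset.mem_sdiff.1 hv).2 ?_
        rw [hbad, Finset.mem_biUnion]
        exact ⟨k, Finset.mem_range.2 hk, Finset.mem_biUnion.2 ⟨s, hs, hb⟩⟩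
      have h1 : (1 - 2 * ε) * ((∑ q ∈ Q k s, 1 / (q : ℝ)) / distProb (l s).toFinset 1)
          ≤ wdeg (l s) (U s) (goodPrimes (l s) (U s) A₀ ε (Q k s) β) v β := by
        by_contra hlt
        exact hvbad (Finset.mem_filter.2 ⟨hvU.1, hvU.2, not_le.1 hlt⟩)
      calc _ = (1 + ε)⁻¹ * ((1 - 2 * ε) *
            ((∑ q ∈ Q k s, 1 / (q : ℝ)) / distProb (l s).toFinset 1)) := by ring
        _ ≤ (1 + ε)⁻¹ * wdeg (l s) (U s) (goodPrimes (l s) (U s) A₀ ε (Q k s) β) v β := by gcongr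
        _ = ∑ q ∈ goodPrimes (l s) (U s) A₀ ε (Q k s) β,
            ((1 + ε) * q)⁻¹ * fiberWeight (l s) (U s) q v β := by
            rw [wdeg, Finset.mul_sum]
            refine Finset.sum_congr rfl fun q _ => ?_
            rw [mul_inv]; ring
        _ ≤ ∑ q ∈ goodPrimes (l s) (U s) A₀ ε (Q k s) β, ∑ a with v ∈ edge q a, ω q a := by
            refine Finset.sum_le_sum fun q hq => ?_
            obtain ⟨hq1, hq2⟩ := Finset.mem_filter.1 hq
            have hqu : used q := ⟨k, hk, s, hs', hq1⟩
            have hb := hblk k hk s hs' q hq1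
            obtain ⟨-, hp, hY1, hY2, hq0, hqn⟩ := huse q hqu
            have hq0' : (0 : ℤ) < q := by exact_mod_cast hq0
            have hlt : ((v - A₀) % q).toNat < q := by
              have := Int.emod_lt_of_pos (v - A₀) hq0'
              have := Int.emod_nonneg (v - A₀) hq0'.ne'
              omega
            have hdvd : (q : ℤ) ∣ v - (A₀ + ((v - A₀) % q).toNat) := by
              rw [Int.toNat_of_nonneg (Int.emod_nonneg _ hq0'.ne')]
              have := Int.emod_add_mul_ediv (v - A₀) q
              exact ⟨(v - A₀) / q, by linarith⟩
            have h2 := Finset.single_le_sum (f := fun a => ω q a)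
              (s := Finset.univ.filter fun a => v ∈ edge q a) (fun a _ => hω0 q a)
              (a := ⟨((v - A₀) % q).toNat, hlt.trans_le hqn⟩) (by
                rw [Finset.mem_filter]
                refine ⟨Finset.mem_univ _, ?_⟩
                simp only [hedge]
                rw [if_pos ⟨hqu, hlt⟩]
                exact mem_fiber.2 ⟨hv, hdvd⟩)
            refine le_trans (le_of_eq ?_) h2
            simp only [hω, hgood, hb]
            rw [if_pos ⟨hqu, hq2⟩, if_pos hlt, fiberWeight_congr hdvd]
        _ ≤ _ := Finset.sum_le_sum_of_subset_of_nonneg (Finset.filter_subset _ _)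
            fun q _ _ => Finset.sum_nonneg fun a _ => hω0 q a
    · intro s hs s' hs' hss
      rw [Function.onFun, Finset.disjoint_left]
      intro q hq hq'
      exact hss (H.hQd k hk k hk s (by simpa using hs) s' (by simpa using hs') q hq hq').2
  obtain ⟨x, hx⟩ := hND.exists_cover ht hg hη hη1 hfin hL0 hL
    (lt_of_le_of_lt (by gcongr) hsmall) (fun j hj v hv => by convert hD j hj v hv)
  refine ⟨fun q => (x q).elim 0 fun a => A₀ + (a : ℕ), ?_⟩
  have hsub : (V.filter fun v => ∀ k < m, ∀ s < B, ∀ q ∈ Q k s,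
      ¬ (q : ℤ) ∣ v - (x q).elim 0 fun a => A₀ + (a : ℕ)) ⊆
      (V'.filter fun v => ∀ j < m, ∀ i ∈ I j, v ∉ hitSet (edge i) (x i)) ∪ bad := by
    intro v hv
    obtain ⟨hvV, hv⟩ := Finset.mem_filter.1 hv
    by_cases hb : v ∈ bad
    · exact Finset.mem_union_right _ hb
    · refine Finset.mem_union_left _ (Finset.mem_filter.2 ⟨Finset.mem_sdiff.2 ⟨hvV, hb⟩, ?_⟩)
      intro k hk q hq hhit
      simp only [hI, if_pos hk, Finset.mem_biUnion, Finset.mem_range] at hq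
      obtain ⟨s, hs, hqs⟩ := hq
      have h1 := hv k hk s hs q hqs
      rcases hxq : x q with _ | a
      · rw [hxq] at hhit; simp [hitSet] at hhit
      · rw [hxq] at hhit h1
        simp only [hitSet, Option.elim_some, hedge] at hhit h1
        split_ifs at hhit with h2
        · exact h1 (mem_fiber.1 hhit).2
        · simp at hhit
  have hbcard : (bad.card : ℝ) ≤ ∑ k ∈ Finset.range m, ∑ s ∈ Finset.range B,
        ((badPoints (l s) (U s) A₀ ε (Q k s) β).card : ℝ) := by
    have : bad.card ≤ ∑ k ∈ Finset.range m, ∑ s ∈ Finset.range B,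
        (badPoints (l s) (U s) A₀ ε (Q k s) β).card :=
      Finset.card_biUnion_le.trans (Finset.sum_le_sum fun k _ => Finset.card_biUnion_le)
    exact_mod_cast this
  have h1 := (Finset.card_le_card hsub).trans (Finset.card_union_le _ _)
  have h2 : κ ^ m * (V'.card + m * t * y) ≤ κ ^ m * (V.card + m * t * y) := by gcongr
  have h3 : ((V.filter fun v => ∀ k < m, ∀ s < B, ∀ q ∈ Q k s,
      ¬ (q : ℤ) ∣ v - (x q).elim 0 fun a => A₀ + (a : ℕ)).card : ℝ) ≤
      ((V'.filter fun v => ∀ j < m, ∀ i ∈ I j, v ∉ hitSet (edge i) (x i)).card : ℝ)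
        + bad.card := by exact_mod_cast h1
  have hx' : ((V'.filter fun v => ∀ j < m, ∀ i ∈ I j, v ∉ hitSet (edge i) (x i)).card : ℝ)
      ≤ κ ^ m * (V'.card + m * t * y) := by convert hx
  refine le_trans h3 ?_
  linarith

end SieveGap

namespace SieveGap

theorem avg_card_filter_surv {l : List ℕ} (hl : l.Nodup) (hl0 : ∀ p ∈ l, 0 < p) (J : Finset ℤ)
    (β : ℕ → ℤ) :
    avg l (fun β => ((J.filter (Surv l β)).card : ℝ)) β = J.card * distProb l.toFinset 1 := by
  have h1 : ∀ v : ℤ, avg l (fun β => if Surv l β v then 1 else 0) β = distProb l.toFinset 1 := by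
    intro v
    have h1 := avg_surv hl hl0 {v} β
    simp only [Finset.mem_singleton, forall_eq] at h1
    rw [h1, survProb_eq_distProb (fun p _ => by
      intro u hu v hv _
      rw [Finset.mem_singleton] at hu hv
      rw [hu, hv])]
    simp
  simp only [← Finset.sum_boole]
  rw [avg_sum, Finset.sum_congr rfl fun v _ => h1 v, Finset.sum_const, nsmul_eq_mul]

theorem surv_append {l₁ l₂ : List ℕ} {β : ℕ → ℤ} {v : ℤ} :
    Surv (l₁ ++ l₂) β v ↔ Surv l₁ β v ∧ Surv l₂ β v := by
  simp only [Surv, List.mem_append, or_imp, forall_and]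

theorem surv_congr {l : List ℕ} {β β' : ℕ → ℤ} (h : ∀ p ∈ l, β' p = β p) (v : ℤ) :
    Surv l β' v ↔ Surv l β v := by
  unfold Surv
  exact forall₂_congr fun p hp => by rw [h p hp]

theorem BlockData.avg_append_badPoints_le {l₁ l₂ : List ℕ} {h y : ℕ} {w S₁ D M Y₁ Y₂ : ℝ}
    (H : BlockData l₂ h y w S₁ D M Y₁ Y₂) (hnd : (l₁ ++ l₂).Nodup) (hl₁ : ∀ p ∈ l₁, 0 < p)
    {J : Finset ℤ} {A₀ : ℤ} (hJ : ∀ u ∈ J, A₀ ≤ u ∧ u < A₀ + y) {Q : Finset ℕ}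
    (hQ : ∀ q ∈ Q, q.Prime ∧ Y₁ < q ∧ (q : ℝ) ≤ Y₂) {ε R : ℝ} (hε : 0 < ε) (hε1 : ε ≤ 1)
    (hR : R = ∑ q ∈ Q, 1 / (q : ℝ)) (hR0 : 0 < R) (β : ℕ → ℤ) :
    avg (l₁ ++ l₂) (fun β => ((badPoints l₂ (J.filter (Surv l₁ β)) A₀ ε Q β).card : ℝ)) β ≤
      J.card * distProb (l₁ ++ l₂).toFinset 1 * degErr l₂ h w S₁ D M Y₁ Y₂ R / (ε ^ 2 * R)
        + 2 * h * Y₂ * massErr l₂ h w S₁ D M Y₁ * distProb l₂.toFinset 1 / ε ^ 3 := by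
  obtain ⟨hnd1, hnd2, hdisj⟩ := List.nodup_append.1 hnd
  have hd : Disjoint l₁.toFinset l₂.toFinset := by
    rw [Finset.disjoint_left]
    intro p hp hp'
    rw [List.mem_toFinset] at hp hp'
    exact hdisj p hp p hp' rfl
  have hσ : distProb (l₁ ++ l₂).toFinset 1 = distProb l₁.toFinset 1 * distProb l₂.toFinset 1 := by
    rw [List.toFinset_append, distProb, Finset.prod_union hd]; rfl
  rw [avg_append]
  have h1 : avg l₁ (avg l₂ fun β =>
      ((badPoints l₂ (J.filter (Surv l₁ β)) A₀ ε Q β).card : ℝ)) β ≤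
      avg l₁ (fun β => (distProb l₂.toFinset 1 * degErr l₂ h w S₁ D M Y₁ Y₂ R / (ε ^ 2 * R)) *
        ((J.filter (Surv l₁ β)).card : ℝ)
        + 2 * h * Y₂ * massErr l₂ h w S₁ D M Y₁ * distProb l₂.toFinset 1 / ε ^ 3) β := by
    refine avg_mono fun β₁ _ => ?_
    have h2 : avg l₂ (fun β => ((badPoints l₂ (J.filter (Surv l₁ β)) A₀ ε Q β).card : ℝ)) β₁
        = avg l₂ (fun β => ((badPoints l₂ (J.filter (Surv l₁ β₁)) A₀ ε Q β).card : ℝ)) β₁ := by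
      refine avg_congr fun β₂ hβ₂ => ?_
      have : J.filter (Surv l₁ β₂) = J.filter (Surv l₁ β₁) :=
        Finset.filter_congr fun v _ => surv_congr (fun p hp => hβ₂ p fun hp' =>
          hdisj p hp p hp' rfl) v
      rw [this]
    rw [h2]
    refine (H.avg_card_badPoints_le (fun u hu => hJ u (Finset.mem_filter.1 hu).1) hQ hε hε1 hR hR0
      β₁).trans (le_of_eq ?_)
    ring
  refine h1.trans (le_of_eq ?_)
  rw [avg_add, avg_const_mul, avg_const hl₁, avg_card_filter_surv hnd1 hl₁, hσ]
  ring

/-- The primes in `[a, a + n)`, in increasing order. -/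
noncomputable def primeList (a n : ℕ) : List ℕ := (List.range' a n).filter fun p => Nat.Prime p

theorem mem_primeList {a n p : ℕ} : p ∈ primeList a n ↔ p.Prime ∧ a ≤ p ∧ p < a + n := by
  simp only [primeList, List.mem_filter, List.mem_range'_1, decide_eq_true_eq]
  tauto

theorem nodup_primeList (a n : ℕ) : (primeList a n).Nodup := List.Nodup.filter _ List.nodup_range'

theorem primeList_append {W z : ℕ} (h : W ≤ z) :
    primeList 0 (W + 1) ++ primeList (W + 1) (z - W) = primeList 0 (z + 1) := by
  unfold primeList
  rw [← List.filter_append]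
  congr 1
  have := List.range'_append (s := 0) (m := W + 1) (n := z - W) (step := 1)
  simp only [one_mul, zero_add] at this
  rw [this]
  congr 1
  omega

/-- The interval of `y` integers starting at `A₀`. -/
noncomputable def window (A₀ : ℤ) (y : ℕ) : Finset ℤ := Finset.Ico A₀ (A₀ + y)

theorem card_window (A₀ : ℤ) (y : ℕ) : (window A₀ y).card = y := by simp [window]

theorem exists_forall_le_of_avg_le {l : List ℕ} (hl : ∀ p ∈ l, 0 < p) {f b : Bool → (ℕ → ℤ) → ℝ}
    {N E : ℝ} (hN : 0 < N) (hE : 0 < E) {β₀ : ℕ → ℤ} (hf0 : ∀ i β, 0 ≤ f i β)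
    (hb0 : ∀ i β, 0 ≤ b i β) (hf1 : ∀ i, avg l (f i) β₀ ≤ N) (hb1 : ∀ i, avg l (b i) β₀ ≤ E) :
    ∃ β, ∀ i, f i β ≤ 8 * N ∧ b i β ≤ 8 * E := by
  have havg : avg l (fun β => (8 * N)⁻¹ * f true β + ((8 * N)⁻¹ * f false β +
      ((8 * E)⁻¹ * b true β + (8 * E)⁻¹ * b false β))) β₀ < 1 := by
    simp only [avg_add, avg_const_mul]
    have h1 : ∀ i, (8 * N)⁻¹ * avg l (f i) β₀ ≤ 1 / 8 := by
      intro i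
      rw [inv_mul_le_iff₀ (by positivity)]
      linarith [hf1 i]
    have h2 : ∀ i, (8 * E)⁻¹ * avg l (b i) β₀ ≤ 1 / 8 := by
      intro i
      rw [inv_mul_le_iff₀ (by positivity)]
      linarith [hb1 i]
    linarith [h1 true, h1 false, h2 true, h2 false]
  obtain ⟨β, hβ⟩ := exists_le_of_avg_lt hl havg
  have hf2 : ∀ i, 0 ≤ (8 * N)⁻¹ * f i β := fun i => mul_nonneg (by positivity) (hf0 i β)
  have hb2 : ∀ i, 0 ≤ (8 * E)⁻¹ * b i β := fun i => mul_nonneg (by positivity) (hb0 i β)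
  have h1 : ∀ i, (8 * N)⁻¹ * f i β ≤ 1 ∧ (8 * E)⁻¹ * b i β ≤ 1 := by
    have := hf2 true; have := hf2 false; have := hb2 true; have := hb2 false
    rintro (_ | _) <;> constructor <;> linarith
  refine ⟨β, fun i => ⟨?_, ?_⟩⟩
  · have := (h1 i).1
    rwa [inv_mul_le_iff₀ (by positivity), mul_one] at this
  · have := (h1 i).2
    rwa [inv_mul_le_iff₀ (by positivity), mul_one] at this

/-- A choice of residues for the small primes leaving few survivors and few bad points. -/
theorem exists_sieve {B m y z : ℕ} {W h : ℕ → ℕ} {Y : ℕ → ℝ} {S₁ D M : ℝ} {A : Bool → ℤ}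
    {Q : Bool → ℕ → ℕ → Finset ℕ} (hW : ∀ s < B, W s ≤ z)
    (H : ∀ s < B, BlockData (primeList (W s + 1) (z - W s)) (h s) y (W s) S₁ D M (Y (s + 1)) (Y s))
    (hQ : ∀ i, ∀ k < m, ∀ s < B, ∀ q ∈ Q i k s, q.Prime ∧ Y (s + 1) < q ∧ (q : ℝ) ≤ Y s)
    {ε N E : ℝ} (hε : 0 < ε) (hε1 : ε ≤ 1) (hN : 0 < N) (hE : 0 < E)
    (hyN : y * distProb (primeList 0 (z + 1)).toFinset 1 ≤ N)
    (hQ0 : ∀ i, ∀ k < m, ∀ s < B, 0 < ∑ q ∈ Q i k s, 1 / (q : ℝ))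
    (hbad : ∀ i, ∀ k < m, ∀ s < B,
      N * degErr (primeList (W s + 1) (z - W s)) (h s) (W s) S₁ D M (Y (s + 1)) (Y s)
          (∑ q ∈ Q i k s, 1 / (q : ℝ)) / (ε ^ 2 * ∑ q ∈ Q i k s, 1 / (q : ℝ))
        + 2 * h s * Y s * massErr (primeList (W s + 1) (z - W s)) (h s) (W s) S₁ D M (Y (s + 1))
          * distProb (primeList (W s + 1) (z - W s)).toFinset 1 / ε ^ 3 ≤ E / (m * B)) :
    ∃ β : ℕ → ℤ, ∀ i,
      (((window (A i) y).filter (Surv (primeList 0 (z + 1)) β)).card : ℝ) ≤ 8 * N ∧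
      ∑ k ∈ Finset.range m, ∑ s ∈ Finset.range B, ((badPoints (primeList (W s + 1) (z - W s))
        ((window (A i) y).filter (Surv (primeList 0 (W s + 1)) β)) (A i) ε (Q i k s) β).card : ℝ)
          ≤ 8 * E := by
  have hl0 : ∀ a n, ∀ p ∈ primeList a n, 0 < p := fun a n p hp => (mem_primeList.1 hp).1.pos
  set f : Bool → (ℕ → ℤ) → ℝ := fun i β =>
    (((window (A i) y).filter (Surv (primeList 0 (z + 1)) β)).card : ℝ) with hf
  set b : Bool → (ℕ → ℤ) → ℝ := fun i β => ∑ k ∈ Finset.range m, ∑ s ∈ Finset.range B,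
    ((badPoints (primeList (W s + 1) (z - W s))
        ((window (A i) y).filter (Surv (primeList 0 (W s + 1)) β)) (A i) ε (Q i k s) β).card : ℝ)
    with hb
  have hf1 : ∀ i, avg (primeList 0 (z + 1)) (f i) 0 ≤ N := by
    intro i
    simp only [hf]
    rw [avg_card_filter_surv (nodup_primeList _ _) (hl0 _ _), card_window]
    exact hyN
  have hb1 : ∀ i, avg (primeList 0 (z + 1)) (b i) 0 ≤ E := by
    intro i
    simp only [hb]
    rw [avg_sum]
    have h1 : ∀ k ∈ Finset.range m, avg (primeList 0 (z + 1)) (fun β => ∑ s ∈ Finset.range B,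
        ((badPoints (primeList (W s + 1) (z - W s))
        ((window (A i) y).filter (Surv (primeList 0 (W s + 1)) β)) (A i) ε (Q i k s) β).card : ℝ)) 0
        ≤ ∑ s ∈ Finset.range B, E / (m * B) := by
      intro k hk
      rw [avg_sum]
      refine Finset.sum_le_sum fun s hs => ?_
      rw [Finset.mem_range] at hk hs
      rw [← primeList_append (hW s hs)]
      refine ((H s hs).avg_append_badPoints_le (by
          rw [primeList_append (hW s hs)]; exact nodup_primeList _ _) (hl0 _ _)
        (fun u hu => by simpa [window] using hu) (hQ i k hk s hs) hε hε1 rfl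
        (hQ0 i k hk s hs) 0).trans ?_
      refine le_trans ?_ (hbad i k hk s hs)
      rw [card_window, primeList_append (hW s hs)]
      have hdeg : 0 ≤ degErr (primeList (W s + 1) (z - W s)) (h s) (W s) S₁ D M (Y (s + 1)) (Y s)
          (∑ q ∈ Q i k s, 1 / (q : ℝ)) := by
        have := (H s hs).distProb_pos le_rfl
        have := (H s hs).smallErr_nonneg
        have := (H s hs).tailErr_nonneg
        have h0 := (H s hs).hY
        have h1 : 0 < Y (s + 1) := by linarith
        have h2 : 0 < Y s := by linarith [(H s hs).hY₂]
        have := Real.log_pos h0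
        unfold degErr progDensity
        positivity
      have := hQ0 i k hk s hs
      gcongr
    refine (Finset.sum_le_sum h1).trans ?_
    simp only [Finset.sum_const, Finset.card_range, nsmul_eq_mul]
    rcases Nat.eq_zero_or_pos m with rfl | hm
    · simp [hE.le]
    rcases Nat.eq_zero_or_pos B with rfl | hB
    · simp [hE.le]
    refine le_of_eq ?_
    field_simp
  exact exists_forall_le_of_avg_le (hl0 0 (z + 1)) hN hE (fun i β => Nat.cast_nonneg _)
    (fun i β => Finset.sum_nonneg fun _ _ => Finset.sum_nonneg fun _ _ => Nat.cast_nonneg _) hf1 hb1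

theorem exists_subset_sum_near {P : Finset ℕ} {a : ℕ → ℝ} {μ T : ℝ} (ha : ∀ q ∈ P, a q ≤ μ)
    (hμ : 0 ≤ μ) (hT0 : 0 ≤ T) (hT : T ≤ ∑ q ∈ P, a q) :
    ∃ Q ⊆ P, T ≤ ∑ q ∈ Q, a q ∧ ∑ q ∈ Q, a q ≤ T + μ := by
  induction P using Finset.induction_on with
  | empty => exact ⟨∅, by simp, hT, by simpa using add_nonneg hT0 hμ⟩
  | insert q P hq ih =>
    by_cases h : T ≤ ∑ q ∈ P, a q
    · obtain ⟨Q, h1, h2⟩ := ih (fun q hq => ha q (Finset.mem_insert_of_mem hq)) h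
      exact ⟨Q, h1.trans (Finset.subset_insert _ _), h2⟩
    · refine ⟨insert q P, subset_rfl, hT, ?_⟩
      rw [Finset.sum_insert hq]
      linarith [ha q (Finset.mem_insert_self _ _)]

/-- A finite set of small weights can be split into parts with prescribed weights. -/
theorem exists_disjoint_sum_ge {τ : Type*} {a : ℕ → ℝ} {μ : ℝ} (hμ : 0 ≤ μ) (T : τ → ℝ)
    (J : Finset τ) (hT : ∀ j ∈ J, 0 ≤ T j) {P : Finset ℕ} (ha : ∀ q ∈ P, a q ≤ μ)
    (hsum : ∑ j ∈ J, (T j + μ) ≤ ∑ q ∈ P, a q) :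
    ∃ Q : τ → Finset ℕ, (∀ j ∈ J, Q j ⊆ P ∧ T j ≤ ∑ q ∈ Q j, a q) ∧
      ∀ j ∈ J, ∀ j' ∈ J, j ≠ j' → Disjoint (Q j) (Q j') := by
  induction J using Finset.induction_on generalizing P with
  | empty => exact ⟨fun _ => ∅, by simp, by simp⟩
  | insert j J hj ih =>
    rw [Finset.sum_insert hj] at hsum
    have h0 : 0 ≤ ∑ j ∈ J, (T j + μ) := Finset.sum_nonneg fun i hi =>
      add_nonneg (hT i (Finset.mem_insert_of_mem hi)) hμ
    obtain ⟨Q₀, h1, h2, h3⟩ := exists_subset_sum_near ha hμ (hT j (Finset.mem_insert_self _ _))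
      (by linarith)
    have h4 := Finset.sum_sdiff (f := a) h1
    obtain ⟨Q, h5, h6⟩ := ih (fun i hi => hT i (Finset.mem_insert_of_mem hi))
      (P := P \ Q₀) (fun q hq => ha q (Finset.mem_sdiff.1 hq).1) (by linarith)
    have hne : ∀ i ∈ J, i ≠ j := fun i hi h => hj (h ▸ hi)
    have hd : ∀ i ∈ J, Disjoint Q₀ (Q i) := fun i hi =>
      Finset.disjoint_of_subset_right (h5 i hi).1 Finset.disjoint_sdiff
    refine ⟨Function.update Q j Q₀, ?_, ?_⟩
    · intro i hi
      rcases Finset.mem_insert.1 hi with rfl | hi'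
      · rw [Function.update_self]; exact ⟨h1, h2⟩
      · rw [Function.update_of_ne (hne i hi')]
        exact ⟨(h5 i hi').1.trans Finset.sdiff_subset, (h5 i hi').2⟩
    · intro i hi i' hi' hii
      rcases Finset.mem_insert.1 hi with rfl | hiJ <;>
        rcases Finset.mem_insert.1 hi' with rfl | hiJ'
      · exact absurd rfl hii
      · rw [Function.update_self, Function.update_of_ne (hne i' hiJ')]
        exact hd i' hiJ'
      · rw [Function.update_self, Function.update_of_ne (hne i hiJ)]
        exact (hd i hiJ).symm
      · rw [Function.update_of_ne (hne i' hiJ'), Function.update_of_ne (hne i hiJ)]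
        exact h6 i hiJ i' hiJ' hii

/-- The Chinese remainder theorem for finitely many primes. -/
theorem exists_forall_prime_dvd_sub (S : Finset ℕ) (hS : ∀ p ∈ S, p.Prime) (c : ℕ → ℤ) :
    ∃ b : ℤ, ∀ p ∈ S, (p : ℤ) ∣ b - c p := by
  induction S using Finset.induction_on with
  | empty => exact ⟨0, by simp⟩
  | insert p S hp ih =>
    obtain ⟨b, hb⟩ := ih fun q hq => hS q (Finset.mem_insert_of_mem hq)
    have hcop : IsCoprime (∏ q ∈ S, (q : ℤ)) (p : ℤ) := by
      refine IsCoprime.prod_left fun q hq => Nat.isCoprime_iff_coprime.2 ?_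
      exact (Nat.coprime_primes (hS q (Finset.mem_insert_of_mem hq))
        (hS p (Finset.mem_insert_self _ _))).2 fun h => hp (h ▸ hq)
    obtain ⟨u, v, huv⟩ := hcop
    refine ⟨b + u * (∏ q ∈ S, (q : ℤ)) * (c p - b), fun q hq => ?_⟩
    rcases Finset.mem_insert.1 hq with rfl | hq
    · refine ⟨-(v * (c q - b)), ?_⟩
      linear_combination (c q - b) * huv
    · have h1 : (q : ℤ) ∣ ∏ q ∈ S, (q : ℤ) := Finset.dvd_prod_of_mem (fun q : ℕ => (q : ℤ)) hq
      have h2 : b + u * (∏ q ∈ S, (q : ℤ)) * (c p - b) - c q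
          = (b - c q) + (∏ q ∈ S, (q : ℤ)) * (u * (c p - b)) := by ring
      rw [h2]
      exact dvd_add (hb q hq) (dvd_mul_of_dvd_left h1 _)

theorem exists_values_of_card_le {W : Finset ℤ} {T : Finset ℕ} (h : W.card ≤ T.card) :
    ∃ ρ : ℕ → ℤ, ∀ v ∈ W, ∃ p ∈ T, ρ p = v := by
  obtain ⟨f⟩ := Function.Embedding.nonempty_of_card_le (α := W) (β := T) (by simpa using h)
  refine ⟨fun p => if hp : ∃ v : W, (f v : ℕ) = p then (hp.choose : ℤ) else 0, fun v hv => ?_⟩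
  refine ⟨f ⟨v, hv⟩, (f ⟨v, hv⟩).2, ?_⟩
  have hex : ∃ v' : W, (f v' : ℕ) = f ⟨v, hv⟩ := ⟨_, rfl⟩
  simp only [dif_pos hex]
  have := f.injective (Subtype.ext hex.choose_spec)
  rw [this]

theorem degErr_div_le {l : List ℕ} {h y : ℕ} {w S₁ D M Y₁ Y₂ : ℝ}
    (H : BlockData l h y w S₁ D M Y₁ Y₂) {τ R ε : ℝ} (hε : 0 < ε) (hτ : 0 < τ) (hR : τ ≤ R) :
    degErr l h w S₁ D M Y₁ Y₂ R / (ε ^ 2 * R) ≤ degErr l h w S₁ D M Y₁ Y₂ τ / (ε ^ 2 * τ) := by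
  have h1 := H.distProb_pos le_rfl
  have h2 := H.smallErr_nonneg
  have h3 := H.tailErr_nonneg
  have h0 := H.hY
  have h4 : 0 < Y₁ := by linarith
  have h5 : 0 < Y₂ := by linarith [H.hY₂]
  have h6 := Real.log_pos h0
  have hR0 : 0 < R := hτ.trans_le hR
  have key : ∀ R : ℝ, 0 < R → degErr l h w S₁ D M Y₁ Y₂ R / (ε ^ 2 * R) =
      (1 / Y₁ * (distProb l.toFinset h)⁻¹ + progDensity Y₁ Y₂ * smallErr h w S₁) / (ε ^ 2 * R)
        + tailErr D M w / ε ^ 2 := by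
    intro R hR
    unfold degErr
    field_simp
  rw [key R hR0, key τ hτ]
  have h7 : 0 ≤ progDensity Y₁ Y₂ := by unfold progDensity; positivity
  gcongr

/-- The primes in `(a, b]`. -/
noncomputable def primesIoc (a b : ℝ) : Finset ℕ := (Finset.Ioc ⌊a⌋₊ ⌊b⌋₊).filter Nat.Prime

theorem mem_primesIoc {a b : ℝ} (ha : 0 ≤ a) (hb : 0 ≤ b) {p : ℕ} :
    p ∈ primesIoc a b ↔ p.Prime ∧ a < p ∧ (p : ℝ) ≤ b := by
  rw [primesIoc, Finset.mem_filter, Finset.mem_Ioc, Nat.floor_lt ha, Nat.le_floor_iff hb]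
  tauto

/-- All numerical requirements of the construction. -/
structure Params (x : ℝ) (y z m n r : ℕ) (W h : ℕ → ℕ) (Y ρ : ℕ → ℝ)
    (S₁ D M Ω c η t L N E : ℝ) : Prop where
  hW : ∀ s < 116, W s ≤ z
  block : ∀ s < 116,
    BlockData (primeList (W s + 1) (z - W s)) (h s) y (W s) S₁ D M (Y (s + 1)) (Y s)
  hzY : ∀ s < 116, (z : ℝ) ≤ Y (s + 1)
  anti : Antitone Y
  hY0 : Y 0 ≤ x
  hr1 : 1 ≤ r
  hr : ∀ s < 116, h s ≤ r
  hy : ∀ s < 116, (y : ℝ) ≤ Y (s + 1) ^ 2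
  hn : ∀ s < 116, Y s ≤ n
  hΩ : ∀ s < 116, (distProb (primeList (W s + 1) (z - W s)).toFinset (h s))⁻¹ / Y (s + 1) ≤ Ω
  hΩ0 : 0 ≤ Ω
  hy0 : 0 < y
  hcΩ : Ω * ((9 / 10 : ℝ) ^ (m * r))⁻¹ ≤ c
  hcY : 1 / (y : ℝ) * ((9 / 10 : ℝ) ^ m)⁻¹ ≤ c
  hc1 : c ≤ 1
  hrc : r * c ≤ 1 / 2
  ht : 0 ≤ t
  hη : 2 * n * (r * c) ^ 2 ≤ η
  hη1 : η ≤ 1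
  hfin : (1 / 9) * (1 + m * t) ≤ (7 / 60) * (1 - m * η) - m * t * ((9 / 10 : ℝ) ^ m)⁻¹
  hL0 : 0 < L
  hL : L * (2 * r * c) ≤ 1
  hsmall : 2 * (m * n + m * y + 1) * Real.exp (n * (L * (2 * r * c)) ^ 2 - L * t) < 1
  hρ0 : ∀ s < 116, 0 < ρ s
  hρ : ∀ s < 116, ρ s ≤ ∑ q ∈ primesIoc (Y (s + 1)) (Y s), 1 / (q : ℝ)
  hρm : ∀ s < 116, 200 * m ≤ ρ s * Y (s + 1)
  hρσ : ∀ s < 116, 22 / 1000 * distProb (primeList (W s + 1) (z - W s)).toFinset 1 ≤ ρ s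
  hN : 0 < N
  hE : 0 < E
  hyN : y * distProb (primeList 0 (z + 1)).toFinset 1 ≤ N
  hbad : ∀ s < 116,
    N * (degErr (primeList (W s + 1) (z - W s)) (h s) (W s) S₁ D M (Y (s + 1)) (Y s)
        (99 / 2000 * ρ s * (9 / 10) ^ m) / ((1 / 100) ^ 2 * (99 / 2000 * ρ s * (9 / 10) ^ m)))
      + 2 * h s * Y s * massErr (primeList (W s + 1) (z - W s)) (h s) (W s) S₁ D M (Y (s + 1))
        * distProb (primeList (W s + 1) (z - W s)).toFinset 1 / (1 / 100) ^ 3 ≤ E / (m * 116)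
  hfinal : 2 * ((9 / 10) ^ m * (8 * N + m * t * y) + 8 * E) ≤ (primesIoc (Y 0) x).card

variable {x : ℝ} {y z m n r : ℕ} {W h : ℕ → ℕ} {Y ρ : ℕ → ℝ} {S₁ D M Ω c η t L N E : ℝ}

theorem Params.pos (H : Params x y z m n r W h Y ρ S₁ D M Ω c η t L N E) {s : ℕ} (hs : s ≤ 116) :
    0 < Y s :=
  lt_of_lt_of_le (by linarith [(H.block 115 (by norm_num)).hY]) (H.anti hs)

theorem geom_sum_le (m : ℕ) : ∑ k ∈ Finset.range m, (9 / 10 : ℝ) ^ k ≤ 10 := by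
  rw [geom_sum_eq (by norm_num)]
  have : (0 : ℝ) < (9 / 10) ^ m := by positivity
  rw [div_le_iff_of_neg (by norm_num)]
  linarith

theorem Params.exists_split (H : Params x y z m n r W h Y ρ S₁ D M Ω c η t L N E) :
    ∃ Q : Bool → ℕ → ℕ → Finset ℕ,
      (∀ i, ∀ k < m, ∀ s < 116, ∀ q ∈ Q i k s, q.Prime ∧ Y (s + 1) < q ∧ (q : ℝ) ≤ Y s) ∧
      (∀ i, ∀ k < m, ∀ s < 116, 99 / 2000 * ρ s * (9 / 10) ^ k ≤ ∑ q ∈ Q i k s, 1 / (q : ℝ)) ∧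
      ∀ i i', ∀ k < m, ∀ k' < m, ∀ s < 116, ∀ s' < 116, ∀ q, q ∈ Q i k s → q ∈ Q i' k' s' →
        i = i' ∧ k = k' ∧ s = s' := by
  have hex : ∀ s, ∃ Q : Bool × ℕ → Finset ℕ, s < 116 →
      (∀ j ∈ (Finset.univ : Finset Bool) ×ˢ Finset.range m, Q j ⊆ primesIoc (Y (s + 1)) (Y s) ∧
        99 / 2000 * ρ s * (9 / 10) ^ j.2 ≤ ∑ q ∈ Q j, 1 / (q : ℝ)) ∧
      ∀ j ∈ (Finset.univ : Finset Bool) ×ˢ Finset.range m,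
        ∀ j' ∈ (Finset.univ : Finset Bool) ×ˢ Finset.range m, j ≠ j' → Disjoint (Q j) (Q j') := by
    intro s
    by_cases hs : s < 116
    · have hρ0 := H.hρ0 s hs
      have hY1 := H.pos (s := s + 1) (by omega)
      have hY2 := H.pos (s := s) (by omega)
      obtain ⟨Q, hQ⟩ := exists_disjoint_sum_ge (a := fun q => 1 / (q : ℝ)) (μ := 1 / Y (s + 1))
        (by positivity) (fun j : Bool × ℕ => 99 / 2000 * ρ s * (9 / 10) ^ j.2)
        ((Finset.univ : Finset Bool) ×ˢ Finset.range m) (fun j _ => by positivity)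
        (P := primesIoc (Y (s + 1)) (Y s)) (fun q hq => by
          have := ((mem_primesIoc hY1.le hY2.le).1 hq).2.1
          gcongr) (by
          refine le_trans ?_ (H.hρ s hs)
          rw [Finset.sum_product]
          simp only [Finset.sum_const, Finset.card_univ, Fintype.card_bool, nsmul_eq_mul]
          rw [Finset.sum_add_distrib, ← Finset.mul_sum]
          have h1 := geom_sum_le m
          have h2 := H.hρm s hs
          rw [← div_le_iff₀ hY1] at h2
          simp only [Finset.sum_const, Finset.card_range, nsmul_eq_mul]
          push_cast
          have h3 : 99 / 2000 * ρ s * ∑ i ∈ Finset.range m, (9 / 10 : ℝ) ^ i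
              ≤ 99 / 2000 * ρ s * 10 := by gcongr
          have h4 : 200 * (m : ℝ) / Y (s + 1) = 200 * (m * (1 / Y (s + 1))) := by ring
          linarith)
      exact ⟨Q, fun _ => hQ⟩
    · exact ⟨fun _ => ∅, fun h => absurd h hs⟩
  choose Q hQ using hex
  have hmem : ∀ (i : Bool) k, k < m → (i, k) ∈ (Finset.univ : Finset Bool) ×ˢ Finset.range m :=
    fun i k hk => by simp [hk]
  have hQ1 : ∀ i : Bool, ∀ k < m, ∀ s < 116, ∀ q ∈ Q s (i, k),
      q.Prime ∧ Y (s + 1) < q ∧ (q : ℝ) ≤ Y s := by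
    intro i k hk s hs q hq
    exact (mem_primesIoc (H.pos (by omega)).le (H.pos (by omega)).le).1
      (((hQ s hs).1 _ (hmem i k hk)).1 hq)
  refine ⟨fun i k s => Q s (i, k), hQ1, fun i k hk s hs => ((hQ s hs).1 _ (hmem i k hk)).2, ?_⟩
  intro i i' k hk k' hk' s hs s' hs' q hq hq'
  have h1 := hQ1 i k hk s hs q hq
  have h2 := hQ1 i' k' hk' s' hs' q hq'
  have hss : s = s' := by
    rcases lt_trichotomy s s' with hlt | heq | hlt
    · have := H.anti (show s + 1 ≤ s' by omega)
      linarith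
    · exact heq
    · have := H.anti (show s' + 1 ≤ s by omega)
      linarith
  subst hss
  by_contra hne
  have h3 : (i, k) ≠ (i', k') := fun h => hne ⟨(Prod.mk.inj h).1, (Prod.mk.inj h).2, rfl⟩
  exact Finset.disjoint_left.1 ((hQ s hs).2 _ (hmem i k hk) _ (hmem i' k' hk') h3) hq hq'

end SieveGap

namespace SieveGap

variable {x : ℝ} {y z m n r : ℕ} {W h : ℕ → ℕ} {Y ρ : ℕ → ℝ} {S₁ D M Ω c η t L N E : ℝ}

theorem Params.hbad_of_sum_ge (H : Params x y z m n r W h Y ρ S₁ D M Ω c η t L N E) {k s : ℕ}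
    (hk : k < m) (hs : s < 116) {R : ℝ} (hR : 99 / 2000 * ρ s * (9 / 10) ^ k ≤ R) :
    N * degErr (primeList (W s + 1) (z - W s)) (h s) (W s) S₁ D M (Y (s + 1)) (Y s) R
        / ((1 / 100) ^ 2 * R)
      + 2 * h s * Y s * massErr (primeList (W s + 1) (z - W s)) (h s) (W s) S₁ D M (Y (s + 1))
        * distProb (primeList (W s + 1) (z - W s)).toFinset 1 / (1 / 100) ^ 3
        ≤ E / (m * (116 : ℕ)) := by
  have hρ := H.hρ0 s hs
  have h1 : (9 / 10 : ℝ) ^ m ≤ (9 / 10) ^ k :=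
    pow_le_pow_of_le_one (by norm_num) (by norm_num) hk.le
  have h2 : 99 / 2000 * ρ s * (9 / 10) ^ m ≤ R := le_trans (by gcongr) hR
  have h3 := degErr_div_le (H.block s hs) (ε := 1 / 100) (by norm_num)
    (show 0 < 99 / 2000 * ρ s * (9 / 10) ^ m by positivity) h2
  have h4 := mul_le_mul_of_nonneg_left h3 H.hN.le
  rw [mul_div_assoc]
  have := H.hbad s hs
  push_cast
  linarith

theorem Params.hdeg_of_sum_ge (H : Params x y z m n r W h Y ρ S₁ D M Ω c η t L N E)
    {Q : ℕ → ℕ → Finset ℕ}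
    (hQ : ∀ k < m, ∀ s < 116, 99 / 2000 * ρ s * (9 / 10) ^ k ≤ ∑ q ∈ Q k s, 1 / (q : ℝ))
    {k : ℕ} (hk : k < m) :
    7 / 60 * (9 / 10 : ℝ) ^ k ≤ (1 - 2 * (1 / 100)) / (1 + 1 / 100) *
      ∑ s ∈ Finset.range 116, (∑ q ∈ Q k s, 1 / (q : ℝ))
        / distProb (primeList (W s + 1) (z - W s)).toFinset 1 := by
  have h1 : ∀ s ∈ Finset.range 116, 99 / 2000 * (22 / 1000) * (9 / 10 : ℝ) ^ k
      ≤ (∑ q ∈ Q k s, 1 / (q : ℝ)) / distProb (primeList (W s + 1) (z - W s)).toFinset 1 := by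
    intro s hs
    have hs := Finset.mem_range.1 hs
    have hd : 0 < distProb (primeList (W s + 1) (z - W s)).toFinset 1 := by
      exact_mod_cast (H.block s hs).distProb_pos (t := 1) (by exact_mod_cast (H.block s hs).hh)
    rw [le_div_iff₀ hd]
    refine le_trans ?_ (hQ k hk s hs)
    have := H.hρσ s hs
    have hp : (0 : ℝ) < (9 / 10) ^ k := by positivity
    nlinarith
  have h2 := Finset.sum_le_sum h1
  rw [Finset.sum_const, Finset.card_range, nsmul_eq_mul] at h2
  have hp : (0 : ℝ) < (9 / 10) ^ k := by positivity
  push_cast at h2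
  norm_num at h2 ⊢
  linarith

theorem Params.exists_cover (H : Params x y z m n r W h Y ρ S₁ D M Ω c η t L N E) (A : Bool → ℤ) :
    ∃ a : ℕ → ℤ, ∀ i, ∀ v ∈ window (A i) y, ∃ p : ℕ, p.Prime ∧ (p : ℝ) ≤ x ∧ (p : ℤ) ∣ v - a p := by
  obtain ⟨Q, hQ, hQs, hQd⟩ := H.exists_split
  have hQpos : ∀ i, ∀ k < m, ∀ s < 116, 0 < ∑ q ∈ Q i k s, 1 / (q : ℝ) := fun i k hk s hs =>
    lt_of_lt_of_le (by have := H.hρ0 s hs; positivity) (hQs i k hk s hs)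
  obtain ⟨β, hβ⟩ := exists_sieve (A := A) (ε := 1 / 100) H.hW H.block hQ (by norm_num) (by norm_num)
    H.hN H.hE H.hyN hQpos (fun i k hk s hs => H.hbad_of_sum_ge hk hs (hQs i k hk s hs))
  have hround : ∀ i, ∃ ρ' : ℕ → ℤ, ((((window (A i) y).filter
      (Surv (primeList 0 (z + 1)) β)).filter fun v => ∀ k < m, ∀ s < 116, ∀ q ∈ Q i k s,
        ¬ (q : ℤ) ∣ v - ρ' q).card : ℝ) ≤ (9 / 10) ^ m * (8 * N + m * t * y) + 8 * E := by
    intro i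
    have hR : RoundData 116 m y n r (A i) (fun s => primeList (W s + 1) (z - W s)) h
        (fun s => (W s : ℝ)) Y S₁ D M Ω
        (fun s => (window (A i) y).filter (Surv (primeList 0 (W s + 1)) β)) (Q i) :=
      { block := H.block
        hU := fun s _ u hu => by
          have := (Finset.mem_filter.1 hu).1
          simpa [window] using this
        hQ := hQ i
        hQd := fun k hk k' hk' s hs s' hs' q h1 h2 =>
          (hQd i i k hk k' hk' s hs s' hs' q h1 h2).2
        hr1 := H.hr1
        hr := H.hr
        hy := H.hy
        hn := H.hn
        hΩ := H.hΩ
        hΩ0 := H.hΩ0 }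
    have hVy : (((window (A i) y).filter (Surv (primeList 0 (z + 1)) β)).card : ℝ) ≤ y := by
      have := Finset.card_filter_le (window (A i) y) (Surv (primeList 0 (z + 1)) β)
      rw [card_window] at this
      exact_mod_cast this
    obtain ⟨ρ', hρ'⟩ := hR.exists_residues (β := β)
      (V := (window (A i) y).filter (Surv (primeList 0 (z + 1)) β)) (by
        intro v hv s hs
        rw [Finset.mem_filter, ← primeList_append (H.hW s hs), surv_append] at hv
        exact ⟨Finset.mem_filter.2 ⟨hv.1, hv.2.1⟩, hv.2.2⟩) H.hy0 (ε := 1 / 100) (κ := 9 / 10)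
      (g := 7 / 60) (by norm_num) (by norm_num) (by norm_num) H.hcΩ H.hcY H.hc1 H.hrc H.ht
      (by norm_num) H.hη H.hη1 (by have := H.hfin; norm_num at this ⊢; linarith) H.hL0 H.hL
      (lt_of_le_of_lt (by gcongr) H.hsmall) (fun k hk => H.hdeg_of_sum_ge (hQs i) hk)
    refine ⟨ρ', hρ'.trans ?_⟩
    have h1 := (hβ i).1
    have h2 := (hβ i).2
    gcongr
  choose ρ' hρ' using hround
  let Wl : Bool → Finset ℤ := fun i => ((window (A i) y).filter
      (Surv (primeList 0 (z + 1)) β)).filter fun v => ∀ k < m, ∀ s < 116, ∀ q ∈ Q i k s,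
        ¬ (q : ℤ) ∣ v - ρ' i q
  have hWl : (Wl true ∪ Wl false).card ≤ (primesIoc (Y 0) x).card := by
    have h1 : ((Wl true ∪ Wl false).card : ℝ) ≤ (Wl true).card + (Wl false).card := by
      exact_mod_cast Finset.card_union_le _ _
    have h2 := hρ' true
    have h3 := hρ' false
    have h4 := H.hfinal
    have h5 : ((Wl true ∪ Wl false).card : ℝ) ≤ (primesIoc (Y 0) x).card := by
      refine h1.trans (le_trans ?_ h4)
      rw [two_mul]
      exact add_le_add h2 h3
    exact_mod_cast h5
  obtain ⟨θ, hθ⟩ := exists_values_of_card_le hWl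
  let mem : Bool → ℕ → Prop := fun i p => ∃ k < m, ∃ s < 116, p ∈ Q i k s
  refine ⟨fun p => if p ≤ z then β p else if mem true p then ρ' true p else
    if mem false p then ρ' false p else θ p, ?_⟩
  have hzY0 : (z : ℝ) ≤ Y 0 := (H.hzY 0 (by norm_num)).trans (H.anti (by norm_num))
  have hzx : (z : ℝ) ≤ x := hzY0.trans H.hY0
  have hmem : ∀ i p, mem i p → p.Prime ∧ ¬ p ≤ z ∧ (p : ℝ) ≤ Y 0 := by
    rintro i p ⟨k, hk, s, hs, hp⟩
    obtain ⟨h1, h2, h3⟩ := hQ i k hk s hs p hp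
    refine ⟨h1, fun h4 => ?_, h3.trans (H.anti (Nat.zero_le s))⟩
    have h5 : (p : ℝ) ≤ z := by exact_mod_cast h4
    linarith [H.hzY s hs]
  intro i v hv
  by_cases hS : Surv (primeList 0 (z + 1)) β v
  · by_cases hl : ∀ k < m, ∀ s < 116, ∀ q ∈ Q i k s, ¬ (q : ℤ) ∣ v - ρ' i q
    · have hvW : v ∈ Wl true ∪ Wl false := by
        have hvi : v ∈ Wl i := Finset.mem_filter.2 ⟨Finset.mem_filter.2 ⟨hv, hS⟩, hl⟩
        cases i
        · exact Finset.mem_union_right _ hvi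
        · exact Finset.mem_union_left _ hvi
      obtain ⟨p, hp, hpv⟩ := hθ v hvW
      have hY0 := H.pos (s := 0) (by norm_num)
      obtain ⟨hp1, hp2, hp3⟩ := (mem_primesIoc hY0.le (hY0.le.trans H.hY0)).1 hp
      refine ⟨p, hp1, hp3, ?_⟩
      have h1 : ¬ p ≤ z := fun h => by
        have : (p : ℝ) ≤ z := by exact_mod_cast h
        linarith
      have h2 : ∀ i, ¬ mem i p := fun i hi => by linarith [(hmem i p hi).2.2]
      simp only [if_neg h1, if_neg (h2 _), hpv, sub_self, dvd_zero]
    · push Not at hl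
      obtain ⟨k, hk, s, hs, q, hq, hqv⟩ := hl
      have hqi : mem i q := ⟨k, hk, s, hs, hq⟩
      obtain ⟨h1, h2, h3⟩ := hmem i q hqi
      refine ⟨q, h1, h3.trans H.hY0, ?_⟩
      cases i
      · have h4 : ¬ mem true q := by
          rintro ⟨k', hk', s', hs', hq'⟩
          exact Bool.noConfusion (hQd _ _ k hk k' hk' s hs s' hs' q hq hq').1
        simpa only [if_neg h2, if_neg h4, if_pos hqi] using hqv
      · simpa only [if_neg h2, if_pos hqi] using hqv
  · unfold Surv at hS
    push Not at hS
    obtain ⟨p, hp, hpv⟩ := hS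
    obtain ⟨h1, -, h2⟩ := mem_primeList.1 hp
    have h3 : p ≤ z := by omega
    refine ⟨p, h1, le_trans (by exact_mod_cast h3) hzx, ?_⟩
    simpa only [if_pos h3] using hpv

theorem Params.exists_int (H : Params x y z m n r W h Y ρ S₁ D M Ω c η t L N E) (K : ℤ) :
    ∃ b : ℤ,
      (∀ n : ℤ, 1 ≤ n → n ≤ (y : ℤ) → ∃ p : ℕ, p.Prime ∧ (p : ℝ) ≤ x ∧ (p : ℤ) ∣ (n - b)) ∧
      (∀ n : ℤ, -(y : ℤ) ≤ n → n ≤ -1 → ∃ p : ℕ, p.Prime ∧ (p : ℝ) ≤ x ∧ (p : ℤ) ∣ (n + K + b)) := by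
  obtain ⟨a, ha⟩ := H.exists_cover fun i => if i then 1 else 1 - K
  obtain ⟨b, hb⟩ := exists_forall_prime_dvd_sub
    ((Finset.range (⌊x⌋₊ + 1)).filter Nat.Prime) (fun p hp => (Finset.mem_filter.1 hp).2) a
  have hb' : ∀ p : ℕ, p.Prime → (p : ℝ) ≤ x → (p : ℤ) ∣ b - a p := fun p hp hpx =>
    hb p (Finset.mem_filter.2 ⟨Finset.mem_range.2 (Nat.lt_succ_of_le (Nat.le_floor hpx)), hp⟩)
  refine ⟨b, fun n h1 h2 => ?_, fun n h1 h2 => ?_⟩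
  · obtain ⟨p, hp, hpx, hd⟩ := ha true n (by simp [window]; omega)
    refine ⟨p, hp, hpx, ?_⟩
    have := dvd_sub hd (hb' p hp hpx)
    rwa [sub_sub_sub_cancel_right] at this
  · obtain ⟨p, hp, hpx, hd⟩ := ha false (-n - K) (by simp [window]; omega)
    refine ⟨p, hp, hpx, ?_⟩
    have h3 := dvd_neg.2 (dvd_sub hd (hb' p hp hpx))
    have h4 : -(-n - K - a p - (b - a p)) = n + K + b := by ring
    rwa [h4] at h3

end SieveGap

namespace SieveGap

theorem toFinset_primeList_eq_primesIoc {W z : ℕ} (h : W ≤ z) :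
    (primeList (W + 1) (z - W)).toFinset = primesIoc W z := by
  ext p
  rw [List.mem_toFinset, mem_primeList, mem_primesIoc (by positivity) (by positivity)]
  norm_cast
  refine and_congr_right fun _ => ?_
  omega

theorem distProb_one_le_exp {P : Finset ℕ} (hP : ∀ p ∈ P, p.Prime) :
    distProb P 1 ≤ Real.exp (-∑ p ∈ P, 1 / (p : ℝ)) := by
  rw [distProb, ← Finset.sum_neg_distrib, Real.exp_sum]
  refine Finset.prod_le_prod (fun p hp => ?_) fun p _ => ?_
  · have : (1 : ℝ) ≤ p := by exact_mod_cast (hP p hp).one_le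
    rw [sub_nonneg, div_le_one (by linarith)]
    exact_mod_cast this
  · push_cast
    linarith [Real.add_one_le_exp (-(1 / (p : ℝ)))]

theorem inv_distProb_le_exp {P : Finset ℕ} {t : ℕ} (hP : ∀ p ∈ P, 0 < p ∧ 2 * t ≤ p) :
    (distProb P t)⁻¹ ≤ Real.exp (2 * t * ∑ p ∈ P, 1 / (p : ℝ)) := by
  rw [distProb, ← Finset.prod_inv_distrib, Finset.mul_sum, Real.exp_sum]
  have key : ∀ p ∈ P, 0 ≤ (t : ℝ) / p ∧ (t : ℝ) / p ≤ 1 / 2 := by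
    intro p hp
    have h1 : (0 : ℝ) < p := by exact_mod_cast (hP p hp).1
    have h2 : 2 * (t : ℝ) ≤ p := by exact_mod_cast (hP p hp).2
    refine ⟨by positivity, ?_⟩
    rw [div_le_iff₀ h1]
    linarith
  refine Finset.prod_le_prod (fun p hp => ?_) fun p hp => ?_
  · have := key p hp
    rw [inv_nonneg]
    linarith
  · obtain ⟨h1, h2⟩ := key p hp
    have h3 : 2 * (t : ℝ) * (1 / (p : ℝ)) = 2 * (t / p) := by ring
    rw [h3]
    generalize (t : ℝ) / p = u at h1 h2
    refine le_trans ?_ (Real.add_one_le_exp _)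
    rw [inv_le_iff_one_le_mul₀ (by linarith)]
    nlinarith

theorem exists_distProb_primesIoc_le : ∃ C > 0, ∀ w z : ℝ, 2 ≤ w → w ≤ z →
    distProb (primesIoc w z) 1 ≤ Real.log w / Real.log z * Real.exp (C / Real.log w) := by
  obtain ⟨C, hC, h⟩ := exists_abs_sum_inv_prime_sub_loglog_le
  refine ⟨C, hC, fun w z hw hz => ?_⟩
  have h1 := (abs_le.1 (h w z hw hz)).1
  have h2 : 0 < Real.log w := Real.log_pos (by linarith)
  have h3 : 0 < Real.log z := Real.log_pos (by linarith)
  refine (distProb_one_le_exp fun p hp => (Finset.mem_filter.1 hp).2).trans ?_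
  have h4 : Real.log w / Real.log z = Real.exp (-Real.log (Real.log z / Real.log w)) := by
    rw [Real.exp_neg, Real.exp_log (by positivity), inv_div]
  rw [h4, ← Real.exp_add]
  refine Real.exp_le_exp.2 ?_
  linarith

theorem exists_sum_primesIoc_le : ∃ C > 0, ∀ w z : ℝ, 2 ≤ w → w ≤ z →
    Real.log (Real.log z / Real.log w) - C / Real.log w ≤ ∑ p ∈ primesIoc w z, 1 / (p : ℝ) ∧
    ∑ p ∈ primesIoc w z, 1 / (p : ℝ) ≤ Real.log (Real.log z / Real.log w) + C / Real.log w := by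
  obtain ⟨C, hC, h⟩ := exists_abs_sum_inv_prime_sub_loglog_le
  refine ⟨C, hC, fun w z hw hz => ?_⟩
  have h1 := abs_le.1 (h w z hw hz)
  unfold primesIoc
  constructor <;> linarith

theorem exists_distProb_primeList_le : ∃ C > 0, ∀ z : ℕ, 2 ≤ z →
    distProb (primeList 0 (z + 1)).toFinset 1 ≤ C / Real.log z := by
  obtain ⟨C, hC, h⟩ := exists_distProb_primesIoc_le
  have hl2 : 0 < Real.log 2 := Real.log_pos (by norm_num)
  refine ⟨Real.log 2 * Real.exp (C / Real.log 2), by positivity, fun z hz => ?_⟩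
  have h2z : (2 : ℝ) ≤ z := by exact_mod_cast hz
  have h1 := h 2 z le_rfl h2z
  have hsub : primesIoc 2 z ⊆ (primeList 0 (z + 1)).toFinset := by
    intro p hp
    obtain ⟨h1, -, h2⟩ := (mem_primesIoc (by norm_num) (by positivity)).1 hp
    rw [List.mem_toFinset, mem_primeList]
    have h3 : p ≤ z := by exact_mod_cast h2
    exact ⟨h1, by omega, by omega⟩
  have hle : distProb (primeList 0 (z + 1)).toFinset 1 ≤ distProb (primesIoc 2 z) 1 := by
    refine Finset.prod_le_prod_of_subset_of_le_one hsub (fun p hp => ?_) fun p _ _ => ?_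
    · rw [List.mem_toFinset, mem_primeList] at hp
      have : (1 : ℝ) ≤ p := by exact_mod_cast hp.1.one_le
      rw [sub_nonneg, div_le_one (by linarith)]
      exact_mod_cast this
    · have : 0 ≤ ((1 : ℕ) : ℝ) / (p : ℝ) := by positivity
      linarith
  calc _ ≤ _ := hle.trans h1
    _ = _ := by ring

theorem exists_le_card_primesIoc : ∃ K ≥ 1, ∀ x : ℝ, K ≤ x → 1 < x →
    x / (K * Real.log x) ≤ (primesIoc (x / K) x).card := by
  obtain ⟨C, hC, h⟩ := exists_abs_sum_primeLogDiv_sub_log_le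
  have hK : 1 ≤ Real.exp (2 * C + 1) := Real.one_le_exp (by positivity)
  refine ⟨Real.exp (2 * C + 1), hK, fun x hx hx1 => ?_⟩
  generalize hKdef : Real.exp (2 * C + 1) = K at *
  have hx0 : 0 < x := by linarith
  have hK0 : 0 < K := by linarith
  have hxK : 1 ≤ x / K := by rwa [le_div_iff₀ hK0, one_mul]
  have h1 := (abs_le.1 (h x hx1.le)).1
  have h2 := (abs_le.1 (h (x / K) hxK)).2
  have hlog : Real.log (x / K) = Real.log x - (2 * C + 1) := by
    rw [Real.log_div hx0.ne' hK0.ne', ← hKdef, Real.log_exp]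
  have hle : ⌊x / K⌋₊ ≤ ⌊x⌋₊ := Nat.floor_mono (div_le_self hx0.le hK)
  have hsplit : ∑ k ∈ Finset.Icc 0 ⌊x⌋₊, primeLogDiv k
      = ∑ k ∈ Finset.Icc 0 ⌊x / K⌋₊, primeLogDiv k
        + ∑ k ∈ Finset.Ioc ⌊x / K⌋₊ ⌊x⌋₊, primeLogDiv k := by
    rw [← Finset.sum_union]
    · congr 1
      ext k
      simp only [Finset.mem_Icc, Finset.mem_union, Finset.mem_Ioc]
      omega
    · rw [Finset.disjoint_left]
      intro k hk hk'
      simp only [Finset.mem_Icc, Finset.mem_Ioc] at hk hk'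
      omega
  have hbig : 1 ≤ ∑ k ∈ Finset.Ioc ⌊x / K⌋₊ ⌊x⌋₊, primeLogDiv k := by linarith
  have hfil : ∑ k ∈ Finset.Ioc ⌊x / K⌋₊ ⌊x⌋₊, primeLogDiv k
      = ∑ p ∈ primesIoc (x / K) x, Real.log p / p := by
    rw [primesIoc, Finset.sum_filter]
    rfl
  have hlx := Real.log_pos hx1
  have hub : ∑ p ∈ primesIoc (x / K) x, Real.log p / p
      ≤ ∑ p ∈ primesIoc (x / K) x, K * Real.log x / x := by
    refine Finset.sum_le_sum fun p hp => ?_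
    obtain ⟨h1, h2, h3⟩ := (mem_primesIoc (by positivity) hx0.le).1 hp
    have h4 : (0 : ℝ) < p := by exact_mod_cast h1.pos
    rw [div_lt_iff₀ hK0] at h2
    rw [div_le_div_iff₀ h4 hx0]
    have h5 := Real.log_le_log h4 h3
    have h6 : 0 ≤ Real.log p := Real.log_natCast_nonneg p
    nlinarith
  rw [Finset.sum_const, nsmul_eq_mul] at hub
  rw [div_le_iff₀ (by positivity)]
  rw [hfil] at hbig
  have h7 : (1 : ℝ) ≤ (primesIoc (x / K) x).card * (K * Real.log x / x) := hbig.trans hub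
  rw [← mul_div_assoc, le_div_iff₀ hx0] at h7
  linarith

/-- The exponents governing the scales of the construction. -/
noncomputable def scaleExp (δ : ℝ) (s : ℕ) : ℝ := 5 / 2 * δ * (11 / 10) ^ s

theorem scaleExp_succ (δ : ℝ) (s : ℕ) : scaleExp δ (s + 1) = 11 / 10 * scaleExp δ s := by
  unfold scaleExp
  ring

theorem scaleExp_mono {δ : ℝ} (hδ : 0 < δ) : Monotone (scaleExp δ) := by
  refine monotone_nat_of_le_succ fun s => ?_
  have : 0 < scaleExp δ s := by unfold scaleExp; positivity
  rw [scaleExp_succ]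
  linarith

theorem le_scaleExp {δ : ℝ} (hδ : 0 < δ) (s : ℕ) : 5 / 2 * δ ≤ scaleExp δ s := by
  simpa [scaleExp] using scaleExp_mono hδ (Nat.zero_le s)

theorem scaleExp_le_half {δ : ℝ} (hδ0 : 0 < δ)
    (hδ : 12 * (10 : ℝ) ^ (2 * δ) < Real.log (1 / (2 * δ))) {s : ℕ} (hs : s ≤ 116) :
    scaleExp δ s ≤ 1 / 2 := by
  refine (scaleExp_mono hδ0 hs).trans ?_
  have h1 : (1 : ℝ) ≤ 10 ^ (2 * δ) := Real.one_le_rpow (by norm_num) (by positivity)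
  have h2 : 12 < Real.log (1 / (2 * δ)) := by linarith
  rw [Real.lt_log_iff_exp_lt (by positivity)] at h2
  have h3 : Real.exp 12 = Real.exp 1 ^ 12 := by rw [← Real.exp_nat_mul]; norm_num
  have h4 : (2.71828 : ℝ) ^ 12 ≤ Real.exp 1 ^ 12 := by
    have := Real.exp_one_gt_d9
    gcongr
    linarith
  have h5 : (2.71828 : ℝ) ^ 12 < 1 / (2 * δ) := by linarith
  rw [lt_div_iff₀ (by positivity)] at h5
  unfold scaleExp
  norm_num at h5 ⊢
  linarith

/-- `x` is large in terms of `K` and `δ`. -/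
structure Large (K δ x : ℝ) : Prop where
  hδ : 0 < δ
  hK : 1000 ≤ K
  pos : 0 < x
  log_gt : 1 < Real.log x
  loglog : K ≤ Real.log (Real.log x)
  pow : K * Real.log (Real.log x) ^ 3 ≤ Real.log x ^ (δ / 10)
  sqrt : K * Real.log (Real.log x) ^ 2 * Real.log x ^ (1 / 2 : ℝ) ≤ Real.log x

theorem eventually_large {K δ : ℝ} (hδ : 0 < δ) (hK : 1000 ≤ K) :
    ∀ᶠ x in Filter.atTop, Large K δ x := by
  have hK0 : 0 < K := by linarith
  have hlog := Real.tendsto_log_atTop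
  have key : ∀ (n : ℕ) {a : ℝ}, 0 < a → ∀ᶠ u : ℝ in Filter.atTop, K * Real.log u ^ n ≤ u ^ a := by
    intro n a ha
    have := (isLittleO_log_rpow_rpow_atTop (n : ℝ) ha).bound (c := 1 / K) (by positivity)
    filter_upwards [this, Filter.eventually_ge_atTop 1] with u hu hu1
    have h0 := Real.log_nonneg hu1
    rw [Real.rpow_natCast, Real.norm_of_nonneg (by positivity),
      Real.norm_of_nonneg (by positivity)] at hu
    rw [one_div, inv_mul_eq_div, le_div_iff₀ hK0] at hu
    linarith
  filter_upwards [Filter.eventually_gt_atTop 0, (hlog.comp hlog).eventually_ge_atTop K,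
    hlog.eventually (key 3 (show 0 < δ / 10 by positivity)),
    hlog.eventually (key 2 (show (0 : ℝ) < 1 / 2 by norm_num)), hlog.eventually_gt_atTop 1]
    with x h1 h2 h3 h4 h5
  refine ⟨hδ, hK, h1, h5, h2, h3, ?_⟩
  calc _ ≤ Real.log x ^ (1 / 2 : ℝ) * Real.log x ^ (1 / 2 : ℝ) := by gcongr
    _ = Real.log x := by rw [← Real.rpow_add (by linarith)]; norm_num

/-- The end points of the prime ranges. -/
noncomputable def cutoff (δ x : ℝ) (s : ℕ) : ℝ := x * Real.log x ^ (δ - scaleExp δ s)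

/-- The lengths of the progressions. -/
noncomputable def blockLen (δ x : ℝ) (s : ℕ) : ℕ := ⌊Real.log x ^ scaleExp δ (s + 1)⌋₊ + 3

namespace Large
variable {K δ x : ℝ}

theorem logloglarge (H : Large K δ x) : 1000 ≤ Real.log (Real.log x) := H.hK.trans H.loglog

theorem log_rpow_eq (H : Large K δ x) (a : ℝ) :
    Real.log x ^ a = Real.exp (a * Real.log (Real.log x)) := by
  rw [Real.rpow_def_of_pos (by linarith [H.log_gt]), mul_comm]

theorem rpow_eq (H : Large K δ x) (a : ℝ) : x ^ a = Real.exp (a * Real.log x) := by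
  rw [Real.rpow_def_of_pos H.pos, mul_comm]

theorem one_le_sqrt (H : Large K δ x) : 1 ≤ Real.log x ^ (1 / 2 : ℝ) :=
  Real.one_le_rpow H.log_gt.le (by norm_num)

theorem loglog_le (H : Large K δ x) :
    K * Real.log (Real.log x) * Real.log x ^ (1 / 2 : ℝ) ≤ Real.log x / 1000 := by
  have h1 := H.sqrt
  have h2 := H.logloglarge
  have h3 := H.one_le_sqrt
  have h4 := H.hK
  have h5 : 0 ≤ K * Real.log (Real.log x) * Real.log x ^ (1 / 2 : ℝ) := by positivity
  nlinarith

theorem const_mul_sqrt_le (H : Large K δ x) : K * Real.log x ^ (1 / 2 : ℝ) ≤ Real.log x / 1000 := by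
  refine le_trans ?_ H.loglog_le
  have h2 := H.logloglarge
  have h3 := H.one_le_sqrt
  have h4 := H.hK
  have h5 : 0 ≤ K * Real.log x ^ (1 / 2 : ℝ) := by positivity
  nlinarith

theorem const_mul_loglog_le (H : Large K δ x) :
    K * Real.log (Real.log x) ≤ Real.log x / 1000 := by
  refine le_trans ?_ H.loglog_le
  have h2 := H.logloglarge
  have h3 := H.one_le_sqrt
  have h4 := H.hK
  have h5 : 0 ≤ K * Real.log (Real.log x) := by positivity
  nlinarith

theorem const_le_log (H : Large K δ x) : K ≤ Real.log x := by
  have h1 := H.const_mul_loglog_le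
  have h2 := H.logloglarge
  have h4 := H.hK
  nlinarith

/-- Powers of the logarithm are small against powers. -/
theorem log_rpow_le (H : Large K δ x) {a b : ℝ} (hb : 0 ≤ b)
    (hab : a ≤ 1000000 * b) :
    Real.log x ^ a ≤ x ^ b := by
  have h1 := H.logloglarge
  have h2 := H.const_mul_loglog_le
  have h3 := H.hK
  rw [H.log_rpow_eq, H.rpow_eq, Real.exp_le_exp]
  have h4 : 1000000 * Real.log (Real.log x) ≤ Real.log x := by nlinarith
  have h5 := H.log_gt
  nlinarith

end Large

/-- The sieving limit. -/
noncomputable def sieveLimit (x : ℝ) : ℕ := ⌊x ^ (99 / 100 : ℝ)⌋₊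

/-- The levels below which the blocks are not sieved. -/
noncomputable def sieveStart (δ x : ℝ) (s : ℕ) : ℕ := 300 * blockLen δ x s ^ 4

namespace Large
variable {K δ x : ℝ} {s : ℕ}

theorem cutoff_eq (H : Large K δ x) (s : ℕ) :
    cutoff δ x s = Real.exp (Real.log x + (δ - scaleExp δ s) * Real.log (Real.log x)) := by
  rw [cutoff, H.log_rpow_eq, Real.exp_add, Real.exp_log H.pos]

theorem log_cutoff (H : Large K δ x) (s : ℕ) :
    Real.log (cutoff δ x s) = Real.log x + (δ - scaleExp δ s) * Real.log (Real.log x) := by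
  rw [H.cutoff_eq, Real.log_exp]

theorem cutoff_pos (H : Large K δ x) (s : ℕ) : 0 < cutoff δ x s := by
  rw [H.cutoff_eq]
  exact Real.exp_pos _

theorem cutoff_le (H : Large K δ x) (s : ℕ) : cutoff δ x s ≤ x := by
  have h1 := le_scaleExp H.hδ s
  have h2 : Real.log x ^ (δ - scaleExp δ s) ≤ 1 :=
    Real.rpow_le_one_of_one_le_of_nonpos H.log_gt.le (by linarith [H.hδ])
  have := H.pos
  unfold cutoff
  nlinarith

theorem cutoff_antitone (H : Large K δ x) : Antitone (cutoff δ x) := by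
  intro s s' hs
  have h1 := scaleExp_mono H.hδ hs
  have h2 := H.pos
  unfold cutoff
  gcongr
  exact H.log_gt.le

theorem log_le_log_cutoff (H : Large K δ x) (hs : scaleExp δ s ≤ 1 / 2) :
    999 / 1000 * Real.log x ≤ Real.log (cutoff δ x s) := by
  rw [H.log_cutoff]
  have h1 := H.const_mul_loglog_le
  have h2 := H.logloglarge
  have h3 := H.hK
  have h4 := H.hδ
  nlinarith

theorem log_cutoff_le (H : Large K δ x) (s : ℕ) : Real.log (cutoff δ x s) ≤ Real.log x :=
  Real.log_le_log (H.cutoff_pos s) (H.cutoff_le s)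

theorem rpow_le_cutoff (H : Large K δ x) (hs : scaleExp δ s ≤ 1 / 2) :
    x ^ (999 / 1000 : ℝ) ≤ cutoff δ x s := by
  rw [H.rpow_eq, ← Real.le_log_iff_exp_le (H.cutoff_pos s)]
  exact H.log_le_log_cutoff hs

theorem le_rpow_scaleExp (H : Large K δ x) (s : ℕ) : K ≤ Real.log x ^ scaleExp δ s := by
  have h1 := H.logloglarge
  have h2 := H.hK
  have h3 := le_scaleExp H.hδ s
  calc K ≤ K * Real.log (Real.log x) ^ 3 :=
        le_mul_of_one_le_right (by linarith) (one_le_pow₀ (by linarith))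
    _ ≤ _ := H.pow
    _ ≤ _ := Real.rpow_le_rpow_of_exponent_le H.log_gt.le (by linarith [H.hδ])

theorem le_blockLen (s : ℕ) :
    Real.log x ^ scaleExp δ (s + 1) + 2 ≤ blockLen δ x s := by
  have := Nat.lt_floor_add_one (Real.log x ^ scaleExp δ (s + 1))
  unfold blockLen
  push_cast
  linarith

theorem blockLen_le (H : Large K δ x) (s : ℕ) :
    (blockLen δ x s : ℝ) ≤ 2 * Real.log x ^ scaleExp δ (s + 1) := by
  have h1 := Nat.floor_le (show 0 ≤ Real.log x ^ scaleExp δ (s + 1) by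
    have := H.log_gt; positivity)
  have h2 := H.le_rpow_scaleExp (s + 1)
  have h3 := H.hK
  unfold blockLen
  push_cast
  linarith

theorem three_le_blockLen (s : ℕ) : 3 ≤ blockLen δ x s := by unfold blockLen; omega

theorem blockLen_le_sqrt (H : Large K δ x) (hs : scaleExp δ (s + 1) ≤ 1 / 2) :
    (blockLen δ x s : ℝ) ≤ 2 * Real.log x ^ (1 / 2 : ℝ) := by
  refine (H.blockLen_le s).trans ?_
  gcongr
  exact H.log_gt.le

theorem rpow_le_sieveLimit (H : Large K δ x) : x ^ (98 / 100 : ℝ) ≤ sieveLimit x := by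
  have h1 := Nat.lt_floor_add_one (x ^ (99 / 100 : ℝ))
  have h2 : x ^ (99 / 100 : ℝ) = x ^ (98 / 100 : ℝ) * x ^ (1 / 100 : ℝ) := by
    rw [← Real.rpow_add H.pos]; norm_num
  have h3 := H.log_rpow_le (a := 1) (b := 1 / 100) (by norm_num) (by norm_num)
  have h4 := H.const_le_log
  have h5 := H.hK
  rw [Real.rpow_one] at h3
  have h6 : 1 ≤ x ^ (98 / 100 : ℝ) := by
    rw [H.rpow_eq]
    exact Real.one_le_exp (by linarith)
  unfold sieveLimit
  nlinarith

theorem sieveLimit_le (H : Large K δ x) : (sieveLimit x : ℝ) ≤ x ^ (99 / 100 : ℝ) :=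
  Nat.floor_le (by have := H.pos; positivity)

theorem one_lt (H : Large K δ x) : 1 < x := by
  have h1 := H.log_gt
  by_contra h
  push Not at h
  linarith [Real.log_nonpos H.pos.le h]

theorem sieveLimit_le_cutoff (H : Large K δ x) (hs : scaleExp δ s ≤ 1 / 2) :
    (sieveLimit x : ℝ) ≤ cutoff δ x s := by
  refine H.sieveLimit_le.trans (le_trans ?_ (H.rpow_le_cutoff hs))
  exact Real.rpow_le_rpow_of_exponent_le H.one_lt.le (by norm_num)

theorem sieveStart_le_log (H : Large K δ x) (hs : scaleExp δ (s + 1) ≤ 1 / 2) :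
    (sieveStart δ x s : ℝ) ≤ 4800 * Real.log x ^ (2 : ℝ) := by
  have h1 := H.blockLen_le_sqrt hs
  have h0 := H.log_gt
  have h2 : (Real.log x ^ (1 / 2 : ℝ)) ^ 4 = Real.log x ^ (2 : ℝ) := by
    rw [← Real.rpow_natCast, ← Real.rpow_mul (by linarith)]
    norm_num
  unfold sieveStart
  push_cast
  calc 300 * (blockLen δ x s : ℝ) ^ 4 ≤ 300 * (2 * Real.log x ^ (1 / 2 : ℝ)) ^ 4 := by gcongr
    _ = _ := by rw [mul_pow, h2]; ring

theorem sieveStart_le (H : Large K δ x) (hs : scaleExp δ (s + 1) ≤ 1 / 2) :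
    sieveStart δ x s ≤ sieveLimit x := by
  have h1 := H.sieveStart_le_log hs
  have h2 := H.const_le_log
  have h3 := H.hK
  have h0 := H.log_gt
  have h4 : 4800 * Real.log x ^ (2 : ℝ) ≤ x ^ (98 / 100 : ℝ) := by
    calc 4800 * Real.log x ^ (2 : ℝ) ≤ (1000 * 1000) * Real.log x ^ (2 : ℝ) := by
          gcongr; norm_num
      _ ≤ (Real.log x * Real.log x) * Real.log x ^ (2 : ℝ) := by gcongr <;> linarith
      _ = Real.log x ^ (4 : ℝ) := by
        norm_cast
        ring
      _ ≤ _ := H.log_rpow_le (by norm_num) (by norm_num)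
  exact_mod_cast (h1.trans h4).trans H.rpow_le_sieveLimit

theorem le_sieveStart (s : ℕ) : 300 * 81 ≤ sieveStart δ x s := by
  have := three_le_blockLen (δ := δ) (x := x) s
  unfold sieveStart
  calc 300 * 81 = 300 * 3 ^ 4 := by norm_num
    _ ≤ _ := by gcongr

theorem one_le_log_sieveStart (s : ℕ) : 1 ≤ Real.log (sieveStart δ x s) := by
  have h1 : (300 * 81 : ℝ) ≤ sieveStart δ x s := by
    exact_mod_cast le_sieveStart (δ := δ) (x := x) s
  rw [Real.le_log_iff_exp_le (by linarith)]
  linarith [Real.exp_one_lt_d9]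

end Large

/-- The length of the interval to be covered. -/
noncomputable def gapLen (δ x : ℝ) : ℕ := ⌈x * Real.log x ^ δ⌉₊

namespace Large
variable {K δ x C : ℝ} {s : ℕ}

theorem gapLen_le_add_one (H : Large K δ x) : (gapLen δ x : ℝ) ≤ x * Real.log x ^ δ + 1 :=
  (Nat.ceil_lt_add_one (by have := H.pos; have := H.log_gt; positivity)).le

theorem one_le_log_rpow (H : Large K δ x) {a : ℝ} (ha : 0 ≤ a) : 1 ≤ Real.log x ^ a :=
  Real.one_le_rpow H.log_gt.le ha

theorem le_gapLen (H : Large K δ x) : x ≤ gapLen δ x := by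
  refine le_trans ?_ (Nat.le_ceil _)
  have := H.one_le_log_rpow H.hδ.le
  have := H.pos
  nlinarith

theorem gapLen_le (H : Large K δ x) : (gapLen δ x : ℝ) ≤ 2 * (x * Real.log x ^ δ) := by
  have h1 := H.one_le_log_rpow H.hδ.le
  have h2 := H.one_lt
  have := H.gapLen_le_add_one
  nlinarith

theorem log_le_x_rpow (H : Large K δ x) {b : ℝ} (hb : 1 / 1000 ≤ b) : Real.log x ≤ x ^ b := by
  have := H.log_rpow_le (a := 1) (b := b) (by linarith) (by linarith)
  rwa [Real.rpow_one] at this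

theorem const_le_rpow (H : Large K δ x) {b : ℝ} (hb : 1 / 1000 ≤ b) : K ≤ x ^ b :=
  H.const_le_log.trans (H.log_le_x_rpow hb)

theorem gapLen_le_rpow (H : Large K δ x) (hδ : δ ≤ 1 / 2) :
    (gapLen δ x : ℝ) ≤ x ^ (1 + 1 / 100 : ℝ) := by
  refine H.gapLen_le.trans ?_
  have h1 := H.log_rpow_le (a := δ) (b := 1 / 200) (by norm_num) (by linarith)
  have h2 := H.const_le_rpow (b := 1 / 200) (by norm_num)
  have h3 := H.hK
  have hx := H.pos
  calc 2 * (x * Real.log x ^ δ) ≤ x ^ (1 / 200 : ℝ) * (x * x ^ (1 / 200 : ℝ)) := by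
        have := H.log_gt
        gcongr
        linarith
    _ = x ^ (1 / 200 : ℝ) * (x ^ (1 : ℝ) * x ^ (1 / 200 : ℝ)) := by rw [Real.rpow_one]
    _ = _ := by rw [← Real.rpow_add hx, ← Real.rpow_add hx]; norm_num

theorem blockLen_le_rpow (H : Large K δ x) (hs : scaleExp δ (s + 1) ≤ 1 / 2) :
    (blockLen δ x s : ℝ) ≤ x ^ (1 / 100 : ℝ) := by
  refine (H.blockLen_le_sqrt hs).trans (le_trans ?_ (H.log_le_x_rpow (by norm_num)))
  have h1 := H.const_mul_sqrt_le
  have h2 := H.one_le_sqrt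
  have := H.hK
  nlinarith

theorem sum_inv_le (H : Large K δ x) (hs : scaleExp δ (s + 1) ≤ 1 / 2) (hCK : C ≤ K) (hC0 : 0 < C)
    (hC : ∀ w z : ℝ, 2 ≤ w → w ≤ z → ∑ p ∈ primesIoc w z, 1 / (p : ℝ)
      ≤ Real.log (Real.log z / Real.log w) + C / Real.log w) :
    ∑ p ∈ primesIoc (sieveStart δ x s) (sieveLimit x), 1 / (p : ℝ)
      ≤ 2 * Real.log (Real.log x) := by
  have hw1 := one_le_log_sieveStart (δ := δ) (x := x) s
  have hw : (300 * 81 : ℝ) ≤ sieveStart δ x s := by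
    exact_mod_cast le_sieveStart (δ := δ) (x := x) s
  have hz : (sieveStart δ x s : ℝ) ≤ sieveLimit x := by exact_mod_cast H.sieveStart_le hs
  have h1 := hC _ _ (by linarith) hz
  have hzx : (sieveLimit x : ℝ) ≤ x := H.sieveLimit_le.trans
    (by simpa using Real.rpow_le_rpow_of_exponent_le H.one_lt.le (show (99 / 100 : ℝ) ≤ 1 by norm_num))
  have h2 : Real.log (sieveLimit x) ≤ Real.log x := Real.log_le_log (by linarith) hzx
  have h3 : 0 < Real.log (sieveLimit x) := Real.log_pos (by linarith)
  have h4 : Real.log (sieveLimit x) / Real.log (sieveStart δ x s) ≤ Real.log x :=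
    (div_le_self h3.le hw1).trans h2
  have h5 := Real.log_le_log (by positivity) h4
  have h6 : C / Real.log (sieveStart δ x s) ≤ C := div_le_self hC0.le hw1
  linarith [H.loglog]

theorem block (H : Large K δ x) (hs : scaleExp δ (s + 1) ≤ 1 / 2) (hCK : C ≤ K) (hC0 : 0 < C)
    (hC : ∀ w z : ℝ, 2 ≤ w → w ≤ z → ∑ p ∈ primesIoc w z, 1 / (p : ℝ)
      ≤ Real.log (Real.log z / Real.log w) + C / Real.log w) :
    BlockData (primeList (sieveStart δ x s + 1) (sieveLimit x - sieveStart δ x s)) (blockLen δ x s)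
      (gapLen δ x) (sieveStart δ x s) (2 * Real.log (Real.log x)) (x ^ (1 / 4 : ℝ)) (x ^ (2 : ℝ))
      (cutoff δ x (s + 1)) (cutoff δ x s) := by
  have hx := H.pos
  have hx1 := H.one_lt
  have hY := H.rpow_le_cutoff hs
  have hYpos := H.cutoff_pos (s + 1)
  have hYs := H.cutoff_pos s
  have hh := H.blockLen_le_rpow hs
  have hK := H.hK
  have hbig : 1000 ≤ cutoff δ x (s + 1) :=
    hK.trans ((H.const_le_rpow (by norm_num)).trans hY)
  refine ⟨nodup_primeList _ _, fun p hp => ?_, (three_le_blockLen s).trans' (by norm_num), ?_, ?_,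
    by positivity, ?_, by linarith, H.cutoff_antitone (Nat.le_succ s), ?_, ?_, ?_, ?_⟩
  · obtain ⟨h1, h2, h3⟩ := mem_primeList.1 hp
    refine ⟨h1, by exact_mod_cast h2, le_trans ?_ (H.sieveLimit_le_cutoff hs)⟩
    have := H.sieveStart_le hs
    exact_mod_cast (show p ≤ sieveLimit x by omega)
  · unfold sieveStart
    push_cast
    gcongr
    norm_num
  · rw [toFinset_primeList_eq_primesIoc (H.sieveStart_le hs)]
    exact H.sum_inv_le hs hCK hC0 hC
  · exact le_trans (Real.rpow_le_rpow_of_exponent_le hx1.le (by norm_num)) hY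
  · refine lt_of_le_of_lt hh (lt_of_lt_of_le ?_ hY)
    exact Real.rpow_lt_rpow_of_exponent_lt hx1 (by norm_num)
  · calc 2 * (blockLen δ x s : ℝ) * cutoff δ x s ≤ x ^ (1 / 100 : ℝ) * x ^ (1 / 100 : ℝ) * x := by
          have := H.const_le_rpow (b := 1 / 100) (by norm_num)
          have := H.cutoff_le s
          gcongr
          linarith
      _ = x ^ (1 / 100 : ℝ) * x ^ (1 / 100 : ℝ) * x ^ (1 : ℝ) := by rw [Real.rpow_one]
      _ = x ^ (1 / 100 + 1 / 100 + 1 : ℝ) := by rw [← Real.rpow_add hx, ← Real.rpow_add hx]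
      _ ≤ _ := Real.rpow_le_rpow_of_exponent_le hx1.le (by norm_num)
  · refine H.gapLen_le_add_one.trans ?_
    have h1 := le_blockLen (δ := δ) (x := x) s
    have h2 : Real.log x ^ scaleExp δ (s + 1) * cutoff δ x (s + 1) = x * Real.log x ^ δ := by
      have h3 : Real.log x ^ δ = Real.log x ^ scaleExp δ (s + 1)
          * Real.log x ^ (δ - scaleExp δ (s + 1)) := by
        rw [← Real.rpow_add (by linarith [H.log_gt])]
        ring_nf
      rw [h3, cutoff]
      ring
    nlinarith
  · have hL := H.log_gt
    have h1 := le_blockLen (δ := δ) (x := x) s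
    have h0 : 0 < Real.log x ^ scaleExp δ (s + 1) := by positivity
    have h2 : 2 * Real.log x ^ scaleExp δ (s + 1) ≤ sieveStart δ x s := by
      unfold sieveStart
      push_cast
      have h3 : (1 : ℝ) ≤ blockLen δ x s := by linarith
      have h4 : (blockLen δ x s : ℝ) ≤ (blockLen δ x s : ℝ) ^ 4 := le_self_pow₀ h3 (by norm_num)
      linarith
    have h5 : cutoff δ x s ≤ Real.log x ^ scaleExp δ (s + 1) * cutoff δ x (s + 1) := by
      have h6 : Real.log x ^ (δ - scaleExp δ s) ≤ Real.log x ^ (scaleExp δ (s + 1)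
          + (δ - scaleExp δ (s + 1))) := by
        refine Real.rpow_le_rpow_of_exponent_le hL.le ?_
        have := le_scaleExp H.hδ s
        linarith [H.hδ]
      rw [Real.rpow_add (by linarith)] at h6
      unfold cutoff
      nlinarith
    have h7 : cutoff δ x s / sieveStart δ x s ≤ cutoff δ x (s + 1) / 2 := by
      rw [div_le_iff₀ (by linarith)]
      nlinarith
    linarith

end Large

/-- The number of rounds. -/
noncomputable def roundCount (δ x : ℝ) : ℕ :=
  ⌈6 / 5 * δ * Real.log (Real.log x) / Real.log (10 / 9)⌉₊

/-- A common bound for the lengths of the progressions. -/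
noncomputable def maxLen (x : ℝ) : ℕ := ⌊Real.log x ^ (1 / 2 : ℝ)⌋₊ + 3

theorem log_ten_ninths_bounds : 1 / 10 ≤ Real.log (10 / 9) ∧ Real.log (10 / 9) ≤ 1 / 9 := by
  constructor
  · have := Real.one_sub_inv_le_log_of_pos (show (0 : ℝ) < 10 / 9 by norm_num)
    norm_num at this ⊢
    linarith
  · have := Real.log_le_sub_one_of_pos (show (0 : ℝ) < 10 / 9 by norm_num)
    linarith

theorem nine_tenths_pow_eq (k : ℕ) : (9 / 10 : ℝ) ^ k = Real.exp (-(k * Real.log (10 / 9))) := by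
  rw [← mul_neg, ← Real.log_inv, Real.exp_nat_mul, Real.exp_log (by norm_num)]
  norm_num

namespace Large
variable {K δ x C : ℝ} {s : ℕ}

theorem nine_tenths_pow_le (H : Large K δ x) :
    (9 / 10 : ℝ) ^ roundCount δ x ≤ Real.log x ^ (-(6 / 5) * δ) := by
  rw [nine_tenths_pow_eq, H.log_rpow_eq, Real.exp_le_exp]
  have h := Nat.le_ceil (6 / 5 * δ * Real.log (Real.log x) / Real.log (10 / 9))
  rw [div_le_iff₀ (by linarith [log_ten_ninths_bounds.1])] at h
  unfold roundCount
  linarith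

theorem roundCount_mul_le (H : Large K δ x) :
    roundCount δ x * Real.log (10 / 9) ≤ 6 / 5 * δ * Real.log (Real.log x) + 1 / 9 := by
  have hl := log_ten_ninths_bounds
  have hl0 : 0 < Real.log (10 / 9) := by linarith
  have h1 := H.logloglarge
  have h2 := H.hδ
  have h := (Nat.ceil_lt_add_one (a := 6 / 5 * δ * Real.log (Real.log x) / Real.log (10 / 9))
    (by positivity)).le
  have h3 := mul_le_mul_of_nonneg_right h hl0.le
  rw [add_mul, div_mul_cancel₀ _ hl0.ne'] at h3
  unfold roundCount
  linarith

theorem inv_nine_tenths_pow_le (H : Large K δ x) :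
    ((9 / 10 : ℝ) ^ roundCount δ x)⁻¹ ≤ 2 * Real.log x ^ (6 / 5 * δ) := by
  rw [nine_tenths_pow_eq, ← Real.exp_neg, neg_neg, H.log_rpow_eq]
  refine (Real.exp_le_exp.2 H.roundCount_mul_le).trans ?_
  rw [Real.exp_add, mul_comm]
  gcongr
  have := Real.exp_bound_div_one_sub_of_interval (x := 1 / 9) (by norm_num) (by norm_num)
  norm_num at this ⊢
  linarith

theorem roundCount_le (H : Large K δ x) (hδ : δ ≤ 1 / 5) :
    (roundCount δ x : ℝ) ≤ 3 * Real.log (Real.log x) := by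
  have h1 := H.roundCount_mul_le
  have h2 := log_ten_ninths_bounds.1
  have h3 := H.logloglarge
  have h4 : (roundCount δ x : ℝ) * (1 / 10) ≤ roundCount δ x * Real.log (10 / 9) := by gcongr
  nlinarith

theorem one_le_roundCount (H : Large K δ x) : 1 ≤ roundCount δ x := by
  refine Nat.one_le_ceil_iff.2 ?_
  have hl := log_ten_ninths_bounds.1
  have hl0 : 0 < Real.log (10 / 9) := by linarith
  have h1 := H.logloglarge
  have h2 := H.hδ
  positivity

theorem blockLen_le_maxLen (H : Large K δ x) (hs : scaleExp δ (s + 1) ≤ 1 / 2) :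
    blockLen δ x s ≤ maxLen x := by
  unfold blockLen maxLen
  gcongr
  exact H.log_gt.le

theorem maxLen_le (H : Large K δ x) : (maxLen x : ℝ) ≤ Real.log x ^ (1 / 2 : ℝ) + 3 := by
  have h0 := H.log_gt
  have h1 := Nat.floor_le (show 0 ≤ Real.log x ^ (1 / 2 : ℝ) by positivity)
  unfold maxLen
  push_cast
  linarith

theorem inv_nine_tenths_pow_mul_le (H : Large K δ x) (hδ : δ ≤ 1 / 5) :
    ((9 / 10 : ℝ) ^ (roundCount δ x * maxLen x))⁻¹ ≤ x ^ (1 / 100 : ℝ) := by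
  rw [nine_tenths_pow_eq, ← Real.exp_neg, neg_neg, H.rpow_eq, Real.exp_le_exp]
  push_cast
  have h1 := H.roundCount_le hδ
  have h2 := H.maxLen_le
  have h3 := H.one_le_sqrt
  have h4 := H.logloglarge
  have h5 := log_ten_ninths_bounds
  have h6 := H.loglog_le
  have h7 := H.hK
  calc (roundCount δ x : ℝ) * maxLen x * Real.log (10 / 9)
      ≤ 3 * Real.log (Real.log x) * (4 * Real.log x ^ (1 / 2 : ℝ)) * (1 / 9) := by
        have : (maxLen x : ℝ) ≤ 4 * Real.log x ^ (1 / 2 : ℝ) := by linarith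
        have := h5.2
        have : 0 ≤ Real.log (10 / 9) := by linarith
        gcongr
    _ ≤ K * Real.log (Real.log x) * Real.log x ^ (1 / 2 : ℝ) := by
        have : 0 ≤ Real.log (Real.log x) * Real.log x ^ (1 / 2 : ℝ) := by positivity
        nlinarith
    _ ≤ _ := by have := H.log_gt; linarith

theorem inv_distProb_le (H : Large K δ x) (hs : scaleExp δ (s + 1) ≤ 1 / 2) (hCK : C ≤ K)
    (hC0 : 0 < C)
    (hC : ∀ w z : ℝ, 2 ≤ w → w ≤ z → ∑ p ∈ primesIoc w z, 1 / (p : ℝ)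
      ≤ Real.log (Real.log z / Real.log w) + C / Real.log w) :
    (distProb (primeList (sieveStart δ x s + 1) (sieveLimit x - sieveStart δ x s)).toFinset
      (blockLen δ x s))⁻¹ ≤ x ^ (1 / 100 : ℝ) := by
  rw [toFinset_primeList_eq_primesIoc (H.sieveStart_le hs)]
  refine (inv_distProb_le_exp fun p hp => ?_).trans ?_
  · obtain ⟨h1, h2, -⟩ := (mem_primesIoc (by positivity) (by positivity)).1 hp
    refine ⟨h1.pos, ?_⟩
    have h3 : sieveStart δ x s < p := by exact_mod_cast h2
    have h4 : blockLen δ x s ≤ blockLen δ x s ^ 4 := Nat.le_self_pow (by norm_num) _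
    unfold sieveStart at h3
    omega
  · rw [H.rpow_eq, Real.exp_le_exp]
    have h1 := H.sum_inv_le hs hCK hC0 hC
    have h2 := H.blockLen_le_sqrt hs
    have h3 := H.logloglarge
    have h4 := H.one_le_sqrt
    have h5 := H.loglog_le
    have h6 := H.hK
    calc _ ≤ 2 * (2 * Real.log x ^ (1 / 2 : ℝ)) * (2 * Real.log (Real.log x)) := by gcongr
      _ ≤ K * Real.log (Real.log x) * Real.log x ^ (1 / 2 : ℝ) := by
        have : 0 ≤ Real.log (Real.log x) * Real.log x ^ (1 / 2 : ℝ) := by positivity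
        nlinarith
      _ ≤ _ := by have := H.log_gt; linarith

theorem twentyfour_le_log_sieveStart (H : Large K δ x) (s : ℕ) :
    24 ≤ Real.log (sieveStart δ x s) := by
  have h1 := le_blockLen (δ := δ) (x := x) s
  have h2 := H.le_rpow_scaleExp (s + 1)
  have h3 : (1000 : ℝ) ≤ blockLen δ x s := by linarith [H.hK]
  have h4 : (300 * 1000 ^ 4 : ℝ) ≤ sieveStart δ x s := by
    unfold sieveStart
    push_cast
    gcongr
  rw [Real.le_log_iff_exp_le (by linarith)]
  have h5 : Real.exp 24 = Real.exp 1 ^ 24 := by rw [← Real.exp_nat_mul]; norm_num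
  have h6 : Real.exp 1 ^ 24 ≤ (2.7182818286 : ℝ) ^ 24 := by
    have := Real.exp_one_lt_d9.le
    gcongr
  rw [h5]
  refine h6.trans (le_trans ?_ h4)
  norm_num

theorem tailErr_le (H : Large K δ x) (s : ℕ) :
    tailErr (x ^ (1 / 4 : ℝ)) (x ^ (2 : ℝ)) (sieveStart δ x s) ≤ x ^ (-(1 / 16) : ℝ) := by
  have h1 := H.twentyfour_le_log_sieveStart s
  have hx := H.pos
  have hL := H.log_gt
  unfold tailErr
  rw [← Real.rpow_mul hx.le, H.rpow_eq, Real.log_rpow hx, Real.rpow_def_of_pos (by norm_num),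
    ← Real.exp_add, H.rpow_eq, Real.exp_le_exp]
  have h2 : 2 * Real.log x / Real.log (sieveStart δ x s) ≤ 2 * Real.log x / 24 := by gcongr
  have h3 : Real.log 2 * (2 * Real.log x / Real.log (sieveStart δ x s))
      ≤ 0.6931471808 * (2 * Real.log x / 24) := by
    have := Real.log_two_lt_d9.le
    gcongr
  norm_num at h3 ⊢
  linarith

theorem smallErr_le (H : Large K δ x) (s : ℕ) :
    smallErr (blockLen δ x s) (sieveStart δ x s) (2 * Real.log (Real.log x))
      ≤ 64 * Real.log (Real.log x) * Real.log x ^ (-(33 / 20) * scaleExp δ s) := by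
  have hL := H.log_gt
  have hℓ := H.logloglarge
  have hA : 0 < Real.log x ^ scaleExp δ (s + 1) := by positivity
  have h1 := le_blockLen (δ := δ) (x := x) s
  have hh : (0 : ℝ) < blockLen δ x s := by linarith
  have hW : ((blockLen δ x s : ℝ) ^ 4) ≤ sieveStart δ x s := by
    unfold sieveStart
    push_cast
    have : 0 ≤ (blockLen δ x s : ℝ) ^ 4 := by positivity
    linarith
  have h2 : (blockLen δ x s : ℝ) ^ 2 * (sieveStart δ x s : ℝ) ^ (-(7 / 8) : ℝ)
      ≤ Real.log x ^ (-(33 / 20) * scaleExp δ s) := by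
    calc _ ≤ (blockLen δ x s : ℝ) ^ 2 * ((blockLen δ x s : ℝ) ^ 4) ^ (-(7 / 8) : ℝ) := by
          gcongr ?_ * ?_
          exact Real.rpow_le_rpow_of_nonpos (by positivity) hW (by norm_num)
      _ = (blockLen δ x s : ℝ) ^ (-(3 / 2) : ℝ) := by
        rw [← Real.rpow_natCast, ← Real.rpow_natCast, ← Real.rpow_mul hh.le, ← Real.rpow_add hh]
        norm_num
      _ ≤ (Real.log x ^ scaleExp δ (s + 1)) ^ (-(3 / 2) : ℝ) :=
        Real.rpow_le_rpow_of_nonpos hA (by linarith) (by norm_num)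
      _ = _ := by
        rw [← Real.rpow_mul (by linarith), scaleExp_succ]
        ring_nf
  have h3 : 32 * Real.log (Real.log x) * Real.log x ^ (-(33 / 20) * scaleExp δ s) ≤ 1 := by
    have h4 : 32 * Real.log (Real.log x) ≤ Real.log x ^ ((33 / 20) * scaleExp δ s) := by
      have h5 := le_scaleExp H.hδ s
      refine le_trans ?_ (H.pow.trans (Real.rpow_le_rpow_of_exponent_le hL.le
        (show δ / 10 ≤ 33 / 20 * scaleExp δ s by linarith [H.hδ])))
      have h6 := H.hK
      have : Real.log (Real.log x) ≤ Real.log (Real.log x) ^ 3 :=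
        le_self_pow₀ (by linarith) (by norm_num)
      nlinarith
    rw [neg_mul, Real.rpow_neg (by linarith), ← div_eq_mul_inv, div_le_one (by positivity)]
    exact h4
  have h5 : 16 * (blockLen δ x s : ℝ) ^ 2 * (sieveStart δ x s : ℝ) ^ (-(7 / 8) : ℝ)
      * (2 * Real.log (Real.log x))
      ≤ 32 * Real.log (Real.log x) * Real.log x ^ (-(33 / 20) * scaleExp δ s) := by
    have := mul_le_mul_of_nonneg_left h2 (show 0 ≤ 32 * Real.log (Real.log x) by positivity)
    linarith
  have h6 : 0 ≤ 16 * (blockLen δ x s : ℝ) ^ 2 * (sieveStart δ x s : ℝ) ^ (-(7 / 8) : ℝ)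
      * (2 * Real.log (Real.log x)) := by positivity
  unfold smallErr
  have h7 := Real.abs_exp_sub_one_le (x := 16 * (blockLen δ x s : ℝ) ^ 2
    * (sieveStart δ x s : ℝ) ^ (-(7 / 8) : ℝ) * (2 * Real.log (Real.log x)))
    (by rw [abs_of_nonneg h6]; linarith)
  rw [abs_of_nonneg h6] at h7
  linarith [le_abs_self (Real.exp (16 * (blockLen δ x s : ℝ) ^ 2
    * (sieveStart δ x s : ℝ) ^ (-(7 / 8) : ℝ) * (2 * Real.log (Real.log x))) - 1)]

end Large

/-- The guaranteed weight of the primes of each range. -/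
noncomputable def rangeWeight (C δ x : ℝ) (s : ℕ) : ℝ :=
  (scaleExp δ s * Real.log (Real.log x) / 10 - 2 * C) / Real.log x

namespace Large
variable {K δ x C : ℝ} {s : ℕ}

theorem log_sieveStart_le (H : Large K δ x) (s : ℕ) :
    Real.log (sieveStart δ x s) ≤ 22 / 5 * scaleExp δ s * Real.log (Real.log x) + 9 := by
  have hL := H.log_gt
  have h1 := H.blockLen_le s
  have h2 : (sieveStart δ x s : ℝ) ≤ 4800 * (Real.log x ^ scaleExp δ (s + 1)) ^ 4 := by
    unfold sieveStart
    push_cast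
    calc 300 * (blockLen δ x s : ℝ) ^ 4 ≤ 300 * (2 * Real.log x ^ scaleExp δ (s + 1)) ^ 4 := by
          gcongr
      _ = _ := by ring
  have h3 : (0 : ℝ) < sieveStart δ x s := by
    exact_mod_cast (le_sieveStart (δ := δ) (x := x) s).trans_lt' (by norm_num)
  have h4 := Real.log_le_log h3 h2
  rw [Real.log_mul (by norm_num) (by positivity), Real.log_pow, Real.log_rpow (by linarith),
    scaleExp_succ] at h4
  have h5 : Real.log 4800 ≤ 9 := by
    rw [Real.log_le_iff_le_exp (by norm_num)]
    have h6 : Real.exp 9 = Real.exp 1 ^ 9 := by rw [← Real.exp_nat_mul]; norm_num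
    have h7 : (2.7182818283 : ℝ) ^ 9 ≤ Real.exp 1 ^ 9 := by
      have := Real.exp_one_gt_d9.le
      gcongr
    rw [h6]
    refine le_trans ?_ h7
    norm_num
  push_cast at h4
  linarith

theorem le_log_sieveStart (H : Large K δ x) (s : ℕ) : K * δ ≤ Real.log (sieveStart δ x s) := by
  have hL := H.log_gt
  have h1 := le_blockLen (δ := δ) (x := x) s
  have h0 : 0 < Real.log x ^ scaleExp δ (s + 1) := by positivity
  have h2 : Real.log x ^ scaleExp δ (s + 1) ≤ sieveStart δ x s := by
    unfold sieveStart
    push_cast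
    have h3 : (1 : ℝ) ≤ blockLen δ x s := by linarith
    have h4 : (blockLen δ x s : ℝ) ≤ (blockLen δ x s : ℝ) ^ 4 := le_self_pow₀ h3 (by norm_num)
    linarith
  have h5 := Real.log_le_log h0 h2
  rw [Real.log_rpow (by linarith)] at h5
  have h6 := le_scaleExp H.hδ (s + 1)
  have h7 := H.loglog
  have h8 := H.hK
  have h9 := H.hδ
  nlinarith

theorem log_sieveLimit_ge (H : Large K δ x) : 98 / 100 * Real.log x ≤ Real.log (sieveLimit x) := by
  have h1 := Real.log_le_log (by have := H.pos; positivity) H.rpow_le_sieveLimit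
  rwa [Real.log_rpow H.pos] at h1

theorem distProb_le (H : Large K δ x) (hs : scaleExp δ (s + 1) ≤ 1 / 2) (hC0 : 0 < C)
    (hCK : 2000 * (1 + C) ≤ K * δ)
    (hC : ∀ w z : ℝ, 2 ≤ w → w ≤ z → distProb (primesIoc w z) 1
      ≤ Real.log w / Real.log z * Real.exp (C / Real.log w)) :
    distProb (primeList (sieveStart δ x s + 1) (sieveLimit x - sieveStart δ x s)).toFinset 1
      ≤ 513 / 500 * ((22 / 5 * scaleExp δ s * Real.log (Real.log x) + 9) / Real.log x) := by
  rw [toFinset_primeList_eq_primesIoc (H.sieveStart_le hs)]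
  have hw : (300 * 81 : ℝ) ≤ sieveStart δ x s := by
    exact_mod_cast le_sieveStart (δ := δ) (x := x) s
  have hz : (sieveStart δ x s : ℝ) ≤ sieveLimit x := by exact_mod_cast H.sieveStart_le hs
  refine (hC _ _ (by linarith) hz).trans ?_
  have hL := H.log_gt
  have h1 := H.log_sieveStart_le s
  have h2 := H.le_log_sieveStart s
  have h3 := H.log_sieveLimit_ge
  have h4 := one_le_log_sieveStart (δ := δ) (x := x) s
  have h5 : C / Real.log (sieveStart δ x s) ≤ 1 / 2000 := by
    rw [div_le_iff₀ (by linarith)]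
    linarith
  have h6 : Real.exp (C / Real.log (sieveStart δ x s)) ≤ 1001 / 1000 := by
    refine (Real.exp_le_exp.2 h5).trans ?_
    have := Real.exp_bound_div_one_sub_of_interval (x := 1 / 2000) (by norm_num) (by norm_num)
    norm_num at this ⊢
    linarith
  calc _ ≤ (22 / 5 * scaleExp δ s * Real.log (Real.log x) + 9) / (98 / 100 * Real.log x)
        * (1001 / 1000) := by
        have : 0 ≤ 22 / 5 * scaleExp δ s * Real.log (Real.log x) + 9 := by linarith
        gcongr
    _ = (1001 / 980) * ((22 / 5 * scaleExp δ s * Real.log (Real.log x) + 9) / Real.log x) := by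
        field_simp; ring
    _ ≤ _ := by
        have : 0 ≤ 22 / 5 * scaleExp δ s * Real.log (Real.log x) + 9 := by linarith
        exact mul_le_mul_of_nonneg_right (by norm_num) (by positivity)

theorem rangeWeight_ge (H : Large K δ x) (hC0 : 0 < C) (hCK : 2000 * (1 + C) ≤ K * δ) (s : ℕ) :
    1 / Real.log x ≤ rangeWeight C δ x s := by
  have hL := H.log_gt
  unfold rangeWeight
  gcongr
  have h1 := le_scaleExp H.hδ s
  have h2 := H.loglog
  have h3 := H.hδ
  have h4 := H.hK
  nlinarith

theorem distProb_le_rangeWeight (H : Large K δ x) (hs : scaleExp δ (s + 1) ≤ 1 / 2) (hC0 : 0 < C)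
    (hCK : 2000 * (1 + C) ≤ K * δ)
    (hC : ∀ w z : ℝ, 2 ≤ w → w ≤ z → distProb (primesIoc w z) 1
      ≤ Real.log w / Real.log z * Real.exp (C / Real.log w)) :
    22 / 1000 * distProb
      (primeList (sieveStart δ x s + 1) (sieveLimit x - sieveStart δ x s)).toFinset 1
      ≤ rangeWeight C δ x s := by
  have h0 := H.distProb_le hs hC0 hCK hC
  have hL := H.log_gt
  refine (mul_le_mul_of_nonneg_left h0 (by norm_num)).trans ?_
  unfold rangeWeight
  rw [← mul_assoc, ← mul_div_assoc]
  gcongr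
  have h1 := le_scaleExp H.hδ s
  have h2 := H.loglog
  have h3 := H.hδ
  have h4 := H.hK
  have h5 : 5 / 2 * (K * δ) ≤ scaleExp δ s * Real.log (Real.log x) := by nlinarith
  linarith

theorem rangeWeight_le (H : Large K δ x) (hC0 : 0 < C) (hs : scaleExp δ s ≤ 1 / 2) :
    rangeWeight C δ x s ≤ 1 := by
  have hL := H.log_gt
  unfold rangeWeight
  rw [div_le_one (by linarith)]
  have h1 := H.const_mul_loglog_le
  have h2 := H.hK
  have h3 := H.logloglarge
  nlinarith

theorem rangeWeight_le_sum (H : Large K δ x) (hs : scaleExp δ (s + 1) ≤ 1 / 2) (hC0 : 0 < C)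
    (hC : ∀ w z : ℝ, 2 ≤ w → w ≤ z → Real.log (Real.log z / Real.log w) - C / Real.log w
      ≤ ∑ p ∈ primesIoc w z, 1 / (p : ℝ)) :
    rangeWeight C δ x s ≤ ∑ q ∈ primesIoc (cutoff δ x (s + 1)) (cutoff δ x s), 1 / (q : ℝ) := by
  have hL := H.log_gt
  have hK := H.hK
  have h1 := H.cutoff_antitone (Nat.le_succ s)
  have h2 : 2 ≤ cutoff δ x (s + 1) := by
    have := (H.const_le_rpow (by norm_num)).trans (H.rpow_le_cutoff hs)
    linarith
  refine le_trans ?_ (hC _ _ h2 h1)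
  have h3 := H.log_le_log_cutoff hs
  have h4 := H.log_cutoff_le s
  have h5 := H.log_cutoff s
  have h6 := H.log_cutoff (s + 1)
  rw [scaleExp_succ] at h6
  have hα := le_scaleExp H.hδ s
  have hδ := H.hδ
  have hℓ := H.logloglarge
  set a := Real.log (cutoff δ x s)
  set b := Real.log (cutoff δ x (s + 1))
  have hab : a - b = scaleExp δ s * Real.log (Real.log x) / 10 := by rw [h5, h6]; ring
  have hab0 : 0 < scaleExp δ s * Real.log (Real.log x) / 10 := by
    have : 0 < scaleExp δ s := by linarith
    positivity
  have hb : 0 < b := by linarith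
  have ha : 0 < a := by linarith
  have h7 : (a - b) / Real.log x ≤ Real.log (a / b) := by
    have := Real.one_sub_inv_le_log_of_pos (show 0 < a / b by positivity)
    rw [inv_div, one_sub_div ha.ne'] at this
    refine le_trans ?_ this
    have : 0 ≤ a - b := by linarith
    gcongr
  have h8 : C / b ≤ 2 * C / Real.log x := by
    rw [div_le_div_iff₀ hb (by linarith)]
    nlinarith
  unfold rangeWeight
  rw [sub_div, ← hab]
  linarith

end Large

namespace Large
variable {K δ x C P : ℝ} {s : ℕ}

theorem rpow_neg_le (H : Large K δ x) {a b : ℝ} (hb : 0 ≤ b) (hab : a ≤ 1000000 * b) :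
    x ^ (-b) ≤ Real.log x ^ (-a) := by
  have hL := H.log_gt
  rw [Real.rpow_neg H.pos.le, Real.rpow_neg (by linarith)]
  exact inv_anti₀ (by positivity) (H.log_rpow_le hb hab)

theorem inv_mul_inv_distProb_le (H : Large K δ x) (hs : scaleExp δ (s + 1) ≤ 1 / 2) (hCK : C ≤ K)
    (hC0 : 0 < C)
    (hC : ∀ w z : ℝ, 2 ≤ w → w ≤ z → ∑ p ∈ primesIoc w z, 1 / (p : ℝ)
      ≤ Real.log (Real.log z / Real.log w) + C / Real.log w) :
    1 / cutoff δ x (s + 1) * (distProb (primeList (sieveStart δ x s + 1)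
      (sieveLimit x - sieveStart δ x s)).toFinset (blockLen δ x s))⁻¹ ≤ x ^ (-(95 / 100) : ℝ) := by
  have hx := H.pos
  have h1 := H.inv_distProb_le hs hCK hC0 hC
  have h2 := H.rpow_le_cutoff hs
  have h3 := inv_nonneg.2 ((H.block hs hCK hC0 hC).distProb_pos le_rfl).le
  generalize (distProb _ _)⁻¹ = u at h1 h3 ⊢
  calc _ ≤ 1 / x ^ (999 / 1000 : ℝ) * x ^ (1 / 100 : ℝ) := by gcongr
    _ = x ^ (-(989 / 1000) : ℝ) := by
      rw [one_div, ← Real.rpow_neg hx.le, ← Real.rpow_add hx]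
      norm_num
    _ ≤ _ := Real.rpow_le_rpow_of_exponent_le H.one_lt.le (by norm_num)

theorem massErr_le (H : Large K δ x) (hs : scaleExp δ (s + 1) ≤ 1 / 2) (hCK : C ≤ K)
    (hC0 : 0 < C)
    (hC : ∀ w z : ℝ, 2 ≤ w → w ≤ z → ∑ p ∈ primesIoc w z, 1 / (p : ℝ)
      ≤ Real.log (Real.log z / Real.log w) + C / Real.log w) :
    massErr (primeList (sieveStart δ x s + 1) (sieveLimit x - sieveStart δ x s)) (blockLen δ x s)
      (sieveStart δ x s) (2 * Real.log (Real.log x)) (x ^ (1 / 4 : ℝ)) (x ^ (2 : ℝ))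
      (cutoff δ x (s + 1))
      ≤ 130 * Real.log (Real.log x) * Real.log x ^ (-(33 / 20) * scaleExp δ s) := by
  have hα : scaleExp δ s ≤ 1 / 2 := (scaleExp_mono H.hδ (Nat.le_succ s)).trans hs
  have h1 := (H.inv_mul_inv_distProb_le hs hCK hC0 hC).trans
    (H.rpow_neg_le (a := 33 / 20 * scaleExp δ s) (by norm_num) (by linarith))
  have h2 := (H.tailErr_le s).trans
    (H.rpow_neg_le (a := 33 / 20 * scaleExp δ s) (by norm_num) (by linarith))
  have h3 := H.smallErr_le s
  rw [← neg_mul] at h1 h2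
  have hℓ := H.logloglarge
  have hp : 0 < Real.log x ^ (-(33 / 20) * scaleExp δ s) := by
    have := H.log_gt
    positivity
  unfold massErr
  nlinarith

theorem progDensity_le (H : Large K δ x) (hs : scaleExp δ (s + 1) ≤ 1 / 2) :
    progDensity (cutoff δ x (s + 1)) (cutoff δ x s)
      ≤ 33 * Real.log x ^ (scaleExp δ s / 10 - 1) := by
  have hx := H.pos
  have hL := H.log_gt
  have hL0 : 0 < Real.log x := by linarith
  have h1 := H.log_le_log_cutoff hs
  have h2 : cutoff δ x s = cutoff δ x (s + 1) * Real.log x ^ (scaleExp δ s / 10) := by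
    unfold cutoff
    rw [scaleExp_succ, mul_assoc, ← Real.rpow_add hL0]
    ring_nf
  have h3 := H.cutoff_pos (s + 1)
  unfold progDensity
  rw [h2, Real.rpow_sub_one hL0.ne']
  calc 32 * (cutoff δ x (s + 1) * Real.log x ^ (scaleExp δ s / 10))
        / (cutoff δ x (s + 1) * Real.log (cutoff δ x (s + 1)))
      = 32 * Real.log x ^ (scaleExp δ s / 10) / Real.log (cutoff δ x (s + 1)) := by
        rw [mul_left_comm, mul_div_mul_left _ _ h3.ne']
    _ ≤ 32 * Real.log x ^ (scaleExp δ s / 10) / (999 / 1000 * Real.log x) := by gcongr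
    _ = 32000 / 999 * (Real.log x ^ (scaleExp δ s / 10) / Real.log x) := by field_simp; norm_num
    _ ≤ _ := mul_le_mul_of_nonneg_right (by norm_num) (by positivity)

theorem degErr_le (H : Large K δ x) (hs : scaleExp δ (s + 1) ≤ 1 / 2) (hCK : C ≤ K)
    (hC0 : 0 < C)
    (hC : ∀ w z : ℝ, 2 ≤ w → w ≤ z → ∑ p ∈ primesIoc w z, 1 / (p : ℝ)
      ≤ Real.log (Real.log z / Real.log w) + C / Real.log w) {τ : ℝ} (hτ : 0 ≤ τ) (hτ1 : τ ≤ 1) :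
    degErr (primeList (sieveStart δ x s + 1) (sieveLimit x - sieveStart δ x s)) (blockLen δ x s)
      (sieveStart δ x s) (2 * Real.log (Real.log x)) (x ^ (1 / 4 : ℝ)) (x ^ (2 : ℝ))
      (cutoff δ x (s + 1)) (cutoff δ x s) τ
      ≤ 2200 * Real.log (Real.log x) * Real.log x ^ (-(31 / 20) * scaleExp δ s - 1) := by
  have hα : scaleExp δ s ≤ 1 / 2 := (scaleExp_mono H.hδ (Nat.le_succ s)).trans hs
  have h1 := (H.inv_mul_inv_distProb_le hs hCK hC0 hC).trans
    (H.rpow_neg_le (a := 31 / 20 * scaleExp δ s + 1) (by norm_num) (by linarith))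
  have h2 := (H.tailErr_le s).trans
    (H.rpow_neg_le (a := 31 / 20 * scaleExp δ s + 1) (by norm_num) (by linarith))
  have hexp : -(31 / 20 * scaleExp δ s + 1) = -(31 / 20) * scaleExp δ s - 1 := by ring
  rw [hexp] at h1 h2
  have h3 := H.smallErr_le s
  have h4 := H.progDensity_le hs
  have hℓ := H.logloglarge
  have hL := H.log_gt
  have hp : 0 < Real.log x ^ (-(31 / 20) * scaleExp δ s - 1) := by positivity
  have h5 : progDensity (cutoff δ x (s + 1)) (cutoff δ x s) * smallErr (blockLen δ x s)
      (sieveStart δ x s) (2 * Real.log (Real.log x))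
      ≤ 33 * Real.log x ^ (scaleExp δ s / 10 - 1) * (64 * Real.log (Real.log x)
        * Real.log x ^ (-(33 / 20) * scaleExp δ s)) := by
    have : 0 ≤ smallErr (blockLen δ x s) (sieveStart δ x s) (2 * Real.log (Real.log x)) :=
      (H.block hs hCK hC0 hC).smallErr_nonneg
    gcongr
  have h6 : Real.log x ^ (scaleExp δ s / 10 - 1) * Real.log x ^ (-(33 / 20) * scaleExp δ s)
      = Real.log x ^ (-(31 / 20) * scaleExp δ s - 1) := by
    rw [← Real.rpow_add (by linarith)]
    ring_nf
  have h7 : τ * tailErr (x ^ (1 / 4 : ℝ)) (x ^ (2 : ℝ)) (sieveStart δ x s)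
      ≤ Real.log x ^ (-(31 / 20) * scaleExp δ s - 1) := by
    have : 0 ≤ tailErr (x ^ (1 / 4 : ℝ)) (x ^ (2 : ℝ)) (sieveStart δ x s) :=
      (H.block hs hCK hC0 hC).tailErr_nonneg
    nlinarith
  have h8 : 33 * Real.log x ^ (scaleExp δ s / 10 - 1) * (64 * Real.log (Real.log x)
        * Real.log x ^ (-(33 / 20) * scaleExp δ s))
      = 2112 * Real.log (Real.log x) * Real.log x ^ (-(31 / 20) * scaleExp δ s - 1) := by
    rw [← h6]; ring
  rw [h8] at h5
  unfold degErr
  nlinarith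

theorem badBound (H : Large K δ x) (hs : scaleExp δ (s + 1) ≤ 1 / 2) (hC0 : 0 < C)
    (hCK : C ≤ K) (hCδ : 2000 * (1 + C) ≤ K * δ) (hP : 0 < P) (hPK : 10 ^ 13 * (1 + P) ≤ K)
    (hC : ∀ w z : ℝ, 2 ≤ w → w ≤ z → ∑ p ∈ primesIoc w z, 1 / (p : ℝ)
      ≤ Real.log (Real.log z / Real.log w) + C / Real.log w)
    (hC' : ∀ w z : ℝ, 2 ≤ w → w ≤ z → distProb (primesIoc w z) 1
      ≤ Real.log w / Real.log z * Real.exp (C / Real.log w)) :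
    (3 * P * x * Real.log x ^ (δ - 1)) * (degErr (primeList (sieveStart δ x s + 1)
        (sieveLimit x - sieveStart δ x s)) (blockLen δ x s)
        (sieveStart δ x s) (2 * Real.log (Real.log x)) (x ^ (1 / 4 : ℝ)) (x ^ (2 : ℝ))
        (cutoff δ x (s + 1)) (cutoff δ x s)
        (99 / 2000 * rangeWeight C δ x s * (9 / 10) ^ roundCount δ x)
        / ((1 / 100) ^ 2 * (99 / 2000 * rangeWeight C δ x s * (9 / 10) ^ roundCount δ x)))
      + 2 * blockLen δ x s * cutoff δ x s * massErr (primeList (sieveStart δ x s + 1)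
        (sieveLimit x - sieveStart δ x s)) (blockLen δ x s)
        (sieveStart δ x s) (2 * Real.log (Real.log x)) (x ^ (1 / 4 : ℝ)) (x ^ (2 : ℝ))
        (cutoff δ x (s + 1))
        * distProb (primeList (sieveStart δ x s + 1)
          (sieveLimit x - sieveStart δ x s)).toFinset 1 / (1 / 100) ^ 3
      ≤ x * Real.log x ^ (-1 - δ) / (roundCount δ x * 116) := by
  have hx := H.pos
  have hL := H.log_gt
  have hL0 : 0 < Real.log x := by linarith
  have hℓ := H.logloglarge
  have hα : scaleExp δ s ≤ 1 / 2 := (scaleExp_mono H.hδ (Nat.le_succ s)).trans hs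
  have hαδ := le_scaleExp H.hδ s
  have hδ := H.hδ
  have hB := H.block hs hCK hC0 hC
  have hρ := H.rangeWeight_ge hC0 hCδ s
  have hρ0 : 0 < rangeWeight C δ x s := lt_of_lt_of_le (by positivity) hρ
  have hρ1 := H.rangeWeight_le hC0 hα
  have hp := H.inv_nine_tenths_pow_le
  have hp1 : (9 / 10 : ℝ) ^ roundCount δ x ≤ 1 := pow_le_one₀ (by norm_num) (by norm_num)
  have hp0 : (0 : ℝ) < (9 / 10) ^ roundCount δ x := by positivity
  have hm := H.roundCount_le (by linarith)
  have hm0 : (0 : ℝ) < roundCount δ x := by exact_mod_cast H.one_le_roundCount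
  have hσ : distProb (primeList (sieveStart δ x s + 1)
      (sieveLimit x - sieveStart δ x s)).toFinset 1 ≤ 3 * Real.log (Real.log x) / Real.log x := by
    refine (H.distProb_le hs hC0 hCδ hC').trans ?_
    rw [← mul_div_assoc]
    exact div_le_div_of_nonneg_right (by nlinarith) hL0.le
  have hσ0 := (hB.distProb_pos hB.hh).le
  have hmass := H.massErr_le hs hCK hC0 hC
  have hmass0 : 0 ≤ massErr (primeList (sieveStart δ x s + 1)
        (sieveLimit x - sieveStart δ x s)) (blockLen δ x s)
        (sieveStart δ x s) (2 * Real.log (Real.log x)) (x ^ (1 / 4 : ℝ)) (x ^ (2 : ℝ))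
        (cutoff δ x (s + 1)) := by
    have h1 := hB.smallErr_nonneg
    have h2 := hB.tailErr_nonneg
    have h3 := hB.distProb_pos le_rfl
    have h4 := H.cutoff_pos (s + 1)
    unfold massErr
    have h5 := mul_nonneg (one_div_nonneg.2 h4.le) (inv_nonneg.2 h3.le)
    linarith
  have hh := H.blockLen_le s
  generalize hτ : 99 / 2000 * rangeWeight C δ x s * (9 / 10) ^ roundCount δ x = τ
  have hτ0 : 0 < τ := by rw [← hτ]; positivity
  have hτ1 : τ ≤ 1 := by rw [← hτ]; nlinarith
  have hdeg := H.degErr_le hs hCK hC0 hC hτ0.le hτ1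
  have hτinv : 1 / ((1 / 100) ^ 2 * τ) ≤ 500000 * Real.log x ^ (1 + 6 / 5 * δ) := by
    rw [← hτ]
    calc 1 / ((1 / 100) ^ 2 * (99 / 2000 * rangeWeight C δ x s * (9 / 10) ^ roundCount δ x))
        = 20000000 / 99 * (1 / rangeWeight C δ x s) * ((9 / 10) ^ roundCount δ x)⁻¹ := by
          field_simp; norm_num
      _ ≤ 20000000 / 99 * Real.log x * (2 * Real.log x ^ (6 / 5 * δ)) := by
          have : 1 / rangeWeight C δ x s ≤ Real.log x := by
            rw [div_le_iff₀ hρ0]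
            rw [div_le_iff₀ hL0] at hρ
            linarith
          gcongr
      _ = 40000000 / 99 * Real.log x ^ (1 + 6 / 5 * δ) := by
          rw [Real.rpow_add hL0, Real.rpow_one]; ring
      _ ≤ _ := mul_le_mul_of_nonneg_right (by norm_num) (by positivity)
  generalize degErr _ _ _ _ _ _ _ _ _ = d at hdeg ⊢
  generalize massErr _ _ _ _ _ _ _ = e at hmass hmass0 ⊢
  generalize distProb _ 1 = σ at hσ hσ0 ⊢
  have hfirst : (3 * P * x * Real.log x ^ (δ - 1)) * (d / ((1 / 100) ^ 2 * τ))
      ≤ 3300000000 * P * Real.log (Real.log x) * (x * Real.log x ^ (-1 - 11 / 10 * δ)) := by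
    rw [div_eq_mul_one_div]
    calc _ ≤ (3 * P * x * Real.log x ^ (δ - 1)) *
          ((2200 * Real.log (Real.log x) * Real.log x ^ (-(31 / 20) * scaleExp δ s - 1))
            * (500000 * Real.log x ^ (1 + 6 / 5 * δ))) := by gcongr
      _ = 3300000000 * P * Real.log (Real.log x) * (x * (Real.log x ^ (δ - 1)
          * Real.log x ^ (-(31 / 20) * scaleExp δ s - 1) * Real.log x ^ (1 + 6 / 5 * δ))) := by ring
      _ ≤ _ := by
        rw [← Real.rpow_add hL0, ← Real.rpow_add hL0]
        gcongr
        · exact hL.le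
        · linarith
  have hsecond : 2 * blockLen δ x s * cutoff δ x s * e * σ / (1 / 100) ^ 3
      ≤ 1560000000 * Real.log (Real.log x) ^ 2 * (x * Real.log x ^ (-1 - 11 / 10 * δ)) := by
    calc _ ≤ 2 * (2 * Real.log x ^ scaleExp δ (s + 1)) * (x * Real.log x ^ (δ - scaleExp δ s))
          * (130 * Real.log (Real.log x) * Real.log x ^ (-(33 / 20) * scaleExp δ s))
          * (3 * Real.log (Real.log x) / Real.log x) / (1 / 100) ^ 3 := by
          unfold cutoff
          gcongr
      _ = 1560000000 * Real.log (Real.log x) ^ 2 * (x * (Real.log x ^ scaleExp δ (s + 1)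
          * Real.log x ^ (δ - scaleExp δ s) * Real.log x ^ (-(33 / 20) * scaleExp δ s)
          * Real.log x ^ (-1 : ℝ))) := by
          rw [Real.rpow_neg_one]; ring
      _ ≤ _ := by
        rw [← Real.rpow_add hL0, ← Real.rpow_add hL0, ← Real.rpow_add hL0, scaleExp_succ]
        gcongr
        · exact hL.le
        · linarith
  refine (add_le_add hfirst hsecond).trans ?_
  rw [le_div_iff₀ (by positivity)]
  have hsplit : Real.log x ^ (-1 - δ) = Real.log x ^ (-1 - 11 / 10 * δ) * Real.log x ^ (δ / 10) := by
    rw [← Real.rpow_add hL0]; ring_nf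
  rw [hsplit]
  have hpow := H.pow
  have hsq : Real.log (Real.log x) ≤ Real.log (Real.log x) ^ 2 :=
    le_self_pow₀ (by linarith) (by norm_num)
  set u := x * Real.log x ^ (-1 - 11 / 10 * δ) with hu
  have hu0 : 0 < u := by positivity
  calc (3300000000 * P * Real.log (Real.log x) * u + 1560000000 * Real.log (Real.log x) ^ 2 * u)
        * (roundCount δ x * 116)
      ≤ (3300000000 * P * Real.log (Real.log x) ^ 2 * u
        + 1560000000 * Real.log (Real.log x) ^ 2 * u) * (3 * Real.log (Real.log x) * 116) := by
        gcongr
    _ = (1148400000000 * P + 542880000000) * Real.log (Real.log x) ^ 3 * u := by ring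
    _ ≤ K * Real.log (Real.log x) ^ 3 * u := by
        gcongr
        linarith
    _ ≤ Real.log x ^ (δ / 10) * u := by gcongr
    _ = _ := by rw [hu]; ring

end Large

namespace Large
variable {K δ x C P A : ℝ} {s : ℕ}

theorem const_mul_rpow_le (H : Large K δ x) {a b : ℝ} (hA : A ≤ K) (hab : a + 1 / 1000 ≤ b) :
    A * x ^ a ≤ x ^ b := by
  have hx := H.pos
  calc A * x ^ a ≤ x ^ (1 / 1000 : ℝ) * x ^ a := by
        gcongr
        exact hA.trans (H.const_le_rpow le_rfl)
    _ = x ^ (a + 1 / 1000) := by rw [← Real.rpow_add hx, add_comm]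
    _ ≤ _ := Real.rpow_le_rpow_of_exponent_le H.one_lt.le hab

theorem thousand_mul_rpow_le_one (H : Large K δ x) {a : ℝ} (ha : a ≤ -(1 / 1000)) :
    1000 * x ^ a ≤ 1 := by
  simpa using H.const_mul_rpow_le (b := 0) H.hK (by linarith)

theorem rpow_mul_rpow_le (H : Large K δ x) {a b c : ℝ} (h : a + b ≤ c) : x ^ a * x ^ b ≤ x ^ c := by
  rw [← Real.rpow_add H.pos]
  exact Real.rpow_le_rpow_of_exponent_le H.one_lt.le h

theorem maxLen_le_rpow (H : Large K δ x) : (maxLen x : ℝ) ≤ x ^ (1 / 100 : ℝ) := by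
  refine H.maxLen_le.trans (le_trans ?_ (H.log_le_x_rpow (by norm_num)))
  have h1 := H.const_mul_sqrt_le
  have h2 := H.one_le_sqrt
  have h3 := H.hK
  nlinarith

theorem roundCount_le_rpow (H : Large K δ x) (hδ : δ ≤ 1 / 5) :
    (roundCount δ x : ℝ) ≤ x ^ (1 / 100 : ℝ) := by
  refine (H.roundCount_le hδ).trans (le_trans ?_ (H.log_le_x_rpow (by norm_num)))
  have h1 := H.const_mul_loglog_le
  have h2 := H.logloglarge
  have h3 := H.hK
  nlinarith

theorem inv_nine_tenths_pow_le_rpow (H : Large K δ x) (hδ : δ ≤ 1 / 5) :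
    ((9 / 10 : ℝ) ^ roundCount δ x)⁻¹ ≤ x ^ (1 / 100 : ℝ) := by
  refine H.inv_nine_tenths_pow_le.trans
    (le_trans ?_ (H.log_rpow_le (a := 2) (by norm_num) (by norm_num)))
  have hL := H.log_gt
  have h1 := H.hK.trans H.const_le_log
  have h2 : Real.log x ^ (6 / 5 * δ) ≤ Real.log x ^ (1 : ℝ) :=
    Real.rpow_le_rpow_of_exponent_le hL.le (by linarith)
  rw [Real.rpow_one] at h2
  rw [Real.rpow_two]
  nlinarith

theorem ceil_le (H : Large K δ x) : (⌈x⌉₊ : ℝ) ≤ 2 * x := by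
  linarith [Nat.ceil_lt_add_one H.pos.le, H.one_lt]

theorem maxLen_mul_rpow_le (H : Large K δ x) :
    maxLen x * x ^ (-(9 / 10) : ℝ) ≤ x ^ (-(89 / 100) : ℝ) := by
  have hx := H.pos
  calc _ ≤ x ^ (1 / 100 : ℝ) * x ^ (-(9 / 10) : ℝ) := by
        gcongr
        exact H.maxLen_le_rpow
    _ ≤ _ := H.rpow_mul_rpow_le (by norm_num)

theorem one_div_gapLen_mul_le (H : Large K δ x) (hδ : δ ≤ 1 / 5) :
    1 / (gapLen δ x : ℝ) * ((9 / 10 : ℝ) ^ roundCount δ x)⁻¹ ≤ x ^ (-(9 / 10) : ℝ) := by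
  have hx := H.pos
  have h1 := H.inv_nine_tenths_pow_le_rpow hδ
  have h2 : 1 / (gapLen δ x : ℝ) ≤ x ^ (-1 : ℝ) := by
    rw [Real.rpow_neg_one, one_div]
    exact inv_anti₀ hx H.le_gapLen
  calc _ ≤ x ^ (-1 : ℝ) * x ^ (1 / 100 : ℝ) := by gcongr
    _ ≤ _ := H.rpow_mul_rpow_le (by norm_num)

theorem ceil_mul_sq_le (H : Large K δ x) :
    2 * (⌈x⌉₊ : ℝ) * (maxLen x * x ^ (-(9 / 10) : ℝ)) ^ 2 ≤ x ^ (-(1 / 2) : ℝ) := by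
  have hx := H.pos
  have h1 := H.maxLen_mul_rpow_le
  have h2 := H.ceil_le
  calc _ ≤ 2 * (2 * x) * (x ^ (-(89 / 100) : ℝ)) ^ 2 := by gcongr
    _ = 4 * (x ^ (1 : ℝ) * x ^ (-(178 / 100) : ℝ)) := by
      rw [Real.rpow_one, ← Real.rpow_natCast, ← Real.rpow_mul hx.le]
      norm_num
      ring
    _ ≤ 4 * x ^ (-(78 / 100) : ℝ) := by
      gcongr
      exact H.rpow_mul_rpow_le (by norm_num)
    _ ≤ _ := H.const_mul_rpow_le (by linarith [H.hK]) (by norm_num)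

theorem roundCount_fin (H : Large K δ x) (hδ : δ ≤ 1 / 5) :
    (1 / 9) * (1 + roundCount δ x * x ^ (-(1 / 4) : ℝ))
      ≤ (7 / 60) * (1 - roundCount δ x * x ^ (-(1 / 2) : ℝ))
        - roundCount δ x * x ^ (-(1 / 4) : ℝ) * ((9 / 10 : ℝ) ^ roundCount δ x)⁻¹ := by
  have hx := H.pos
  have hm := H.roundCount_le_rpow hδ
  have hp := H.inv_nine_tenths_pow_le_rpow hδ
  have h1 : roundCount δ x * x ^ (-(1 / 4) : ℝ) ≤ x ^ (-(24 / 100) : ℝ) :=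
    (mul_le_mul_of_nonneg_right hm (by positivity)).trans (H.rpow_mul_rpow_le (by norm_num))
  have h2 : roundCount δ x * x ^ (-(1 / 2) : ℝ) ≤ x ^ (-(49 / 100) : ℝ) :=
    (mul_le_mul_of_nonneg_right hm (by positivity)).trans (H.rpow_mul_rpow_le (by norm_num))
  have h3 : roundCount δ x * x ^ (-(1 / 4) : ℝ) * ((9 / 10 : ℝ) ^ roundCount δ x)⁻¹
      ≤ x ^ (-(23 / 100) : ℝ) :=
    (mul_le_mul h1 hp (by positivity) (by positivity)).trans (H.rpow_mul_rpow_le (by norm_num))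
  linarith [H.thousand_mul_rpow_le_one (a := -(24 / 100)) (by norm_num),
    H.thousand_mul_rpow_le_one (a := -(49 / 100)) (by norm_num),
    H.thousand_mul_rpow_le_one (a := -(23 / 100)) (by norm_num)]

theorem rpow_third_mul_le (H : Large K δ x) :
    x ^ (1 / 3 : ℝ) * (2 * maxLen x * x ^ (-(9 / 10) : ℝ)) ≤ 2 * x ^ (-(55 / 100) : ℝ) := by
  have hx := H.pos
  calc _ = 2 * (x ^ (1 / 3 : ℝ) * (maxLen x * x ^ (-(9 / 10) : ℝ))) := by ring
    _ ≤ 2 * (x ^ (1 / 3 : ℝ) * x ^ (-(89 / 100) : ℝ)) := by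
      gcongr
      exact H.maxLen_mul_rpow_le
    _ ≤ _ := by
      gcongr
      exact H.rpow_mul_rpow_le (by norm_num)

theorem union_bound (H : Large K δ x) (hδ : δ ≤ 1 / 5) :
    2 * (roundCount δ x * (⌈x⌉₊ : ℝ) + roundCount δ x * gapLen δ x + 1)
      * Real.exp (⌈x⌉₊ * (x ^ (1 / 3 : ℝ) * (2 * maxLen x * x ^ (-(9 / 10) : ℝ))) ^ 2
        - x ^ (1 / 3 : ℝ) * x ^ (-(1 / 4) : ℝ)) < 1 := by
  have hx := H.pos
  have hL := H.hK.trans H.const_le_log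
  have hm := H.roundCount_le_rpow hδ
  have hn := H.ceil_le
  have hy := H.gapLen_le_rpow (by linarith)
  have h1 : (⌈x⌉₊ : ℝ) * (x ^ (1 / 3 : ℝ) * (2 * maxLen x * x ^ (-(9 / 10) : ℝ))) ^ 2 ≤ 1 := by
    have h2 := H.rpow_third_mul_le
    have h3 := H.thousand_mul_rpow_le_one (a := -(1 / 10)) (by norm_num)
    calc _ ≤ 2 * x * (2 * x ^ (-(55 / 100) : ℝ)) ^ 2 := by gcongr
      _ = 8 * (x ^ (1 : ℝ) * x ^ (-(11 / 10) : ℝ)) := by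
        rw [Real.rpow_one, mul_pow, ← Real.rpow_natCast, ← Real.rpow_natCast,
          ← Real.rpow_mul hx.le]
        norm_num
        ring
      _ ≤ 8 * x ^ (-(1 / 10) : ℝ) := by
        gcongr
        exact H.rpow_mul_rpow_le (by norm_num)
      _ ≤ 1 := by linarith [Real.rpow_pos_of_pos hx (-(1 / 10))]
  have h2 : x ^ (1 / 3 : ℝ) * x ^ (-(1 / 4) : ℝ) = x ^ (1 / 12 : ℝ) := by
    rw [← Real.rpow_add hx]; norm_num
  have h3 : 2 * (roundCount δ x * (⌈x⌉₊ : ℝ) + roundCount δ x * gapLen δ x + 1) ≤ x ^ (2 : ℝ) := by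
    have h4 : roundCount δ x * (⌈x⌉₊ : ℝ) ≤ 2 * x ^ (102 / 100 : ℝ) := by
      calc _ ≤ x ^ (1 / 100 : ℝ) * (2 * x ^ (1 : ℝ)) := by rw [Real.rpow_one]; gcongr
        _ = 2 * (x ^ (1 / 100 : ℝ) * x ^ (1 : ℝ)) := by ring
        _ ≤ _ := by
          gcongr
          exact H.rpow_mul_rpow_le (by norm_num)
    have h5 : (roundCount δ x : ℝ) * gapLen δ x ≤ x ^ (102 / 100 : ℝ) := by
      calc _ ≤ x ^ (1 / 100 : ℝ) * x ^ (1 + 1 / 100 : ℝ) := by gcongr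
        _ ≤ _ := H.rpow_mul_rpow_le (by norm_num)
    have h6 : 1 ≤ x ^ (102 / 100 : ℝ) := Real.one_le_rpow H.one_lt.le (by norm_num)
    have h7 := H.const_mul_rpow_le (A := 8) (a := 102 / 100) (b := 2) (by linarith [H.hK])
      (by norm_num)
    linarith
  have h8 : Real.log x ^ (2 : ℝ) ≤ x ^ (1 / 12 : ℝ) := H.log_rpow_le (by norm_num) (by norm_num)
  rw [Real.rpow_two] at h8
  rw [h2]
  calc _ ≤ x ^ (2 : ℝ) * Real.exp (1 - x ^ (1 / 12 : ℝ)) := by gcongr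
    _ = Real.exp (2 * Real.log x + (1 - x ^ (1 / 12 : ℝ))) := by rw [H.rpow_eq 2, Real.exp_add]
    _ < 1 := by
      rw [Real.exp_lt_one_iff]
      nlinarith

theorem roundCount_le_rangeWeight_mul (H : Large K δ x) (hδ : δ ≤ 1 / 5)
    (hs : scaleExp δ (s + 1) ≤ 1 / 2) (hC0 : 0 < C) (hCδ : 2000 * (1 + C) ≤ K * δ) :
    200 * (roundCount δ x : ℝ) ≤ rangeWeight C δ x s * cutoff δ x (s + 1) := by
  have hx := H.pos
  have hL0 : 0 < Real.log x := by linarith [H.log_gt]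
  have hm := H.roundCount_le_rpow hδ
  have hL := H.log_le_x_rpow (b := 1 / 100) (by norm_num)
  have hρ := H.rangeWeight_ge hC0 hCδ s
  have hY := H.rpow_le_cutoff hs
  refine le_trans ?_ (mul_le_mul hρ hY (by positivity) (le_trans (by positivity) hρ))
  rw [one_div_mul_eq_div, le_div_iff₀ hL0]
  calc _ ≤ 200 * x ^ (1 / 100 : ℝ) * x ^ (1 / 100 : ℝ) := by gcongr
    _ ≤ 200 * x ^ (1 / 50 : ℝ) := by
      rw [mul_assoc]
      gcongr
      exact H.rpow_mul_rpow_le (by norm_num)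
    _ ≤ _ := H.const_mul_rpow_le (by linarith [H.hK]) (by norm_num)

theorem gapLen_mul_distProb_le (H : Large K δ x) (hP : 0 < P)
    (hP' : ∀ z : ℕ, 2 ≤ z → distProb (primeList 0 (z + 1)).toFinset 1 ≤ P / Real.log z) :
    gapLen δ x * distProb (primeList 0 (sieveLimit x + 1)).toFinset 1
      ≤ 3 * P * x * Real.log x ^ (δ - 1) := by
  have hx := H.pos
  have hL0 : 0 < Real.log x := by linarith [H.log_gt]
  have hz : 2 ≤ sieveLimit x := by
    have h1 := H.hK.trans ((H.const_le_rpow (b := 98 / 100) (by norm_num)).trans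
      H.rpow_le_sieveLimit)
    have h2 : 1000 ≤ sieveLimit x := by exact_mod_cast h1
    omega
  have h1 : distProb (primeList 0 (sieveLimit x + 1)).toFinset 1
      ≤ P / (98 / 100 * Real.log x) := by
    refine (hP' _ hz).trans ?_
    have := H.log_sieveLimit_ge
    gcongr
  have h2 := H.gapLen_le
  calc _ ≤ (gapLen δ x : ℝ) * (P / (98 / 100 * Real.log x)) := by gcongr
    _ ≤ 2 * (x * Real.log x ^ δ) * (P / (98 / 100 * Real.log x)) := by gcongr
    _ = 100 / 49 * (P * x * (Real.log x ^ δ / Real.log x)) := by field_simp; norm_num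
    _ ≤ 3 * (P * x * (Real.log x ^ δ / Real.log x)) :=
      mul_le_mul_of_nonneg_right (by norm_num) (by positivity)
    _ = _ := by rw [Real.rpow_sub_one hL0.ne']; ring

theorem le_log_rpow (H : Large K δ x) {a : ℝ} (ha : δ / 10 ≤ a) : K ≤ Real.log x ^ a := by
  have h1 := H.logloglarge
  have h2 := H.hK
  calc K ≤ K * Real.log (Real.log x) ^ 3 :=
        le_mul_of_one_le_right (by linarith) (one_le_pow₀ (by linarith))
    _ ≤ _ := H.pow
    _ ≤ _ := Real.rpow_le_rpow_of_exponent_le H.log_gt.le ha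

theorem card_primesIoc_ge (H : Large K δ x) (hA1 : 1 ≤ A) (hAK : A ≤ K)
    (hA : ∀ x : ℝ, A ≤ x → 1 < x → x / (A * Real.log x) ≤ (primesIoc (x / A) x).card) :
    x / (A * Real.log x) ≤ (primesIoc (cutoff δ x 0) x).card := by
  have hx := H.pos
  have hL := H.log_gt
  have hL0 : 0 < Real.log x := by linarith
  have hAx : A ≤ x := by
    have := H.const_le_rpow (b := 1) (by norm_num)
    rw [Real.rpow_one] at this
    linarith
  refine (hA x hAx H.one_lt).trans ?_
  have h1 : cutoff δ x 0 ≤ x / A := by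
    have h2 : A ≤ Real.log x ^ (3 / 2 * δ) := hAK.trans (H.le_log_rpow (by linarith [H.hδ]))
    have h3 : δ - scaleExp δ 0 = -(3 / 2 * δ) := by
      simp only [scaleExp, pow_zero]; ring
    rw [cutoff, h3, Real.rpow_neg hL0.le, ← div_eq_mul_inv]
    gcongr
  have h2 := H.cutoff_pos 0
  norm_cast
  refine Finset.card_le_card fun p hp => ?_
  rw [mem_primesIoc (by positivity) hx.le] at hp ⊢
  exact ⟨hp.1, h1.trans_lt hp.2.1, hp.2.2⟩

theorem final_count (H : Large K δ x) (hδ : δ ≤ 1 / 5) (hP : 0 < P) (hA1 : 1 ≤ A)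
    (hAK : 2 * (24 * P + 9) * A ≤ K)
    (hA : ∀ x : ℝ, A ≤ x → 1 < x → x / (A * Real.log x) ≤ (primesIoc (x / A) x).card) :
    2 * ((9 / 10 : ℝ) ^ roundCount δ x * (8 * (3 * P * x * Real.log x ^ (δ - 1))
      + roundCount δ x * x ^ (-(1 / 4) : ℝ) * gapLen δ x) + 8 * (x * Real.log x ^ (-1 - δ)))
      ≤ (primesIoc (cutoff δ x 0) x).card := by
  have hx := H.pos
  have hL := H.log_gt
  have hL0 : 0 < Real.log x := by linarith
  have hK0 : 0 < K := by linarith [H.hK]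
  refine le_trans ?_ (H.card_primesIoc_ge hA1 (by nlinarith) hA)
  have h1 : roundCount δ x * x ^ (-(1 / 4) : ℝ) * gapLen δ x ≤ x * Real.log x ^ (δ - 1) := by
    have h2 : 2 * (roundCount δ x * x ^ (-(1 / 4) : ℝ)) ≤ Real.log x ^ (-1 : ℝ) := by
      calc _ ≤ 2 * (x ^ (1 / 100 : ℝ) * x ^ (-(1 / 4) : ℝ)) := by
            gcongr
            exact H.roundCount_le_rpow hδ
        _ ≤ 2 * x ^ (-(24 / 100) : ℝ) := by
            gcongr
            exact H.rpow_mul_rpow_le (by norm_num)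
        _ ≤ x ^ (-(1 / 10) : ℝ) := H.const_mul_rpow_le (by linarith [H.hK]) (by norm_num)
        _ ≤ _ := H.rpow_neg_le (by norm_num) (by norm_num)
    calc _ ≤ roundCount δ x * x ^ (-(1 / 4) : ℝ) * (2 * (x * Real.log x ^ δ)) := by
          gcongr
          exact H.gapLen_le
      _ = 2 * (roundCount δ x * x ^ (-(1 / 4) : ℝ)) * (x * Real.log x ^ δ) := by ring
      _ ≤ Real.log x ^ (-1 : ℝ) * (x * Real.log x ^ δ) := by gcongr
      _ = x * (Real.log x ^ δ * Real.log x ^ (-1 : ℝ)) := by ring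
      _ = _ := by rw [← Real.rpow_add hL0, sub_eq_add_neg]
  have h2 := H.nine_tenths_pow_le
  have h3 : Real.log x ^ (-(δ / 5) : ℝ) ≤ 1 / K := by
    rw [Real.rpow_neg hL0.le, ← one_div]
    exact one_div_le_one_div_of_le hK0 (H.le_log_rpow (by linarith [H.hδ]))
  have h4 : Real.log x ^ (-(6 / 5) * δ) * Real.log x ^ (δ - 1)
      = Real.log x ^ (-(δ / 5)) / Real.log x := by
    rw [← Real.rpow_add hL0, ← Real.rpow_sub_one hL0.ne']
    ring_nf
  have h5 : Real.log x ^ (-1 - δ) ≤ Real.log x ^ (-(δ / 5)) / Real.log x := by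
    rw [← Real.rpow_sub_one hL0.ne']
    exact Real.rpow_le_rpow_of_exponent_le hL.le (by linarith [H.hδ])
  calc _ ≤ 2 * (Real.log x ^ (-(6 / 5) * δ) * (8 * (3 * P * x * Real.log x ^ (δ - 1))
        + x * Real.log x ^ (δ - 1)) + 8 * (x * (Real.log x ^ (-(δ / 5)) / Real.log x))) := by
        gcongr
    _ = 2 * ((24 * P + 1) * x * (Real.log x ^ (-(6 / 5) * δ) * Real.log x ^ (δ - 1))
        + 8 * (x * (Real.log x ^ (-(δ / 5)) / Real.log x))) := by ring
    _ = 2 * (24 * P + 9) * (x / Real.log x) * Real.log x ^ (-(δ / 5)) := by rw [h4]; ring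
    _ ≤ 2 * (24 * P + 9) * (x / Real.log x) * (1 / K) := by gcongr
    _ = (2 * (24 * P + 9) / K) * (x / Real.log x) := by ring
    _ ≤ (1 / A) * (x / Real.log x) := by
        refine mul_le_mul_of_nonneg_right ?_ (by positivity)
        rw [div_le_div_iff₀ hK0 (by linarith)]
        linarith
    _ = _ := by field_simp

theorem params (H : Large K δ x) (hs : ∀ s < 116, scaleExp δ (s + 1) ≤ 1 / 2) (hC0 : 0 < C)
    (hCK : C ≤ K) (hCδ : 2000 * (1 + C) ≤ K * δ) (hP : 0 < P) (hPK : 10 ^ 13 * (1 + P) ≤ K)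
    (hA1 : 1 ≤ A) (hAK : 2 * (24 * P + 9) * A ≤ K)
    (hCl : ∀ w z : ℝ, 2 ≤ w → w ≤ z → Real.log (Real.log z / Real.log w) - C / Real.log w
      ≤ ∑ p ∈ primesIoc w z, 1 / (p : ℝ))
    (hCu : ∀ w z : ℝ, 2 ≤ w → w ≤ z → ∑ p ∈ primesIoc w z, 1 / (p : ℝ)
      ≤ Real.log (Real.log z / Real.log w) + C / Real.log w)
    (hCd : ∀ w z : ℝ, 2 ≤ w → w ≤ z → distProb (primesIoc w z) 1
      ≤ Real.log w / Real.log z * Real.exp (C / Real.log w))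
    (hPd : ∀ z : ℕ, 2 ≤ z → distProb (primeList 0 (z + 1)).toFinset 1 ≤ P / Real.log z)
    (hA : ∀ x : ℝ, A ≤ x → 1 < x → x / (A * Real.log x) ≤ (primesIoc (x / A) x).card) :
    Params x (gapLen δ x) (sieveLimit x) (roundCount δ x) ⌈x⌉₊ (maxLen x) (sieveStart δ x)
      (blockLen δ x) (cutoff δ x) (rangeWeight C δ x) (2 * Real.log (Real.log x))
      (x ^ (1 / 4 : ℝ)) (x ^ (2 : ℝ)) (x ^ (-(95 / 100) : ℝ)) (x ^ (-(9 / 10) : ℝ))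
      (x ^ (-(1 / 2) : ℝ)) (x ^ (-(1 / 4) : ℝ)) (x ^ (1 / 3 : ℝ))
      (3 * P * x * Real.log x ^ (δ - 1)) (x * Real.log x ^ (-1 - δ)) := by
  have hx := H.pos
  have hL0 : 0 < Real.log x := by linarith [H.log_gt]
  have hδ : δ ≤ 1 / 5 := by
    linarith [le_scaleExp H.hδ (0 + 1), hs 0 (by norm_num)]
  have hle : ∀ {a : ℝ}, a ≤ 0 → x ^ a ≤ 1 := fun ha =>
    Real.rpow_le_one_of_one_le_of_nonpos H.one_lt.le ha
  exact {
    hW := fun s h => H.sieveStart_le (hs s h)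
    block := fun s h => H.block (hs s h) hCK hC0 hCu
    hzY := fun s h => H.sieveLimit_le_cutoff (hs s h)
    anti := H.cutoff_antitone
    hY0 := H.cutoff_le 0
    hr1 := by unfold maxLen; omega
    hr := fun s h => H.blockLen_le_maxLen (hs s h)
    hy := fun s h => by
      refine (H.gapLen_le_rpow (by linarith)).trans ?_
      calc x ^ (1 + 1 / 100 : ℝ) ≤ x ^ (999 / 1000 * (2 : ℕ) : ℝ) :=
            Real.rpow_le_rpow_of_exponent_le H.one_lt.le (by norm_num)
        _ = (x ^ (999 / 1000 : ℝ)) ^ 2 := by rw [Real.rpow_mul hx.le, Real.rpow_natCast]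
        _ ≤ _ := pow_le_pow_left₀ (by positivity) (H.rpow_le_cutoff (hs s h)) 2
    hn := fun s _ => (H.cutoff_le s).trans (Nat.le_ceil x)
    hΩ := fun s h => by
      rw [div_eq_mul_one_div, mul_comm]
      exact H.inv_mul_inv_distProb_le (hs s h) hCK hC0 hCu
    hΩ0 := by positivity
    hy0 := by exact_mod_cast hx.trans_le H.le_gapLen
    hcΩ := (mul_le_mul_of_nonneg_left (H.inv_nine_tenths_pow_mul_le hδ) (by positivity)).trans
      (H.rpow_mul_rpow_le (by norm_num))
    hcY := H.one_div_gapLen_mul_le hδ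
    hc1 := hle (by norm_num)
    hrc := by
      linarith [H.maxLen_mul_rpow_le,
        H.thousand_mul_rpow_le_one (a := -(89 / 100)) (by norm_num)]
    ht := by positivity
    hη := H.ceil_mul_sq_le
    hη1 := hle (by norm_num)
    hfin := H.roundCount_fin hδ
    hL0 := by positivity
    hL := by
      linarith [H.rpow_third_mul_le,
        H.thousand_mul_rpow_le_one (a := -(55 / 100)) (by norm_num)]
    hsmall := H.union_bound hδ
    hρ0 := fun s _ => lt_of_lt_of_le (by positivity) (H.rangeWeight_ge hC0 hCδ s)
    hρ := fun s h => H.rangeWeight_le_sum (hs s h) hC0 hCl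
    hρm := fun s h => H.roundCount_le_rangeWeight_mul hδ (hs s h) hC0 hCδ
    hρσ := fun s h => H.distProb_le_rangeWeight (hs s h) hC0 hCδ hCd
    hN := by positivity
    hE := by positivity
    hyN := H.gapLen_mul_distProb_le hP hPd
    hbad := fun s h => H.badBound (hs s h) hC0 hCK hCδ hP hPK hCu hCd
    hfinal := H.final_count hδ hP hA1 hAK hA }

end Large

theorem exists_int_of_large_gap {δ : ℝ} (hδ0 : 0 < δ)
    (hδ : 12 * (10 : ℝ) ^ (2 * δ) < Real.log (1 / (2 * δ))) :
    ∃ x₀ : ℝ, ∀ x ≥ x₀, ∀ N : ℤ, ∃ b : ℤ,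
      (∀ n : ℤ, 1 ≤ n → n ≤ (gapLen δ x : ℤ) →
        ∃ p : ℕ, p.Prime ∧ (p : ℝ) ≤ x ∧ (p : ℤ) ∣ (n - b)) ∧
      (∀ n : ℤ, -(gapLen δ x : ℤ) ≤ n → n ≤ -1 →
        ∃ p : ℕ, p.Prime ∧ (p : ℝ) ≤ x ∧ (p : ℤ) ∣ (n + N + b)) := by
  obtain ⟨C₁, hC₁, h₁⟩ := exists_sum_primesIoc_le
  obtain ⟨C₂, hC₂, h₂⟩ := exists_distProb_primesIoc_le
  obtain ⟨P, hP, hPd⟩ := exists_distProb_primeList_le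
  obtain ⟨A, hA1, hA⟩ := exists_le_card_primesIoc
  set C := C₁ + C₂ with hC
  have hlog : ∀ {w : ℝ}, 2 ≤ w → 0 < Real.log w := fun hw => Real.log_pos (by linarith)
  have hle : ∀ {w : ℝ}, 2 ≤ w → C₁ / Real.log w ≤ C / Real.log w ∧
      C₂ / Real.log w ≤ C / Real.log w := fun hw =>
    ⟨div_le_div_of_nonneg_right (by linarith) (hlog hw).le,
      div_le_div_of_nonneg_right (by linarith) (hlog hw).le⟩
  set K := 1000 + C + 2000 * (1 + C) / δ + 10 ^ 13 * (1 + P) + 2 * (24 * P + 9) * A with hK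
  have hC0 : 0 < C := by positivity
  have hA0 : 0 < A := by linarith
  have hq : 0 ≤ 2000 * (1 + C) / δ := by positivity
  have hq2 : 0 ≤ 2 * (24 * P + 9) * A := by positivity
  obtain ⟨x₀, hx₀⟩ := Filter.eventually_atTop.1
    (eventually_large (K := K) hδ0 (by linarith))
  refine ⟨x₀, fun x hx N => ?_⟩
  have H := hx₀ x hx
  refine (H.params (C := C) (P := P) (A := A) (fun s hs => scaleExp_le_half hδ0 hδ (by omega))
    hC0 (by linarith) ?_ hP (by linarith) hA1 (by linarith) (fun w z hw hz => ?_)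
    (fun w z hw hz => ?_) (fun w z hw hz => ?_) hPd hA).exists_int N
  · rw [← div_le_iff₀ hδ0]
    linarith
  · linarith [(h₁ w z hw hz).1, (hle hw).1]
  · linarith [(h₁ w z hw hz).2, (hle hw).1]
  · refine (h₂ w z hw hz).trans ?_
    have h3 := hlog hw
    have h4 := hlog (hw.trans hz)
    exact mul_le_mul_of_nonneg_left (Real.exp_le_exp.2 (hle hw).2) (by positivity)

end SieveGap

theorem stmt17 (δ : ℝ) (hδ0 : 0 < δ) (hδ1 : δ < 1/2)
    (hδ : 12 * (10 : ℝ) ^ (2 * δ) < Real.log (1 / (2 * δ))) :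
    ∃ x₀ : ℝ, ∀ x ≥ x₀, ∀ N : ℤ, ∃ b : ℤ,
      (∀ n : ℤ, 1 ≤ n → n ≤ (yy δ x : ℤ) →
        ∃ p : ℕ, p.Prime ∧ (p : ℝ) ≤ x ∧ (p : ℤ) ∣ (n - b)) ∧
      (∀ n : ℤ, -(yy δ x : ℤ) ≤ n → n ≤ -1 →
        ∃ p : ℕ, p.Prime ∧ (p : ℝ) ≤ x ∧ (p : ℤ) ∣ (n + N + b)) :=
  SieveGap.exists_int_of_large_gap hδ0 hδ
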